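/- Existence of planelike minimizers in periodic media: for every n ≥ 1 there exist η ∈ (0,1) and M > 1, depending only on n, such that the following holds. Let r ∈ (0,1) and let g : ℝⁿ → ℝ be ℤⁿ-periodic (g(x+k) = g(x) for all k ∈ ℤⁿ), with ∫_{[0,1]ⁿ} g = 0 and ‖g‖_{L^∞(ℝⁿ)} ≤ η. Then for every unit vector ω ∈ ℝⁿ there exists a measurable set E*_ω which is a Class A minimizer for F_{r,g} and satisfies {x ∈ ℝⁿ : ω · x ≤ −M} ⊆ E*_ω ⊆ {x ∈ ℝⁿ : ω · x ≤ M}. Moreover, if ω is rational (i.e. there exist n−1 linearly independent vectors K_1, …, K_{n−1} ∈ ℤⁿ with ω · K_j = 0 for all j), then E*_ω can be taken ω-periodic, i.e. E*_ω + k = E*_ω for every k ∈ ℤⁿ with ω · k = 0. -/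

import Mathlib

open MeasureTheory Metric Set Filter Topology
open scoped RealInnerProductSpace ENNReal

noncomputable section

/-- The set of points of Lebesgue density one of `E`. -/
def densityOnePoints (n : ℕ) (E : Set (EuclideanSpace ℝ (Fin n))) :
    Set (EuclideanSpace ℝ (Fin n)) :=
  {x | Tendsto (fun ρ : ℝ => volume (E ∩ ball x ρ) / volume (ball x ρ)) (𝓝[>] 0) (𝓝 1)}

/-- The `r`-perimeter `Per_r(E, Ω) = (1/(2r)) Lⁿ((∂E ⊕ B_r) ∩ Ω)`, where `E` is identified with
its points of density one, `∂E` is the topological boundary of that set, and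
`A ⊕ B_r` is the open `r`-neighbourhood of `A`. -/
def perR (n : ℕ) (r : ℝ) (E Ω : Set (EuclideanSpace ℝ (Fin n))) : ℝ≥0∞ :=
  volume (Metric.thickening r (frontier (densityOnePoints n E)) ∩ Ω) / ENNReal.ofReal (2 * r)

/-- The inner domain `D ⊖ B_r = {x ∈ D : dist(x, ∂D) ≥ r}`. -/
def innerDomain (n : ℕ) (r : ℝ) (D : Set (EuclideanSpace ℝ (Fin n))) :
    Set (EuclideanSpace ℝ (Fin n)) :=
  {x ∈ D | r ≤ Metric.infDist x (frontier D)}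

/-- The energy `F_{r,g}(E, Ω) = Per_r(E, Ω) + ∫_{E ∩ Ω} g`, as an extended real number. -/
def FRG (n : ℕ) (r : ℝ) (g : EuclideanSpace ℝ (Fin n) → ℝ)
    (E Ω : Set (EuclideanSpace ℝ (Fin n))) : EReal :=
  (perR n r E Ω : EReal) + ((∫ x in E ∩ Ω, g x : ℝ) : EReal)

/-- `E` is a minimizer of `F_{r,g}` in `D`: it minimizes among measurable competitors that
coincide with `E` outside `D ⊖ B_r`. -/
def IsMinimizerFRG (n : ℕ) (r : ℝ) (g : EuclideanSpace ℝ (Fin n) → ℝ)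
    (E D : Set (EuclideanSpace ℝ (Fin n))) : Prop :=
  ∀ F : Set (EuclideanSpace ℝ (Fin n)), MeasurableSet F →
    F \ innerDomain n r D = E \ innerDomain n r D → FRG n r g E D ≤ FRG n r g F D

/-- The point of `EuclideanSpace ℝ (Fin n)` with integer coordinates `k`. -/
def intVec (n : ℕ) (k : Fin n → ℤ) : EuclideanSpace ℝ (Fin n) :=
  (WithLp.equiv 2 (Fin n → ℝ)).symm (fun i => (k i : ℝ))

set_option linter.unusedSectionVars false
set_option linter.deprecated false
set_option linter.unusedVariables false
set_option linter.unusedSimpArgs false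

section Body
variable {V : Type*} [NormedAddCommGroup V] [InnerProductSpace ℝ V] [FiniteDimensional ℝ V]
  [MeasurableSpace V] [BorelSpace V] {μ : Measure V} [μ.IsAddHaarMeasure]

def PP (μ : Measure V) (r : ℝ) (E : Set V) : Set V := {x | 0 < μ (E ∩ ball x r)}

def NN (μ : Measure V) (r : ℝ) (E : Set V) : Set V := PP μ r E ∩ PP μ r Eᶜ

def JJ (μ : Measure V) (r : ℝ) (g : V → ℝ) (D E : Set V) : ℝ :=
  μ.real (NN μ r E ∩ D) / (2 * r) + ∫ x in E ∩ D, g x ∂μ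

/-- bounded measurable potentials -/
def GB (μ : Measure V) (g : V → ℝ) (b : ℝ) : Prop := Measurable g ∧ ∀ᵐ x ∂μ, |g x| ≤ b

/-- a.e. inclusion -/
abbrev AL (μ : Measure V) (A B : Set V) : Prop := ∀ᵐ x ∂μ, x ∈ A → x ∈ B

theorem notPP {r : ℝ} {A : Set V} {y : V} :
    y ∉ PP μ r A ↔ ∀ᵐ x ∂μ, x ∈ ball y r → x ∉ A := by
  unfold PP
  simp only [Set.mem_setOf_eq, not_lt, nonpos_iff_eq_zero]
  rw [measure_eq_zero_iff_ae_notMem]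
  refine ⟨fun h => ?_, fun h => ?_⟩ <;> filter_upwards [h] with x hx <;> simp only [mem_inter_iff] at * <;> tauto

theorem PP_imp {r : ℝ} {A B : Set V} {y : V}
    (h : ∀ᵐ x ∂μ, x ∈ ball y r → x ∈ A → x ∈ B) (hy : y ∈ PP μ r A) : y ∈ PP μ r B := by
  by_contra hB
  rw [notPP] at hB
  have : y ∉ PP μ r A := by
    rw [notPP]; filter_upwards [h, hB] with x h1 h2 h3 h4; exact h2 h3 (h1 h3 h4)
  exact this hy

theorem isOpen_PP (μ : Measure V) [μ.IsAddHaarMeasure] (r : ℝ) (E : Set V) : IsOpen (PP μ r E) := by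
  rw [Metric.isOpen_iff]
  intro x hx
  by_contra hcon
  push Not at hcon
  have key : ∀ n : ℕ, μ (E ∩ ball x (r - 1/((n:ℝ)+1))) = 0 := by
    intro n
    have hpos : (0:ℝ) < 1/((n:ℝ)+1) := by positivity
    have := hcon _ hpos
    rw [Set.not_subset] at this
    obtain ⟨y, hy, hyn⟩ := this
    unfold PP at hyn
    simp only [Set.mem_setOf_eq, not_lt, nonpos_iff_eq_zero] at hyn
    refine measure_mono_null ?_ hyn
    refine inter_subset_inter_right _ ?_
    apply ball_subset_ball'
    rw [mem_ball, dist_comm] at hy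
    linarith
  have hU : E ∩ ball x r ⊆ ⋃ n : ℕ, (E ∩ ball x (r - 1/((n:ℝ)+1))) := by
    intro z hz
    rw [mem_iUnion]
    have : 0 < r - dist z x := by have := hz.2; rw [mem_ball] at this; linarith
    obtain ⟨n, hn⟩ := exists_nat_one_div_lt this
    exact ⟨n, hz.1, by rw [mem_ball]; linarith⟩
  have h0 : μ (E ∩ ball x r) = 0 := measure_mono_null hU (measure_iUnion_null key)
  exact (ne_of_gt (show 0 < μ (E ∩ ball x r) from hx)) h0

theorem meas_PP (μ : Measure V) [μ.IsAddHaarMeasure] (r : ℝ) (E : Set V) : MeasurableSet (PP μ r E) :=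
  (isOpen_PP μ r E).measurableSet

theorem meas_NN (μ : Measure V) [μ.IsAddHaarMeasure] (r : ℝ) (E : Set V) : MeasurableSet (NN μ r E) :=
  (meas_PP μ r E).inter (meas_PP μ r Eᶜ)

theorem NN_compl (r : ℝ) (E : Set V) : NN μ r Eᶜ = NN μ r E := by
  unfold NN; rw [compl_compl, inter_comm]

theorem PP_union (r : ℝ) (A B : Set V) : PP μ r (A ∪ B) = PP μ r A ∪ PP μ r B := by
  ext y
  constructor
  · intro h
    by_contra hc
    rw [mem_union, not_or, notPP, notPP] at hc
    have : y ∉ PP μ r (A ∪ B) := by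
      rw [notPP]; filter_upwards [hc.1, hc.2] with x h1 h2 h3
      rw [mem_union]; tauto
    exact this h
  · rintro (h | h)
    · exact PP_imp (Eventually.of_forall fun x _ hx => Or.inl hx) h
    · exact PP_imp (Eventually.of_forall fun x _ hx => Or.inr hx) h

theorem PP_mono {r : ℝ} {A B : Set V} (h : AL μ A B) : PP μ r A ⊆ PP μ r B := fun _ hy =>
  PP_imp (by filter_upwards [h] with x hx _; exact hx) hy

theorem PP_sub {r : ℝ} {A B : Set V} (h : A ⊆ B) : PP μ r A ⊆ PP μ r B :=
  PP_mono (Eventually.of_forall fun _ hx => h hx)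

theorem NN_congr {r : ℝ} {A B : Set V} {y : V}
    (h : ∀ᵐ x ∂μ, x ∈ ball y r → (x ∈ A ↔ x ∈ B)) : y ∈ NN μ r A ↔ y ∈ NN μ r B := by
  have h1 : ∀ {A B : Set V}, (∀ᵐ x ∂μ, x ∈ ball y r → (x ∈ A ↔ x ∈ B)) → y ∈ NN μ r A → y ∈ NN μ r B := by
    intro A B h hy
    refine ⟨PP_imp ?_ hy.1, PP_imp ?_ hy.2⟩
    · filter_upwards [h] with x hx h1; exact (hx h1).1
    · filter_upwards [h] with x hx h1; exact fun h2 h3 => h2 ((hx h1).2 h3)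
  exact ⟨h1 h, h1 (by filter_upwards [h] with x hx h2; exact (hx h2).symm)⟩

theorem NN_union_inter (r : ℝ) (A B : Set V) :
    NN μ r (A ∪ B) ∪ NN μ r (A ∩ B) ⊆ NN μ r A ∪ NN μ r B := by
  have h1 : PP μ r (A ∪ B) = PP μ r A ∪ PP μ r B := PP_union r A B
  have h2 : PP μ r (A ∩ B)ᶜ = PP μ r Aᶜ ∪ PP μ r Bᶜ := by rw [compl_inter, PP_union]
  have h3 : PP μ r (A ∩ B) ⊆ PP μ r A ∩ PP μ r B := fun y hy =>
    ⟨PP_mono (Eventually.of_forall fun x hx => hx.1) hy, PP_mono (Eventually.of_forall fun x hx => hx.2) hy⟩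
  have h4 : PP μ r (A ∪ B)ᶜ ⊆ PP μ r Aᶜ ∩ PP μ r Bᶜ := fun y hy =>
    ⟨PP_sub (compl_subset_compl.2 subset_union_left) hy,
      PP_sub (compl_subset_compl.2 subset_union_right) hy⟩
  unfold NN
  rw [h1, h2]
  rintro y (⟨ha, hb⟩ | ⟨ha, hb⟩)
  · have := h4 hb; rcases ha with ha | ha
    · exact Or.inl ⟨ha, this.1⟩
    · exact Or.inr ⟨ha, this.2⟩
  · have := h3 ha; rcases hb with hb | hb
    · exact Or.inl ⟨this.1, hb⟩
    · exact Or.inr ⟨this.2, hb⟩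

theorem NN_inter_union (r : ℝ) (A B : Set V) :
    NN μ r (A ∪ B) ∩ NN μ r (A ∩ B) ⊆ NN μ r A ∩ NN μ r B := by
  have h3 : PP μ r (A ∩ B) ⊆ PP μ r A ∩ PP μ r B := fun y hy =>
    ⟨PP_mono (Eventually.of_forall fun x hx => hx.1) hy, PP_mono (Eventually.of_forall fun x hx => hx.2) hy⟩
  have h4 : PP μ r (A ∪ B)ᶜ ⊆ PP μ r Aᶜ ∩ PP μ r Bᶜ := fun y hy =>
    ⟨PP_sub (compl_subset_compl.2 subset_union_left) hy,
      PP_sub (compl_subset_compl.2 subset_union_right) hy⟩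
  rintro y ⟨⟨_, hb⟩, ⟨ha, _⟩⟩
  exact ⟨⟨(h3 ha).1, (h4 hb).1⟩, ⟨(h3 ha).2, (h4 hb).2⟩⟩

theorem mr_le {A B : Set V} (h : A ⊆ B) (hB : μ B ≠ ∞) : μ.real A ≤ μ.real B := measureReal_mono h hB

theorem fin_inter {A D : Set V} (hD : μ D ≠ ∞) : μ (A ∩ D) ≠ ∞ :=
  ne_top_of_le_ne_top hD (measure_mono inter_subset_right)

theorem fin_bdd {D : Set V} (hD : Bornology.IsBounded D) : μ D ≠ ∞ := hD.measure_lt_top.ne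

theorem per_submod (r : ℝ) {D A B : Set V} (hDm : MeasurableSet D) (hD : μ D ≠ ∞) :
    μ.real (NN μ r (A ∩ B) ∩ D) + μ.real (NN μ r (A ∪ B) ∩ D) ≤
      μ.real (NN μ r A ∩ D) + μ.real (NN μ r B ∩ D) := by
  have e1 := measureReal_union_add_inter (μ := μ) (s := NN μ r (A ∩ B) ∩ D)
    (t := NN μ r (A ∪ B) ∩ D) ((meas_NN μ r _).inter hDm) (fin_inter hD) (fin_inter hD)
  have e2 := measureReal_union_add_inter (μ := μ) (s := NN μ r A ∩ D)
    (t := NN μ r B ∩ D) ((meas_NN μ r _).inter hDm) (fin_inter hD) (fin_inter hD)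
  rw [← e1, ← e2]
  have hf : μ (NN μ r A ∩ D ∪ NN μ r B ∩ D) ≠ ∞ :=
    ne_top_of_le_ne_top hD (measure_mono (union_subset inter_subset_right inter_subset_right))
  refine add_le_add (mr_le ?_ hf) (mr_le ?_ (ne_top_of_le_ne_top hD (measure_mono fun x hx => hx.1.2)))
  · rw [← union_inter_distrib_right, ← union_inter_distrib_right, union_comm]
    exact inter_subset_inter_left _ (NN_union_inter r A B)
  · rintro x ⟨⟨h1, h2⟩, ⟨h3, _⟩⟩
    have := NN_inter_union r A B ⟨h3, h1⟩
    exact ⟨⟨this.1, h2⟩, ⟨this.2, h2⟩⟩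

theorem GB.intOn {g : V → ℝ} {b : ℝ} (hg : GB μ g b) {D : Set V} (hD : μ D ≠ ∞) :
    IntegrableOn g D μ := by
  refine Measure.integrableOn_of_bounded (M := b) hD hg.1.aestronglyMeasurable ?_
  exact ae_restrict_of_ae hg.2

theorem GB.bound {g : V → ℝ} {b : ℝ} (hg : GB μ g b) {D : Set V} (hD : μ D ≠ ∞) :
    |∫ x in D, g x ∂μ| ≤ b * μ.real D := by
  have := norm_setIntegral_le_of_norm_le_const_ae (μ := μ) (s := D) (f := g) (C := b) hD.lt_top ?_
  · simpa using this
  · exact ae_restrict_of_ae hg.2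

theorem GB.neg {g : V → ℝ} {b : ℝ} (hg : GB μ g b) : GB μ (fun x => - g x) b :=
  ⟨hg.1.neg, by simpa using hg.2⟩

theorem int_submod {g1 g2 : V → ℝ} {b1 b2 : ℝ} (h1 : GB μ g1 b1) (h2 : GB μ g2 b2)
    (hle : ∀ᵐ x ∂μ, g2 x ≤ g1 x)
    {D A B : Set V} (hDm : MeasurableSet D) (hD : μ D ≠ ∞) (hA : MeasurableSet A) (hB : MeasurableSet B) :
    (∫ x in (A ∩ B) ∩ D, g1 x ∂μ) + (∫ x in (A ∪ B) ∩ D, g2 x ∂μ) ≤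
      (∫ x in A ∩ D, g1 x ∂μ) + (∫ x in B ∩ D, g2 x ∂μ) := by
  have e1 : (∫ x in A ∩ D, g1 x ∂μ) = (∫ x in (A ∩ B) ∩ D, g1 x ∂μ) + ∫ x in (A \ B) ∩ D, g1 x ∂μ := by
    rw [← setIntegral_union _ ((hA.diff hB).inter hDm) (h1.intOn (fin_inter hD)) (h1.intOn (fin_inter hD))]
    · congr 2; ext x; simp only [mem_inter_iff, mem_union, mem_diff]; tauto
    · rw [Set.disjoint_left]; rintro x hx hy; exact hy.1.2 hx.1.2
  have e2 : (∫ x in (A ∪ B) ∩ D, g2 x ∂μ) = (∫ x in B ∩ D, g2 x ∂μ) + ∫ x in (A \ B) ∩ D, g2 x ∂μ := by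
    rw [← setIntegral_union _ ((hA.diff hB).inter hDm) (h2.intOn (fin_inter hD)) (h2.intOn (fin_inter hD))]
    · congr 2; ext x; simp only [mem_inter_iff, mem_union, mem_diff]; tauto
    · rw [Set.disjoint_left]; rintro x hx hy; exact hy.1.2 hx.1
  have e3 : (∫ x in (A \ B) ∩ D, g2 x ∂μ) ≤ ∫ x in (A \ B) ∩ D, g1 x ∂μ :=
    setIntegral_mono_ae (h2.intOn (fin_inter hD)) (h1.intOn (fin_inter hD)) hle
  linarith

theorem JJ_submod' {r : ℝ} (hr : 0 < r) {g1 g2 : V → ℝ} {b1 b2 : ℝ} (h1 : GB μ g1 b1) (h2 : GB μ g2 b2)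
    (hle : ∀ᵐ x ∂μ, g2 x ≤ g1 x)
    {D A B : Set V} (hDm : MeasurableSet D) (hD : μ D ≠ ∞) (hA : MeasurableSet A) (hB : MeasurableSet B) :
    JJ μ r g1 D (A ∩ B) + JJ μ r g2 D (A ∪ B) ≤ JJ μ r g1 D A + JJ μ r g2 D B := by
  unfold JJ
  have e1 := int_submod h1 h2 hle hDm hD hA hB
  have e2 := per_submod r (A := A) (B := B) hDm hD
  have e3 : (μ.real (NN μ r (A ∩ B) ∩ D) + μ.real (NN μ r (A ∪ B) ∩ D)) / (2 * r) ≤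
      (μ.real (NN μ r A ∩ D) + μ.real (NN μ r B ∩ D)) / (2 * r) := by gcongr
  rw [add_div, add_div] at e3
  linarith

theorem JJ_submod {r : ℝ} (hr : 0 < r) {g : V → ℝ} {b : ℝ} (h1 : GB μ g b)
    {D A B : Set V} (hDm : MeasurableSet D) (hD : μ D ≠ ∞) (hA : MeasurableSet A) (hB : MeasurableSet B) :
    JJ μ r g D (A ∩ B) + JJ μ r g D (A ∪ B) ≤ JJ μ r g D A + JJ μ r g D B :=
  JJ_submod' hr h1 h1 (Eventually.of_forall fun _ => le_rfl) hDm hD hA hB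

theorem JJ_compl {r : ℝ} {g : V → ℝ} {b : ℝ} (h1 : GB μ g b)
    {D A : Set V} (hDm : MeasurableSet D) (hD : μ D ≠ ∞) (hA : MeasurableSet A) :
    JJ μ r (fun x => - g x) D Aᶜ = JJ μ r g D A - ∫ x in D, g x ∂μ := by
  unfold JJ
  rw [NN_compl, integral_neg]
  have : (∫ x in D, g x ∂μ) = (∫ x in A ∩ D, g x ∂μ) + ∫ x in Aᶜ ∩ D, g x ∂μ := by
    rw [← setIntegral_union _ (hA.compl.inter hDm) (h1.intOn (fin_inter hD)) (h1.intOn (fin_inter hD))]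
    · congr 2; ext x; simp only [mem_inter_iff, mem_union, mem_compl_iff]; tauto
    · rw [Set.disjoint_left]; rintro x hx hy; exact hy.1 hx.1
  rw [this]; ring

theorem JJ_bound {r : ℝ} (hr : 0 < r) {g : V → ℝ} {b : ℝ} (h1 : GB μ g b) (hb : 0 ≤ b)
    {D A : Set V} (hD : μ D ≠ ∞) : - (b * μ.real D) ≤ JJ μ r g D A := by
  unfold JJ
  have e1 := h1.bound (D := A ∩ D) (fin_inter hD)
  have e2 : μ.real (A ∩ D) ≤ μ.real D := mr_le inter_subset_right hD
  have e3 : 0 ≤ μ.real (NN μ r A ∩ D) / (2 * r) := by positivity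
  have := neg_abs_le (∫ x in A ∩ D, g x ∂μ)
  nlinarith

theorem JJ_congr {r : ℝ} {g : V → ℝ} {D A B : Set V} (h : ∀ᵐ x ∂μ, x ∈ A ↔ x ∈ B) :
    JJ μ r g D A = JJ μ r g D B := by
  unfold JJ
  have e1 : NN μ r A = NN μ r B := by
    ext y; exact NN_congr (by filter_upwards [h] with x hx _; exact hx)
  have e2 : (∫ x in A ∩ D, g x ∂μ) = ∫ x in B ∩ D, g x ∂μ := by
    apply setIntegral_congr_set
    rw [eventuallyEq_set]
    filter_upwards [h] with x hx
    simp only [mem_inter_iff]; tauto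
  rw [e1, e2]

theorem lsc_mono {r : ℝ} (hr : 0 < r) {g : V → ℝ} {b : ℝ} (h1 : GB μ g b)
    {D : Set V} (hDm : MeasurableSet D) (hD : μ D ≠ ∞) {A : ℕ → Set V} (hA : ∀ i, MeasurableSet (A i))
    (hm : Monotone A) :
    ∃ q : ℕ → ℝ, Tendsto q atTop (𝓝 (JJ μ r g D (⋃ i, A i))) ∧ ∀ i, q i ≤ JJ μ r g D (A i) := by
  set U := ⋃ i, A i with hU
  set S : ℕ → Set V := fun i => PP μ r (A i) ∩ PP μ r Uᶜ ∩ D with hS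
  have hSm : Monotone S := by
    intro i j hij x hx
    exact ⟨⟨PP_mono (Eventually.of_forall fun z hz => hm hij hz) hx.1.1, hx.1.2⟩, hx.2⟩
  have hSU : ⋃ i, S i = NN μ r U ∩ D := by
    ext x
    simp only [mem_iUnion, hS, NN, mem_inter_iff]
    constructor
    · rintro ⟨i, ⟨h, h'⟩, h''⟩
      exact ⟨⟨PP_mono (Eventually.of_forall fun z hz => mem_iUnion.2 ⟨i, hz⟩) h, h'⟩, h''⟩
    · rintro ⟨⟨h, h'⟩, h''⟩
      by_contra hc
      push Not at hc
      have : ∀ i, x ∉ PP μ r (A i) := fun i hi => hc i ⟨hi, h'⟩ h''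
      have h2 : ∀ i, ∀ᵐ z ∂μ, z ∈ ball x r → z ∉ A i := fun i => notPP.1 (this i)
      rw [← ae_all_iff] at h2
      have : x ∉ PP μ r U := by
        rw [notPP]
        filter_upwards [h2] with z hz hz' hzU
        obtain ⟨i, hi⟩ := mem_iUnion.1 hzU
        exact hz i hz' hi
      exact this h
  have t1 : Tendsto (fun i => μ.real (S i)) atTop (𝓝 (μ.real (NN μ r U ∩ D))) := by
    rw [← hSU]
    refine (ENNReal.tendsto_toReal ?_).comp (tendsto_measure_iUnion_atTop hSm)
    rw [hSU]; exact fin_inter hD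
  have t2 : Tendsto (fun i => ∫ x in A i ∩ D, g x ∂μ) atTop (𝓝 (∫ x in U ∩ D, g x ∂μ)) := by
    have : U ∩ D = ⋃ i, (A i ∩ D) := by rw [hU, iUnion_inter]
    rw [this]
    apply tendsto_setIntegral_of_monotone
    · intro i; exact (hA i).inter hDm
    · intro i j hij; exact inter_subset_inter_left _ (hm hij)
    · rw [← this]; exact h1.intOn (fin_inter hD)
  refine ⟨fun i => μ.real (S i) / (2*r) + ∫ x in A i ∩ D, g x ∂μ, (t1.div_const _).add t2, fun i => ?_⟩
  unfold JJ
  have : μ.real (S i) ≤ μ.real (NN μ r (A i) ∩ D) := by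
    refine mr_le ?_ (fin_inter hD)
    rintro x ⟨⟨h, h'⟩, h''⟩
    exact ⟨⟨h, PP_sub (compl_subset_compl.2 (subset_iUnion A i)) h'⟩, h''⟩
  simp only []
  gcongr

theorem lsc_anti {r : ℝ} (hr : 0 < r) {g : V → ℝ} {b : ℝ} (h1 : GB μ g b)
    {D : Set V} (hDm : MeasurableSet D) (hD : μ D ≠ ∞) {A : ℕ → Set V} (hA : ∀ i, MeasurableSet (A i))
    (hm : Antitone A) :
    ∃ q : ℕ → ℝ, Tendsto q atTop (𝓝 (JJ μ r g D (⋂ i, A i))) ∧ ∀ i, q i ≤ JJ μ r g D (A i) := by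
  obtain ⟨q, hq, hq'⟩ := lsc_mono hr h1.neg hDm hD (A := fun i => (A i)ᶜ) (fun i => (hA i).compl)
    (fun i j hij => compl_subset_compl.2 (hm hij))
  refine ⟨fun i => q i + ∫ x in D, g x ∂μ, ?_, ?_⟩
  · have : (⋃ i, (A i)ᶜ) = (⋂ i, A i)ᶜ := by rw [compl_iInter]
    rw [this, JJ_compl h1 hDm hD (MeasurableSet.iInter hA)] at hq
    have := hq.add_const (∫ x in D, g x ∂μ)
    simpa using this
  · intro i
    have := hq' i
    rw [JJ_compl h1 hDm hD (hA i)] at this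
    linarith

/-- translate: `tr v A = A - v` -/
def tr (v : V) (A : Set V) : Set V := (fun x => x + v) ⁻¹' A

theorem mem_tr {v : V} {A : Set V} {x : V} : x ∈ tr v A ↔ x + v ∈ A := Iff.rfl

theorem meas_tr (v : V) {A : Set V} (hA : MeasurableSet A) : MeasurableSet (tr v A) :=
  (measurable_add_const v) hA

theorem measure_tr (v : V) (A : Set V) : μ (tr v A) = μ A := measure_preimage_add_right μ v A

theorem real_tr (v : V) (A : Set V) : μ.real (tr v A) = μ.real A := by
  simp only [Measure.real, measure_tr]

theorem ae_tr (v : V) {p : V → Prop} (h : ∀ᵐ x ∂μ, p x) : ∀ᵐ x ∂μ, p (x + v) :=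
  (measurePreserving_add_right μ v).quasiMeasurePreserving.ae h

theorem tr_ball (v x : V) (s : ℝ) : tr v (ball x s) = ball (x - v) s := by
  ext y; simp only [mem_tr, mem_ball, dist_eq_norm]
  rw [show y + v - x = y - (x - v) by abel]

theorem PP_tr (r : ℝ) (v : V) (A : Set V) : PP μ r (tr v A) = tr v (PP μ r A) := by
  ext y
  rw [mem_tr]
  unfold PP
  simp only [Set.mem_setOf_eq]
  have : tr v A ∩ ball y r = tr v (A ∩ ball (y + v) r) := by
    have : ball y r = tr v (ball (y+v) r) := by rw [tr_ball]; simp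
    rw [this]; rfl
  rw [this, measure_tr]

theorem NN_tr (r : ℝ) (v : V) (A : Set V) : NN μ r (tr v A) = tr v (NN μ r A) := by
  unfold NN
  have : (tr v A)ᶜ = tr v Aᶜ := rfl
  rw [this, PP_tr, PP_tr]; rfl

theorem int_tr (v : V) {g : V → ℝ} (hg : ∀ x, g (x + v) = g x) {A : Set V} :
    (∫ x in tr v A, g x ∂μ) = ∫ x in A, g x ∂μ := by
  have := (measurePreserving_add_right μ v).setIntegral_preimage_emb (measurableEmbedding_addRight v) g A
  rw [← this]
  simp only [hg]; rfl

theorem JJ_tr {r : ℝ} (v : V) {g : V → ℝ} (hg : ∀ x, g (x + v) = g x) (D A : Set V) :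
    JJ μ r g (tr v D) (tr v A) = JJ μ r g D A := by
  unfold JJ
  rw [NN_tr]
  have e1 : tr v (NN μ r A) ∩ tr v D = tr v (NN μ r A ∩ D) := rfl
  have e2 : tr v A ∩ tr v D = tr v (A ∩ D) := rfl
  rw [e1, e2, real_tr, int_tr v hg]

/-- ample domain for perturbations in `K` -/
structure Amp (r : ℝ) (K D : Set V) : Prop where
  meas : MeasurableSet D
  bdd : Bornology.IsBounded D
  far : ∀ x ∈ K, ∀ y, y ∉ D → r ≤ dist x y

theorem Amp.fin {r : ℝ} {K D : Set V} (h : Amp r K D) : μ D ≠ ∞ := fin_bdd h.bdd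

theorem Amp.sub {r : ℝ} {K D : Set V} (hr : 0 < r) (h : Amp r K D) : K ⊆ D := by
  intro x hx; by_contra hc
  have := h.far x hx x hc
  rw [dist_self] at this; linarith

theorem Amp.inter {r : ℝ} {K D D' : Set V} (h : Amp r K D) (h' : Amp r K D') : Amp r K (D ∩ D') :=
  ⟨h.meas.inter h'.meas, h.bdd.subset inter_subset_left, fun x hx y hy => by
    by_cases hD : y ∈ D
    · exact h'.far x hx y fun h => hy ⟨hD, h⟩
    · exact h.far x hx y hD⟩

theorem Amp.anti {r : ℝ} {K K' D : Set V} (h : Amp r K D) (h' : K' ⊆ K) : Amp r K' D :=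
  ⟨h.meas, h.bdd, fun x hx => h.far x (h' hx)⟩

theorem Amp.ball {r R s : ℝ} {x : V} (h : R + r ≤ s) : Amp r (ball x R) (Metric.ball x s) :=
  ⟨measurableSet_ball, isBounded_ball, fun z hz y hy => by
    rw [mem_ball] at hz hy
    have := dist_triangle y z x
    rw [dist_comm z y]; linarith⟩

theorem Amp.closedBall {r R s : ℝ} {x : V} (h : R + r ≤ s) : Amp r (closedBall x R) (Metric.ball x s) :=
  ⟨measurableSet_ball, isBounded_ball, fun z hz y hy => by
    rw [mem_closedBall] at hz; rw [mem_ball] at hy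
    have := dist_triangle y z x
    rw [dist_comm z y]; linarith⟩

theorem Amp.tr {r : ℝ} {K D : Set V} (h : Amp r K D) (v : V) : Amp r (tr v K) (tr v D) :=
  ⟨meas_tr v h.meas, by
    have := h.bdd
    rw [isBounded_iff_subset_ball (0:V)] at this ⊢
    obtain ⟨R, hR⟩ := this
    refine ⟨R + ‖v‖, fun x hx => ?_⟩
    have := hR hx
    rw [mem_ball_zero_iff] at this ⊢
    have h2 : ‖x‖ ≤ ‖x + v‖ + ‖v‖ := by
      have := norm_sub_le (x + v) v
      simpa using this
    linarith, fun x hx y hy => by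
      have := h.far _ hx _ hy
      simpa using this⟩

theorem JJ_diff_aux {r : ℝ} (hr : 0 < r) {g : V → ℝ} {b : ℝ} (h1 : GB μ g b) {K D D' E F : Set V}
    (hD : Amp r K D) (hD' : Amp r K D') (hs : D ⊆ D') (hE : MeasurableSet E) (hF : MeasurableSet F)
    (hEF : ∀ᵐ x ∂μ, x ∉ K → (x ∈ E ↔ x ∈ F)) :
    JJ μ r g D F - JJ μ r g D E = JJ μ r g D' F - JJ μ r g D' E := by
  have e1 : ∀ A, μ.real (NN μ r A ∩ D') = μ.real (NN μ r A ∩ D) + μ.real (NN μ r A ∩ (D' \ D)) := by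
    intro A
    rw [← measureReal_union _ ((meas_NN μ r A).inter (hD'.meas.diff hD.meas)) (fin_inter hD.fin)
      (ne_top_of_le_ne_top (hD'.fin (μ := μ)) (measure_mono fun x hx => hx.2.1))]
    · congr 1; ext x; simp only [mem_inter_iff, mem_union, mem_diff]
      have := @hs x; tauto
    · rw [Set.disjoint_left]; rintro x hx hy; exact hy.2.2 hx.2
  have e2 : ∀ A, MeasurableSet A → (∫ x in A ∩ D', g x ∂μ) = (∫ x in A ∩ D, g x ∂μ) + ∫ x in A ∩ (D' \ D), g x ∂μ := by
    intro A hA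
    rw [← setIntegral_union _ (hA.inter (hD'.meas.diff hD.meas)) (h1.intOn (fin_inter hD.fin))
      (h1.intOn (ne_top_of_le_ne_top (hD'.fin (μ := μ)) (measure_mono fun x hx => hx.2.1)))]
    · congr 2; ext x; simp only [mem_inter_iff, mem_union, mem_diff]
      have := @hs x; tauto
    · rw [Set.disjoint_left]; rintro x hx hy; exact hy.2.2 hx.2
  have e3 : NN μ r E ∩ (D' \ D) = NN μ r F ∩ (D' \ D) := by
    ext y
    simp only [mem_inter_iff]
    apply and_congr_left
    intro hy
    apply NN_congr
    filter_upwards [hEF] with x hx hxy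
    apply hx
    intro hK
    have := hD.far x hK y hy.2
    rw [mem_ball] at hxy; linarith
  have e4 : (∫ x in E ∩ (D' \ D), g x ∂μ) = ∫ x in F ∩ (D' \ D), g x ∂μ := by
    apply setIntegral_congr_set
    rw [eventuallyEq_set]
    filter_upwards [hEF] with x hx
    have : x ∈ K → x ∈ D := fun h => hD.sub hr h
    simp only [mem_inter_iff, mem_diff]; tauto
  unfold JJ
  rw [e1 E, e1 F, e2 E hE, e2 F hF, e3, e4]; ring

theorem JJ_diff {r : ℝ} (hr : 0 < r) {g : V → ℝ} {b : ℝ} (h1 : GB μ g b) {K D D' E F : Set V}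
    (hD : Amp r K D) (hD' : Amp r K D') (hE : MeasurableSet E) (hF : MeasurableSet F)
    (hEF : ∀ᵐ x ∂μ, x ∉ K → (x ∈ E ↔ x ∈ F)) :
    JJ μ r g D F - JJ μ r g D E = JJ μ r g D' F - JJ μ r g D' E := by
  rw [← JJ_diff_aux hr h1 (hD.inter hD') hD inter_subset_left hE hF hEF,
    ← JJ_diff_aux hr h1 (hD.inter hD') hD' inter_subset_right hE hF hEF]



theorem abs_exists {X : Type*} (C : Set (Set X)) (Φ : Set X → ℝ) (hne : C.Nonempty)
    (hi : ∀ A ∈ C, ∀ B ∈ C, A ∩ B ∈ C) (hu : ∀ A ∈ C, ∀ B ∈ C, A ∪ B ∈ C)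
    (hU : ∀ A : ℕ → Set X, (∀ i, A i ∈ C) → Monotone A → (⋃ i, A i) ∈ C)
    (hI : ∀ A : ℕ → Set X, (∀ i, A i ∈ C) → Antitone A → (⋂ i, A i) ∈ C)
    (hs : ∀ A ∈ C, ∀ B ∈ C, Φ (A ∩ B) + Φ (A ∪ B) ≤ Φ A + Φ B)
    (hlU : ∀ A : ℕ → Set X, (∀ i, A i ∈ C) → Monotone A → ∀ c, (∀ i, Φ (A i) ≤ c) → Φ (⋃ i, A i) ≤ c)
    (hlI : ∀ A : ℕ → Set X, (∀ i, A i ∈ C) → Antitone A → ∀ c, (∀ i, Φ (A i) ≤ c) → Φ (⋂ i, A i) ≤ c)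
    (m : ℝ) (hm : ∀ A ∈ C, m ≤ Φ A) : ∃ E ∈ C, ∀ F ∈ C, Φ E ≤ Φ F := by
  set I := sInf (Φ '' C) with hIdef
  have hbdd : BddBelow (Φ '' C) := ⟨m, by rintro _ ⟨A, hA, rfl⟩; exact hm A hA⟩
  have hIle : ∀ A ∈ C, I ≤ Φ A := fun A hA => csInf_le hbdd ⟨A, hA, rfl⟩
  have hex : ∀ k : ℕ, ∃ A ∈ C, Φ A ≤ I + (1/2:ℝ)^k := by
    intro k
    have : I < I + (1/2:ℝ)^k := by have : (0:ℝ) < (1/2:ℝ)^k := by positivity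
                                   linarith
    obtain ⟨_, ⟨A, hA, rfl⟩, h⟩ := exists_lt_of_csInf_lt (hne.image Φ) this
    exact ⟨A, hA, h.le⟩
  choose E hEC hE using hex
  have hcap : ∀ A ∈ C, ∀ B ∈ C, ∀ a b, Φ A ≤ I + a → Φ B ≤ I + b → Φ (A ∩ B) ≤ I + (a + b) := by
    intro A hA B hB a b ha hb
    have := hs A hA B hB
    have := hIle _ (hu A hA B hB)
    linarith
  set G : ℕ → ℕ → Set X := fun m M => {x | ∀ i ≤ M, x ∈ E (m + i)} with hG
  have hGs : ∀ m M, G m (M+1) = G m M ∩ E (m + (M+1)) := by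
    intro m M; ext x
    simp only [hG, Set.mem_setOf_eq, mem_inter_iff]
    constructor
    · intro h; exact ⟨fun i hi => h i (by omega), h _ le_rfl⟩
    · rintro ⟨h1, h2⟩ i hi
      rcases Nat.lt_or_ge M i with h | h
      · have : i = M + 1 := by omega
        subst this; exact h2
      · exact h1 i h
  have hGC : ∀ m M, G m M ∈ C ∧ Φ (G m M) ≤ I + (2 * (1/2:ℝ)^m - (1/2:ℝ)^(m+M)) := by
    intro m M
    induction M with
    | zero =>
      have : G m 0 = E m := by ext x; simp [hG]
      rw [this]
      refine ⟨hEC m, ?_⟩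
      have := hE m
      simp only [add_zero]; linarith
    | succ M ih =>
      rw [hGs]
      refine ⟨hi _ ih.1 _ (hEC _), ?_⟩
      have := hcap _ ih.1 _ (hEC (m + (M+1))) _ _ ih.2 (hE _)
      refine this.trans ?_
      have : (1/2:ℝ)^(m+M) = 2 * (1/2:ℝ)^(m+(M+1)) := by rw [← add_assoc, pow_succ]; ring
      linarith
  set H : ℕ → Set X := fun m => ⋂ M, G m M with hH
  have hGa : ∀ m, Antitone (G m) := by
    intro m i j hij x hx k hk
    exact hx k (hk.trans hij)
  have hHC : ∀ m, H m ∈ C := fun m => hI _ (fun M => (hGC m M).1) (hGa m)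
  have hHΦ : ∀ m, Φ (H m) ≤ I + 2 * (1/2:ℝ)^m := by
    intro m
    apply hlI _ (fun M => (hGC m M).1) (hGa m)
    intro M
    have := (hGC m M).2
    have h2 : (0:ℝ) < (1/2:ℝ)^(m+M) := by positivity
    linarith
  have hHm : Monotone H := by
    intro i j hij x hx
    simp only [hH, mem_iInter, hG, Set.mem_setOf_eq] at hx ⊢
    intro M k _
    have := hx (j - i + k) (j - i + k) le_rfl
    rwa [show i + (j - i + k) = j + k by omega] at this
  refine ⟨⋃ m, H m, hU _ hHC hHm, fun F hF => ?_⟩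
  refine le_trans ?_ (hIle F hF)
  have hall : ∀ m : ℕ, Φ (⋃ m, H m) ≤ I + 2 * (1/2:ℝ)^m := by
    intro m
    have e : (⋃ m, H m) = ⋃ i, H (m + i) := by
      apply Subset.antisymm
      · apply iUnion_subset; intro i
        exact (hHm (Nat.le_add_left i m)).trans (subset_iUnion (fun i => H (m+i)) i)
      · apply iUnion_subset; intro i
        exact subset_iUnion H (m+i)
    rw [e]
    apply hlU _ (fun i => hHC _) (fun i j hij => hHm (by omega))
    intro i
    refine (hHΦ _).trans ?_
    have : (1/2:ℝ)^(m+i) ≤ (1/2:ℝ)^m := pow_le_pow_of_le_one (by norm_num) (by norm_num) (by omega)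
    linarith
  have ht : Tendsto (fun m : ℕ => I + 2 * (1/2:ℝ)^m) atTop (𝓝 (I + 2 * 0)) :=
    ((tendsto_pow_atTop_nhds_zero_of_lt_one (by norm_num) (by norm_num)).const_mul 2).const_add I
  have := ge_of_tendsto' ht hall
  linarith

/-- minimal minimizer between `L` and `U` -/
structure MinIn (μ : Measure V) (r : ℝ) (g : V → ℝ) (L U E : Set V) : Prop where
  meas : MeasurableSet E
  low : AL μ L E
  up : AL μ E U
  min : ∀ D, Amp r (U \ L) D → ∀ F, MeasurableSet F → AL μ L F → AL μ F U →
    JJ μ r g D E ≤ JJ μ r g D F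
  least : ∀ D, Amp r (U \ L) D → ∀ F, MeasurableSet F → AL μ L F → AL μ F U →
    JJ μ r g D F ≤ JJ μ r g D E → AL μ E F

theorem exists_amp (r : ℝ) {K : Set V} (h : Bornology.IsBounded K) :
    ∃ R0 : ℝ, ∀ R, R0 ≤ R → Amp r K (ball (0:V) R) := by
  rw [isBounded_iff_subset_ball (0:V)] at h
  obtain ⟨R, hR⟩ := h
  exact ⟨R + r, fun R' hR' => (Amp.ball hR').anti hR⟩

theorem exists_MinIn {r : ℝ} (hr : 0 < r) {g : V → ℝ} {b : ℝ} (hb : 0 ≤ b) (hg : GB μ g b) {L U : Set V}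
    (hL : MeasurableSet L) (hU : MeasurableSet U) (hLU : L ⊆ U) (hbd : Bornology.IsBounded (U \ L)) :
    ∃ E, MinIn μ r g L U E := by
  obtain ⟨R0, hR0⟩ := exists_amp r hbd
  set D := ball (0:V) R0 with hDdef
  have hD : Amp r (U \ L) D := hR0 R0 le_rfl
  have hDf : μ D ≠ ∞ := hD.fin
  set C : Set (Set V) := {F | MeasurableSet F ∧ AL μ L F ∧ AL μ F U} with hC
  have ci : ∀ A ∈ C, ∀ B ∈ C, A ∩ B ∈ C := by
    rintro A ⟨h1, h2, h3⟩ B ⟨h4, h5, h6⟩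
    refine ⟨h1.inter h4, ?_, ?_⟩
    · filter_upwards [h2, h5] with x; rw [mem_inter_iff]; tauto
    · filter_upwards [h3, h6] with x; rw [mem_inter_iff]; tauto
  have cu : ∀ A ∈ C, ∀ B ∈ C, A ∪ B ∈ C := by
    rintro A ⟨h1, h2, h3⟩ B ⟨h4, h5, h6⟩
    refine ⟨h1.union h4, ?_, ?_⟩
    · filter_upwards [h2, h5] with x; rw [mem_union]; tauto
    · filter_upwards [h3, h6] with x; rw [mem_union]; tauto
  have cU : ∀ A : ℕ → Set V, (∀ i, A i ∈ C) → (⋃ i, A i) ∈ C := by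
    intro A hA
    refine ⟨MeasurableSet.iUnion fun i => (hA i).1, ?_, ?_⟩
    · filter_upwards [(hA 0).2.1] with x hx hxL; exact mem_iUnion.2 ⟨0, hx hxL⟩
    · have := ae_all_iff.2 fun i => (hA i).2.2
      filter_upwards [this] with x hx hxL
      obtain ⟨i, hi⟩ := mem_iUnion.1 hxL
      exact hx i hi
  have cI : ∀ A : ℕ → Set V, (∀ i, A i ∈ C) → (⋂ i, A i) ∈ C := by
    intro A hA
    refine ⟨MeasurableSet.iInter fun i => (hA i).1, ?_, ?_⟩
    · have := ae_all_iff.2 fun i => (hA i).2.1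
      filter_upwards [this] with x hx hxL
      exact mem_iInter.2 fun i => hx i hxL
    · filter_upwards [(hA 0).2.2] with x hx hxL; exact hx (mem_iInter.1 hxL 0)
  have sm : ∀ A ∈ C, ∀ B ∈ C, JJ μ r g D (A ∩ B) + JJ μ r g D (A ∪ B) ≤ JJ μ r g D A + JJ μ r g D B :=
    fun A hA B hB => JJ_submod hr hg hD.meas hDf hA.1 hB.1
  have lU : ∀ A : ℕ → Set V, (∀ i, A i ∈ C) → Monotone A → ∀ c, (∀ i, JJ μ r g D (A i) ≤ c) →
      JJ μ r g D (⋃ i, A i) ≤ c := by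
    intro A hA hm c hc
    obtain ⟨q, hq, hq'⟩ := lsc_mono hr hg hD.meas hDf (fun i => (hA i).1) hm
    exact le_of_tendsto' hq fun i => (hq' i).trans (hc i)
  have lI : ∀ A : ℕ → Set V, (∀ i, A i ∈ C) → Antitone A → ∀ c, (∀ i, JJ μ r g D (A i) ≤ c) →
      JJ μ r g D (⋂ i, A i) ≤ c := by
    intro A hA hm c hc
    obtain ⟨q, hq, hq'⟩ := lsc_anti hr hg hD.meas hDf (fun i => (hA i).1) hm
    exact le_of_tendsto' hq fun i => (hq' i).trans (hc i)
  have hLC : L ∈ C := ⟨hL, Eventually.of_forall fun _ h => h, Eventually.of_forall fun _ h => hLU h⟩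
  obtain ⟨E0, hE0C, hE0⟩ := abs_exists C (JJ μ r g D) ⟨L, hLC⟩ ci cu (fun A hA _ => cU A hA)
    (fun A hA _ => cI A hA) sm lU lI _ (fun A _ => JJ_bound hr hg hb hDf)
  set C' : Set (Set V) := {F | F ∈ C ∧ ∀ G ∈ C, JJ μ r g D F ≤ JJ μ r g D G} with hC'
  have mod : ∀ A ∈ C', ∀ B ∈ C', μ.real ((A ∩ B) ∩ D) + μ.real ((A ∪ B) ∩ D) ≤ μ.real (A ∩ D) + μ.real (B ∩ D) := by
    rintro A ⟨hA, _⟩ B ⟨hB, _⟩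
    have := measureReal_union_add_inter (μ := μ) (s := A ∩ D) (t := B ∩ D) (hB.1.inter hD.meas)
      (fin_inter hDf) (fin_inter hDf)
    rw [← this, union_inter_distrib_right, inter_inter_distrib_right]; linarith
  obtain ⟨E, hEC', hE⟩ := abs_exists C' (fun A => μ.real (A ∩ D)) ⟨E0, hE0C, hE0⟩
    (by
      rintro A ⟨hA, hA'⟩ B ⟨hB, hB'⟩
      refine ⟨ci A hA B hB, fun G hG => ?_⟩
      have := sm A hA B hB
      have h1 := hA' _ (cu A hA B hB)
      have h2 := hB' G hG
      linarith)
    (by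
      rintro A ⟨hA, hA'⟩ B ⟨hB, hB'⟩
      refine ⟨cu A hA B hB, fun G hG => ?_⟩
      have := sm A hA B hB
      have h1 := hA' _ (ci A hA B hB)
      have h2 := hB' G hG
      linarith)
    (fun A hA hm => ⟨cU A fun i => (hA i).1, fun G hG => lU A (fun i => (hA i).1) hm _ fun i => (hA i).2 G hG⟩)
    (fun A hA hm => ⟨cI A fun i => (hA i).1, fun G hG => lI A (fun i => (hA i).1) hm _ fun i => (hA i).2 G hG⟩)
    mod
    (by
      intro A hA hm c hc
      have : Tendsto (fun i => μ.real (A i ∩ D)) atTop (𝓝 (μ.real ((⋃ i, A i) ∩ D))) := by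
        rw [iUnion_inter]
        refine (ENNReal.tendsto_toReal ?_).comp (tendsto_measure_iUnion_atTop ?_)
        · rw [← iUnion_inter]; exact fin_inter hDf
        · intro i j hij; exact inter_subset_inter_left _ (hm hij)
      exact le_of_tendsto' this hc)
    (by
      intro A hA hm c hc
      refine le_trans ?_ (hc 0)
      exact mr_le (inter_subset_inter_left _ (iInter_subset A 0)) (fin_inter hDf))
    0 (fun A _ => measureReal_nonneg)
  have off : ∀ F ∈ C, ∀ᵐ x ∂μ, x ∉ U \ L → (x ∈ E ↔ x ∈ F) := by
    rintro F ⟨_, h1, h2⟩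
    filter_upwards [h1, h2, hEC'.1.2.1, hEC'.1.2.2] with x
    rw [mem_diff]; tauto
  refine ⟨E, hEC'.1.1, hEC'.1.2.1, hEC'.1.2.2, ?_, ?_⟩
  · intro D' hD' F h1 h2 h3
    have e := JJ_diff hr hg hD hD' hEC'.1.1 h1 (off F ⟨h1, h2, h3⟩)
    have := hEC'.2 F ⟨h1, h2, h3⟩
    linarith
  · intro D' hD' F h1 h2 h3 hle
    have e := JJ_diff hr hg hD hD' hEC'.1.1 h1 (off F ⟨h1, h2, h3⟩)
    have hFC : F ∈ C := ⟨h1, h2, h3⟩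
    have h4 : E ∩ F ∈ C' := by
      refine ⟨ci _ hEC'.1 _ hFC, fun G hG => ?_⟩
      have := sm E hEC'.1 F hFC
      have a1 := hEC'.2 _ (cu _ hEC'.1 _ hFC)
      have a2 := hEC'.2 G hG
      linarith
    have h5 := hE _ h4
    have h6 : μ.real (E ∩ D) = μ.real ((E ∩ F) ∩ D) + μ.real ((E \ F) ∩ D) := by
      rw [← measureReal_union _ ((hEC'.1.1.diff h1).inter hD.meas) (fin_inter hDf) (fin_inter hDf)]
      · congr 1; ext x; simp only [mem_inter_iff, mem_union, mem_diff]; tauto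
      · rw [Set.disjoint_left]; rintro x hx hy; exact hy.1.2 hx.1.2
    have h7 : μ.real ((E \ F) ∩ D) = 0 := le_antisymm (by linarith) measureReal_nonneg
    rw [measureReal_eq_zero_iff (fin_inter hDf), measure_eq_zero_iff_ae_notMem] at h7
    filter_upwards [h7, off F hFC] with x hx hx2 hxE
    by_contra hxF
    have : x ∉ D := fun h => hx ⟨⟨hxE, hxF⟩, h⟩
    have h8 : x ∉ U \ L := fun h => this (hD.sub hr h)
    exact hxF ((hx2 h8).1 hxE)

theorem MinIn.comp {r : ℝ} (hr : 0 < r) {g1 g2 : V → ℝ} {b1 b2 : ℝ} (hg1 : GB μ g1 b1) (hg2 : GB μ g2 b2)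
    (hle : ∀ᵐ x ∂μ, g2 x ≤ g1 x) {L U L' U' E E' : Set V}
    (hbd : Bornology.IsBounded (U \ L)) (hbd' : Bornology.IsBounded (U' \ L'))
    (hL : L ⊆ L') (hU : U ⊆ U') (h : MinIn μ r g1 L U E) (h' : MinIn μ r g2 L' U' E') : AL μ E E' := by
  obtain ⟨R0, hR0⟩ := exists_amp r hbd
  obtain ⟨R1, hR1⟩ := exists_amp r hbd'
  have hD := hR0 (max R0 R1) (le_max_left _ _)
  have hD' := hR1 (max R0 R1) (le_max_right _ _)
  have s := JJ_submod' hr hg1 hg2 hle hD.meas hD.fin h.meas h'.meas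
  have a := h'.min _ hD' (E ∪ E') (h.meas.union h'.meas)
    (by filter_upwards [h'.low] with x hx hxL; exact Or.inr (hx hxL))
    (by filter_upwards [h.up, h'.up] with x h1 h2 h3
        rcases h3 with h3 | h3
        · exact hU (h1 h3)
        · exact h2 h3)
  have b := h.least _ hD (E ∩ E') (h.meas.inter h'.meas)
    (by filter_upwards [h.low, h'.low] with x h1 h2 h3; exact ⟨h1 h3, h2 (hL h3)⟩)
    (by filter_upwards [h.up] with x h1 h3; exact h1 h3.1) (by linarith)
  filter_upwards [b] with x hx hxE; exact (hx hxE).2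

theorem tr_neg (v : V) (A : Set V) : tr v (tr (-v) A) = A := by
  ext x; simp [mem_tr]

theorem tr_neg' (v : V) (A : Set V) : tr (-v) (tr v A) = A := by
  ext x; simp [mem_tr]

theorem MinIn.tr {r : ℝ} {g : V → ℝ} {L U E : Set V} (h : MinIn μ r g L U E) (v : V)
    (hg : ∀ x, g (x + v) = g x) : MinIn μ r g (tr v L) (tr v U) (tr v E) := by
  have key : ∀ D, Amp r (_root_.tr v U \ _root_.tr v L) D → Amp r (U \ L) (_root_.tr (-v) D) := by
    intro D hD
    have := hD.tr (-v)
    have e : _root_.tr (-v) (_root_.tr v U \ _root_.tr v L) = U \ L := by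
      ext x; simp [mem_tr]
    rwa [e] at this
  have hF1 : ∀ F, AL μ (_root_.tr v L) F → AL μ L (_root_.tr (-v) F) := by
    intro F hF
    filter_upwards [ae_tr (-v) hF] with x hx hxL
    apply hx; simpa [mem_tr] using hxL
  have hF2 : ∀ F, AL μ F (_root_.tr v U) → AL μ (_root_.tr (-v) F) U := by
    intro F hF
    filter_upwards [ae_tr (-v) hF] with x hx hxL
    have := hx hxL; simpa [mem_tr] using this
  have e : ∀ D A, JJ μ r g D A = JJ μ r g (_root_.tr (-v) D) (_root_.tr (-v) A) := by
    intro D A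
    rw [JJ_tr (-v)]
    intro x
    have := hg (x + -v); simpa using this.symm
  refine ⟨meas_tr v h.meas, ae_tr v h.low, ae_tr v h.up, ?_, ?_⟩
  · intro D hD F h1 h2 h3
    rw [e D F, e D, tr_neg']
    exact h.min _ (key D hD) _ (meas_tr _ h1) (hF1 F h2) (hF2 F h3)
  · intro D hD F h1 h2 h3 h4
    rw [e D F, e D, tr_neg'] at h4
    have := h.least _ (key D hD) _ (meas_tr _ h1) (hF1 F h2) (hF2 F h3) h4
    filter_upwards [ae_tr v this] with x hx hxE
    have := hx hxE; simpa [mem_tr] using this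


theorem JJ_add {r : ℝ} {g : V → ℝ} {b : ℝ} (hg : GB μ g b) {D1 D2 A : Set V} (h1 : MeasurableSet D1)
    (h2 : MeasurableSet D2) (hA : MeasurableSet A) (hd : Disjoint D1 D2) (f1 : μ D1 ≠ ∞) (f2 : μ D2 ≠ ∞) :
    JJ μ r g (D1 ∪ D2) A = JJ μ r g D1 A + JJ μ r g D2 A := by
  unfold JJ
  rw [inter_union_distrib_left, inter_union_distrib_left,
    measureReal_union (hd.mono inter_subset_right inter_subset_right) ((meas_NN μ r A).inter h2)
      (fin_inter f1) (fin_inter f2),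
    setIntegral_union (hd.mono inter_subset_right inter_subset_right) (hA.inter h2)
      (hg.intOn (fin_inter f1)) (hg.intOn (fin_inter f2))]
  ring

theorem GB.addc {g : V → ℝ} {b : ℝ} (hg : GB μ g b) (c : ℝ) : GB μ (fun x => g x + c) (b + |c|) :=
  ⟨hg.1.add_const c, by
    filter_upwards [hg.2] with x hx
    exact (abs_add_le _ _).trans (by linarith)⟩

theorem JJ_const {r : ℝ} {g : V → ℝ} {b : ℝ} (hg : GB μ g b) (c : ℝ) {D A : Set V} (f : μ D ≠ ∞) :
    JJ μ r (fun x => g x + c) D A = JJ μ r g D A + c * μ.real (A ∩ D) := by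
  unfold JJ
  have : (∫ x in A ∩ D, (g x + c) ∂μ) = (∫ x in A ∩ D, g x ∂μ) + ∫ x in A ∩ D, c ∂μ :=
    integral_add (hg.intOn (fin_inter f)) (integrableOn_const (fin_inter f))
  rw [this, setIntegral_const, smul_eq_mul]; ring

theorem PP_iUnion (r : ℝ) (A : ℕ → Set V) : PP μ r (⋃ i, A i) = ⋃ i, PP μ r (A i) := by
  apply Subset.antisymm
  · intro x h
    by_contra hc
    rw [mem_iUnion] at hc
    push Not at hc
    have h2 : ∀ i, ∀ᵐ z ∂μ, z ∈ ball x r → z ∉ A i := fun i => notPP.1 (hc i)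
    rw [← ae_all_iff] at h2
    have : x ∉ PP μ r (⋃ i, A i) := by
      rw [notPP]
      filter_upwards [h2] with z hz hz' hzU
      obtain ⟨i, hi⟩ := mem_iUnion.1 hzU
      exact hz i hz' hi
    exact this h
  · exact iUnion_subset fun i => PP_sub (subset_iUnion A i)

theorem diff_tendsto {A : ℕ → Set V} (hA : ∀ i, MeasurableSet (A i)) (hm : Monotone A) {D : Set V}
    (hD : MeasurableSet D) (f : μ D ≠ ∞) :
    Tendsto (fun i => μ.real (((⋃ j, A j) \ A i) ∩ D)) atTop (𝓝 0) := by
  have t : Tendsto (fun i => μ.real (A i ∩ D)) atTop (𝓝 (μ.real ((⋃ i, A i) ∩ D))) := by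
    rw [iUnion_inter]
    refine (ENNReal.tendsto_toReal ?_).comp (tendsto_measure_iUnion_atTop ?_)
    · rw [← iUnion_inter]; exact fin_inter f
    · intro i j hij; exact inter_subset_inter_left _ (hm hij)
  have e : ∀ i, μ.real (((⋃ j, A j) \ A i) ∩ D) = μ.real ((⋃ i, A i) ∩ D) - μ.real (A i ∩ D) := by
    intro i
    have : μ.real ((⋃ i, A i) ∩ D) = μ.real (A i ∩ D) + μ.real (((⋃ j, A j) \ A i) ∩ D) := by
      rw [← measureReal_union _ (((MeasurableSet.iUnion hA).diff (hA i)).inter hD) (fin_inter f) (fin_inter f)]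
      · congr 1; ext x; simp only [mem_inter_iff, mem_union, mem_diff]
        have := @subset_iUnion _ _ A i x
        tauto
      · rw [Set.disjoint_left]; rintro x hx hy; exact hy.1.2 hx.1
    linarith
  simp only [e]
  have := t.const_sub (μ.real ((⋃ i, A i) ∩ D))
  simpa using this

/-- obstacle minimizer on the whole space -/
def OMin (μ : Measure V) (r : ℝ) (g : V → ℝ) (L U E : Set V) : Prop :=
  ∀ F R, MeasurableSet F → AL μ L F → AL μ F U → (∀ᵐ x ∂μ, x ∉ ball (0:V) R → (x ∈ E ↔ x ∈ F)) →
    JJ μ r g (ball 0 (R+1)) E ≤ JJ μ r g (ball 0 (R+1)) F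

theorem limMin {r : ℝ} (hr : 0 < r) (hr1 : r < 1) {g : V → ℝ} {b : ℝ} (hb : 0 ≤ b) (hg : GB μ g b) {L U : Set V}
    {E : ℕ → Set V} (hE : ∀ i, MeasurableSet (E i)) (hm : Monotone E) {ε : ℕ → ℝ}
    (hε0 : ∀ i, 0 ≤ ε i) (hε1 : ∀ i, ε i ≤ 1) (hε : Tendsto ε atTop (𝓝 0))
    (hmin : ∀ R, ∀ᶠ j in atTop, ∀ G, MeasurableSet G →
      (∀ᵐ x ∂μ, x ∉ ball (0:V) R → (x ∈ G ↔ x ∈ E j)) →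
      (∀ᵐ x ∂μ, x ∈ ball (0:V) R → (x ∈ L → x ∈ G) ∧ (x ∈ G → x ∈ U)) →
      JJ μ r (fun x => g x + ε j) (ball 0 (R+1)) (E j) ≤ JJ μ r (fun x => g x + ε j) (ball 0 (R+1)) G) :
    OMin μ r g L U (⋃ i, E i) := by
  intro F R hF hL hU hoff
  set E' := ⋃ i, E i with hE'
  have hE'm : MeasurableSet E' := MeasurableSet.iUnion hE
  set D1 := ball (0:V) (R+1) with hD1
  set K := ball (0:V) (R+2) with hK
  set D2 := ball (0:V) (R+2+1) \ D1 with hD2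
  have m1 : MeasurableSet D1 := measurableSet_ball
  have mK : MeasurableSet K := measurableSet_ball
  have m2 : MeasurableSet D2 := measurableSet_ball.diff measurableSet_ball
  have f1 : μ D1 ≠ ∞ := fin_bdd isBounded_ball
  have f2 : μ D2 ≠ ∞ := fin_bdd (isBounded_ball.subset diff_subset)
  have hDu : ball (0:V) (R+2+1) = D1 ∪ D2 := by
    rw [hD2, union_diff_self]
    exact (union_eq_self_of_subset_left (ball_subset_ball (by linarith))).symm
  have hdis : Disjoint D1 D2 := disjoint_sdiff_right
  set err : ℕ → ℝ := fun j => ε j * μ.real D1 + μ.real ((PP μ r E' \ PP μ r (E j)) ∩ D2) / (2*r)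
    + (b + 1) * μ.real ((E' \ E j) ∩ D2) with herr
  have terr : Tendsto err atTop (𝓝 0) := by
    have t1 := hε.mul_const (μ.real D1)
    have t2 : Tendsto (fun j => μ.real ((PP μ r E' \ PP μ r (E j)) ∩ D2)) atTop (𝓝 0) := by
      rw [hE', PP_iUnion]
      exact diff_tendsto (fun i => meas_PP μ r _) (fun i j hij => PP_sub (hm hij)) m2 f2
    have t3 : Tendsto (fun j => μ.real ((E' \ E j) ∩ D2)) atTop (𝓝 0) := diff_tendsto hE hm m2 f2
    have := (t1.add (t2.div_const (2*r))).add (t3.const_mul (b+1))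
    simpa using this
  have key : ∀ᶠ j in atTop, JJ μ r g D1 (E j) ≤ JJ μ r g D1 F + err j := by
    filter_upwards [hmin (R+2)] with j hj
    set G := (F ∩ K) ∪ (E j \ K) with hG
    have hGm : MeasurableSet G := (hF.inter mK).union ((hE j).diff mK)
    have a1 := hj G hGm (by
      refine Eventually.of_forall fun x hx => ?_
      simp only [hG, mem_union, mem_inter_iff, mem_diff]; tauto) (by
      filter_upwards [hL, hU] with x h1 h2 h3
      have h3' : x ∈ K := h3
      simp only [hG, mem_union, mem_inter_iff, mem_diff]; tauto)
    set gj : V → ℝ := fun x => g x + ε j with hgj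
    have hgjb : GB μ gj (b + 1) := by
      refine ⟨(hg.addc (ε j)).1, ?_⟩
      filter_upwards [(hg.addc (ε j)).2] with x hx
      rw [abs_of_nonneg (hε0 j)] at hx
      have := hε1 j; linarith
    rw [hDu, JJ_add hgjb m1 m2 (hE j) hdis f1 f2, JJ_add hgjb m1 m2 hGm hdis f1 f2] at a1
    have a2 : JJ μ r gj D1 G = JJ μ r gj D1 F := by
      unfold JJ
      have e1 : NN μ r G ∩ D1 = NN μ r F ∩ D1 := by
        ext y; simp only [mem_inter_iff]
        apply and_congr_left; intro hy
        apply NN_congr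
        refine Eventually.of_forall fun x hx => ?_
        have : x ∈ K := by
          rw [hK, mem_ball]; rw [hD1, mem_ball] at hy; rw [mem_ball] at hx
          have := dist_triangle x y 0; linarith
        simp only [hG, mem_union, mem_inter_iff, mem_diff]; tauto
      have e2 : G ∩ D1 = F ∩ D1 := by
        ext x
        have : x ∈ D1 → x ∈ K := fun h => ball_subset_ball (by linarith) h
        simp only [hG, mem_union, mem_inter_iff, mem_diff]; tauto
      rw [e1, e2]
    have hoff2 : ∀ y ∈ D2, ∀ᵐ x ∂μ, x ∈ ball y r → (x ∈ G → x ∈ E') ∧ (x ∈ E j → x ∈ G) := by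
      intro y hy
      filter_upwards [hoff] with x hx hxy
      have h1 : x ∉ ball (0:V) R := by
        intro h
        apply hy.2
        rw [hD1, mem_ball]; rw [mem_ball] at hxy h
        have := dist_triangle y x 0
        rw [dist_comm y x] at this; linarith
      have := hx h1
      have h3 : x ∈ E j → x ∈ E' := fun h => mem_iUnion.2 ⟨j, h⟩
      simp only [hG, mem_union, mem_inter_iff, mem_diff]; tauto
    have a3 : μ.real (NN μ r G ∩ D2) ≤ μ.real (NN μ r (E j) ∩ D2) + μ.real ((PP μ r E' \ PP μ r (E j)) ∩ D2) := by
      refine le_trans (mr_le ?_ ?_) (measureReal_union_le _ _)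
      · rintro y ⟨⟨h1, h2⟩, h3⟩
        have o := hoff2 y h3
        have p1 : y ∈ PP μ r E' := PP_imp (by filter_upwards [o] with x hx h; exact (hx h).1) h1
        have p2 : y ∈ PP μ r (E j)ᶜ := PP_imp (by
          filter_upwards [o] with x hx h h4 h5; exact h4 ((hx h).2 h5)) h2
        by_cases hp : y ∈ PP μ r (E j)
        · exact Or.inl ⟨⟨hp, p2⟩, h3⟩
        · exact Or.inr ⟨⟨p1, hp⟩, h3⟩
      · exact ne_top_of_le_ne_top f2 (measure_mono (union_subset inter_subset_right inter_subset_right))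
    have a4 : (∫ x in G ∩ D2, gj x ∂μ) ≤ (∫ x in E j ∩ D2, gj x ∂μ) + (b+1) * μ.real ((E' \ E j) ∩ D2) := by
      have ho : ∀ᵐ x ∂μ, x ∈ D2 → (x ∈ G → x ∈ E') ∧ (x ∈ E j → x ∈ G) := by
        filter_upwards [hoff] with x hx hxy
        have h1 : x ∉ ball (0:V) R := by
          intro h
          exact hxy.2 (ball_subset_ball (by linarith) h)
        have := hx h1
        have h3 : x ∈ E j → x ∈ E' := fun h => mem_iUnion.2 ⟨j, h⟩
        simp only [hG, mem_union, mem_inter_iff, mem_diff]; tauto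
      have e1 : (∫ x in G ∩ D2, gj x ∂μ) = (∫ x in E j ∩ D2, gj x ∂μ) + ∫ x in (G \ E j) ∩ D2, gj x ∂μ := by
        rw [← setIntegral_union _ ((hGm.diff (hE j)).inter m2) (hgjb.intOn (fin_inter f2)) (hgjb.intOn (fin_inter f2))]
        · apply setIntegral_congr_set
          rw [eventuallyEq_set]
          filter_upwards [ho] with x hx
          simp only [mem_inter_iff, mem_union, mem_diff]; tauto
        · rw [Set.disjoint_left]; rintro x hx hy; exact hy.1.2 hx.1
      have e2 := hgjb.bound (D := (G \ E j) ∩ D2) (fin_inter f2)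
      have e3 : μ.real ((G \ E j) ∩ D2) ≤ μ.real ((E' \ E j) ∩ D2) := by
        refine ENNReal.toReal_mono (fin_inter f2) (measure_mono_ae ?_)
        filter_upwards [ho] with x hx h
        exact ⟨⟨(hx h.2).1 h.1.1, h.1.2⟩, h.2⟩
      have e4 := le_abs_self (∫ x in (G \ E j) ∩ D2, gj x ∂μ)
      have : (b+1) * μ.real ((G \ E j) ∩ D2) ≤ (b+1) * μ.real ((E' \ E j) ∩ D2) := by gcongr
      linarith
    have a5 : JJ μ r gj D2 G ≤ JJ μ r gj D2 (E j) + μ.real ((PP μ r E' \ PP μ r (E j)) ∩ D2) / (2*r)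
        + (b+1) * μ.real ((E' \ E j) ∩ D2) := by
      unfold JJ
      have : μ.real (NN μ r G ∩ D2) / (2*r) ≤ (μ.real (NN μ r (E j) ∩ D2) + μ.real ((PP μ r E' \ PP μ r (E j)) ∩ D2)) / (2*r) := by
        gcongr
      rw [add_div] at this
      linarith
    have a6 : JJ μ r gj D1 (E j) = _ := JJ_const hg (ε j) f1
    have a7 : JJ μ r gj D1 F = _ := JJ_const hg (ε j) f1
    have a8 : 0 ≤ ε j * μ.real (E j ∩ D1) := mul_nonneg (hε0 j) measureReal_nonneg
    have a9 : ε j * μ.real (F ∩ D1) ≤ ε j * μ.real D1 :=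
      mul_le_mul_of_nonneg_left (mr_le inter_subset_right f1) (hε0 j)
    simp only [herr]
    linarith
  obtain ⟨q, hq, hq'⟩ := lsc_mono hr hg m1 f1 hE hm
  have t := terr.const_add (JJ μ r g D1 F)
  rw [add_zero] at t
  refine le_of_tendsto_of_tendsto hq t ?_
  filter_upwards [key] with j hj
  exact (hq' j).trans hj

/-- half space -/
def HH (ω : V) (t : ℝ) : Set V := {x | ⟪ω, x⟫ ≤ t}

theorem mem_HH {ω : V} {t : ℝ} {x : V} : x ∈ HH ω t ↔ ⟪ω, x⟫ ≤ t := Iff.rfl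

theorem meas_HH (ω : V) (t : ℝ) : MeasurableSet (HH ω t) :=
  (isClosed_le (by fun_prop) continuous_const).measurableSet

theorem HH_mono (ω : V) {s t : ℝ} (h : s ≤ t) : HH ω s ⊆ HH ω t := fun x hx => le_trans (show ⟪ω, x⟫ ≤ s from hx) h

theorem tr_HH (ω v : V) (t : ℝ) : tr v (HH ω t) = HH ω (t - ⟪ω, v⟫) := by
  ext x; rw [mem_tr, mem_HH, mem_HH, inner_add_right]; constructor <;> intro h <;> linarith

/-- sequences of data -/
structure Dat (τ ε A : ℕ → ℝ) : Prop where
  τm : Monotone τ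
  εa : Antitone ε
  ε0 : ∀ i, 0 ≤ ε i
  ε1 : ∀ i, ε i ≤ 1
  Am : Monotone A

def Up (ω : V) (τ A : ℕ → ℝ) (j : ℕ) : Set V := HH ω (τ j) ∪ (ball (0:V) j ∩ HH ω (A j))

theorem Up_bdd (ω : V) (τ A : ℕ → ℝ) (j : ℕ) : Bornology.IsBounded (Up ω τ A j \ HH ω (τ j)) := by
  apply (isBounded_ball (x := (0:V)) (r := j)).subset
  rintro x ⟨h1 | h1, h2⟩
  · exact absurd h1 h2
  · exact h1.1

theorem exists_Em {r : ℝ} (hr : 0 < r) {g : V → ℝ} {b : ℝ} (hb : 0 ≤ b) (hg : GB μ g b) (ω : V) (τ ε A : ℕ → ℝ) (j : ℕ) :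
    ∃ E, MinIn μ r (fun x => g x + ε j) (HH ω (τ j)) (Up ω τ A j) E :=
  exists_MinIn hr (by positivity) (hg.addc (ε j)) (meas_HH _ _)
    ((meas_HH _ _).union (measurableSet_ball.inter (meas_HH _ _))) subset_union_left (Up_bdd ω τ A j)

open Classical in
def Em (μ : Measure V) (r : ℝ) (g : V → ℝ) (ω : V) (τ ε A : ℕ → ℝ) (j : ℕ) : Set V :=
  if h : ∃ E, MinIn μ r (fun x => g x + ε j) (HH ω (τ j)) (Up ω τ A j) E then h.choose else ∅

theorem Em_spec {r : ℝ} (hr : 0 < r) {g : V → ℝ} {b : ℝ} (hb : 0 ≤ b) (hg : GB μ g b) (ω : V) (τ ε A : ℕ → ℝ) (j : ℕ) :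
    MinIn μ r (fun x => g x + ε j) (HH ω (τ j)) (Up ω τ A j) (Em μ r g ω τ ε A j) := by
  unfold Em
  rw [dif_pos (exists_Em hr hb hg ω τ ε A j)]
  exact (exists_Em hr hb hg ω τ ε A j).choose_spec

def EE (μ : Measure V) (r : ℝ) (g : V → ℝ) (ω : V) (τ ε A : ℕ → ℝ) : Set V := ⋃ j, Em μ r g ω τ ε A j

theorem EE_meas {r : ℝ} (hr : 0 < r) {g : V → ℝ} {b : ℝ} (hb : 0 ≤ b) (hg : GB μ g b) (ω : V) (τ ε A : ℕ → ℝ) :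
    MeasurableSet (EE μ r g ω τ ε A) := MeasurableSet.iUnion fun j => (Em_spec hr hb hg ω τ ε A j).meas

theorem MinIn.congr {r : ℝ} {g : V → ℝ} {L U E E' : Set V} (h : MinIn μ r g L U E) (hE' : MeasurableSet E')
    (he : ∀ᵐ x ∂μ, x ∈ E ↔ x ∈ E') : MinIn μ r g L U E' := by
  refine ⟨hE', ?_, ?_, ?_, ?_⟩
  · filter_upwards [h.low, he] with x; tauto
  · filter_upwards [h.up, he] with x; tauto
  · intro D hD F h1 h2 h3; rw [← JJ_congr he]; exact h.min D hD F h1 h2 h3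
  · intro D hD F h1 h2 h3 h4; rw [← JJ_congr he] at h4
    filter_upwards [h.least D hD F h1 h2 h3 h4, he] with x; tauto

/-- comparison between families, with translation -/
theorem Em_comp {r : ℝ} (hr : 0 < r) {g : V → ℝ} {b : ℝ} (hb : 0 ≤ b) (hg : GB μ g b) (ω : V)
    {g' : V → ℝ} {b' : ℝ} (hb' : 0 ≤ b') (hg' : GB μ g' b')
    (k : V) (hk : ∀ x, g (x + -k) = g x) {τ ε A τ' ε' A' : ℕ → ℝ} {j j' : ℕ}
    (h1 : τ j + ⟪ω, k⟫ ≤ τ' j') (h2 : A j + ⟪ω, k⟫ ≤ A' j')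
    (h3 : ∀ᵐ x ∂μ, g' x + ε' j' ≤ g x + ε j) (h4 : j + ‖k‖ ≤ j') :
    AL μ (tr (-k) (Em μ r g ω τ ε A j)) (Em μ r g' ω τ' ε' A' j') := by
  have m1 := (Em_spec hr hb hg ω τ ε A j).tr (-k) (by intro x; simp only [hk])
  have m2 := Em_spec hr hb' hg' ω τ' ε' A' j'
  have ein : ∀ t, tr (-k) (HH ω t) = HH ω (t + ⟪ω, k⟫) := by
    intro t; rw [tr_HH, inner_neg_right]; congr 1; ring
  refine MinIn.comp hr (hg.addc (ε j)) (hg'.addc (ε' j')) h3 ?_ (Up_bdd _ _ _ _) ?_ ?_ m1 m2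
  · apply (isBounded_ball (x := k) (r := j)).subset
    rintro x ⟨h5 | h5, h6⟩
    · exact absurd h5 h6
    · have := h5.1; simpa [dist_eq_norm, sub_eq_add_neg] using this
  · rw [ein]; exact HH_mono ω h1
  · have : tr (-k) (Up ω τ A j) = tr (-k) (HH ω (τ j)) ∪ (tr (-k) (ball (0:V) j) ∩ tr (-k) (HH ω (A j))) := rfl
    rw [this, ein, ein, tr_ball]
    unfold Up
    apply union_subset_union (HH_mono ω h1)
    apply inter_subset_inter _ (HH_mono ω h2)
    apply ball_subset_ball'
    simpa [dist_eq_norm] using h4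

theorem Em_mono {r : ℝ} (hr : 0 < r) {g : V → ℝ} {b : ℝ} (hb : 0 ≤ b) (hg : GB μ g b) (ω : V)
    {τ ε A : ℕ → ℝ} (hd : Dat τ ε A) {i j : ℕ} (hij : i ≤ j) :
    AL μ (Em μ r g ω τ ε A i) (Em μ r g ω τ ε A j) := by
  have := Em_comp hr hb hg ω hb hg 0 (by simp) (τ := τ) (ε := ε) (A := A) (τ' := τ) (ε' := ε) (A' := A)
    (j := i) (j' := j) (by simpa using hd.τm hij) (by simpa using hd.Am hij)
    (Eventually.of_forall fun x => by have := hd.εa hij; linarith) (by simpa using hij)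
  simpa [tr] using this

theorem EE_comp {r : ℝ} (hr : 0 < r) {g : V → ℝ} {b : ℝ} (hb : 0 ≤ b) (hg : GB μ g b) (ω : V)
    {g' : V → ℝ} {b' : ℝ} (hb' : 0 ≤ b') (hg' : GB μ g' b')
    (k : V) (hk : ∀ x, g (x + -k) = g x) {τ ε A τ' ε' A' : ℕ → ℝ}
    (h : ∀ j : ℕ, ∃ j' : ℕ, τ j + ⟪ω, k⟫ ≤ τ' j' ∧ A j + ⟪ω, k⟫ ≤ A' j' ∧
      (∀ᵐ x ∂μ, g' x + ε' j' ≤ g x + ε j) ∧ j + ‖k‖ ≤ j') :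
    AL μ (tr (-k) (EE μ r g ω τ ε A)) (EE μ r g' ω τ' ε' A') := by
  have : ∀ j, AL μ (tr (-k) (Em μ r g ω τ ε A j)) (EE μ r g' ω τ' ε' A') := by
    intro j
    obtain ⟨j', h1, h2, h3, h4⟩ := h j
    filter_upwards [Em_comp hr hb hg ω hb' hg' k hk h1 h2 h3 h4] with x hx hx'
    exact mem_iUnion.2 ⟨j', hx hx'⟩
  rw [← ae_all_iff] at this
  filter_upwards [this] with x hx hx'
  obtain ⟨j, hj⟩ := mem_iUnion.1 (show x + -k ∈ EE μ r g ω τ ε A from hx')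
  exact hx j hj

theorem EE_OMin {r : ℝ} (hr : 0 < r) (hr1 : r < 1) {g : V → ℝ} {b : ℝ} (hb : 0 ≤ b) (hg : GB μ g b) (ω : V)
    {τ ε A : ℕ → ℝ} (hd : Dat τ ε A) (hε : Tendsto ε atTop (𝓝 0)) {L U : Set V}
    (hL : ∀ j, HH ω (τ j) ⊆ L) (hU : ∀ R, ∀ᶠ j in atTop, U ∩ ball (0:V) R ⊆ HH ω (A j)) :
    OMin μ r g L U (EE μ r g ω τ ε A) := by
  set E0 := Em μ r g ω τ ε A with hE0
  set E : ℕ → Set V := fun j => ⋃ i ≤ j, E0 i with hE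
  have hs : ∀ j, MinIn μ r (fun x => g x + ε j) (HH ω (τ j)) (Up ω τ A j) (E0 j) := fun j => Em_spec hr hb hg ω τ ε A j
  have hEm : ∀ j, MeasurableSet (E j) := fun j =>
    MeasurableSet.iUnion fun i => MeasurableSet.iUnion fun _ => (hs i).meas
  have hmono : Monotone E := by
    intro i j hij
    exact biUnion_subset_biUnion_left fun k hk => le_trans hk hij
  have hae : ∀ j, ∀ᵐ x ∂μ, x ∈ E0 j ↔ x ∈ E j := by
    intro j
    have : ∀ i, ∀ᵐ x ∂μ, i ≤ j → x ∈ E0 i → x ∈ E0 j := by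
      intro i
      by_cases hij : i ≤ j
      · filter_upwards [Em_mono hr hb hg ω hd hij] with x hx _; exact hx
      · exact Eventually.of_forall fun x h => absurd h hij
    rw [← ae_all_iff] at this
    filter_upwards [this] with x hx
    simp only [hE, mem_iUnion, exists_prop]
    exact ⟨fun h => ⟨j, le_rfl, h⟩, fun ⟨i, hi, h⟩ => hx i hi h⟩
  have hmin' : ∀ j, MinIn μ r (fun x => g x + ε j) (HH ω (τ j)) (Up ω τ A j) (E j) := fun j => (hs j).congr (hEm j) (hae j)
  have hUn : EE μ r g ω τ ε A = ⋃ j, E j := by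
    unfold EE
    ext x; simp only [hE, mem_iUnion, exists_prop]
    exact ⟨fun ⟨i, h⟩ => ⟨i, i, le_rfl, h⟩, fun ⟨_, i, _, h⟩ => ⟨i, h⟩⟩
  rw [hUn]
  refine limMin hr hr1 hb hg hEm hmono hd.ε0 hd.ε1 hε ?_
  intro R
  filter_upwards [hU R, eventually_ge_atTop ⌈R⌉₊] with j hj hjR G hG h1 h2
  have hRj : R ≤ j := (Nat.le_ceil R).trans (by exact_mod_cast hjR)
  have l1 : AL μ (HH ω (τ j)) G := by
    filter_upwards [h1, h2, (hmin' j).low] with x a1 a2 a3 a4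
    by_cases hx : x ∈ ball (0:V) R
    · exact (a2 hx).1 (hL j a4)
    · exact (a1 hx).2 (a3 a4)
  have l2 : AL μ G (Up ω τ A j) := by
    filter_upwards [h1, h2, (hmin' j).up] with x a1 a2 a3 a4
    by_cases hx : x ∈ ball (0:V) R
    · exact Or.inr ⟨ball_subset_ball hRj hx, hj ⟨(a2 hx).2 a4, hx⟩⟩
    · exact a3 ((a1 hx).1 a4)
  obtain ⟨R0, hR0⟩ := exists_amp r (Up_bdd ω τ A j)
  have a := (hmin' j).min _ (hR0 (max R0 (R+1)) (le_max_left _ _)) G hG l1 l2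
  have e := JJ_diff hr (hg.addc (ε j)) (K := ball (0:V) R) (D := ball 0 (R+1)) (D' := ball 0 (max R0 (R+1)))
    (Amp.ball (by linarith)) (Amp.ball (by have := le_max_right R0 (R+1); linarith)) (hEm j) hG
    (by filter_upwards [h1] with x hx hx'; exact (hx hx').symm)
  linarith


theorem OMin.amp {r : ℝ} (hr : 0 < r) (hr1 : r < 1) {g : V → ℝ} {b : ℝ} (hg : GB μ g b) {L U E F K D : Set V}
    (h : OMin μ r g L U E) (hE : MeasurableSet E) (hF : MeasurableSet F) (hD : Amp r K D)
    (hL : AL μ L F) (hU : AL μ F U) (hoff : ∀ᵐ x ∂μ, x ∉ K → (x ∈ E ↔ x ∈ F)) :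
    JJ μ r g D E ≤ JJ μ r g D F := by
  have hb := hD.bdd
  rw [isBounded_iff_subset_ball (0:V)] at hb
  obtain ⟨R, hR⟩ := hb
  have hK : K ⊆ ball (0:V) R := (hD.sub hr).trans hR
  have a := h F R hF hL hU (by filter_upwards [hoff] with x hx hx'; exact hx fun h => hx' (hK h))
  have e := JJ_diff hr hg hD ((Amp.ball (by linarith : R + r ≤ R + 1)).anti hK) hE hF hoff
  linarith

theorem glue_NN {r s : ℝ} {c : V} {A B W : Set V} (h : ∀ᵐ x ∂μ, x ∉ W → (x ∈ A ↔ x ∈ B)) :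
    NN μ r ((A ∩ ball c s) ∪ (B \ ball c s)) ⊆ (NN μ r A ∩ ball c s) ∪ (NN μ r B \ ball c s) ∪
      (PP μ r W ∩ (ball c (s + r) \ ball c (s - r))) := by
  intro y hy
  by_cases h1 : y ∈ ball c (s - r)
  · have hA : y ∈ NN μ r A := by
      rw [← NN_congr ?_]
      · exact hy
      · refine Eventually.of_forall fun x hx => ?_
        have : x ∈ ball c s := by
          rw [mem_ball] at *
          have := dist_triangle x y c; linarith
        simp only [mem_union, mem_inter_iff, mem_diff]; tauto
    by_cases hs : y ∈ ball c s
    · exact Or.inl (Or.inl ⟨hA, hs⟩)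
    · have hB : y ∈ NN μ r B := by
        rw [mem_ball] at h1 hs
        have hr' : r < 0 := by linarith
        exfalso
        have := hA.1
        unfold PP at this
        rw [Set.mem_setOf_eq, ball_eq_empty.2 hr'.le] at this
        simp at this
      exact Or.inl (Or.inr ⟨hB, hs⟩)
  by_cases h2 : y ∈ ball c (s + r)
  · by_cases hW : y ∈ PP μ r W
    · exact Or.inr ⟨hW, h2, h1⟩
    · rw [notPP] at hW
      have hA : y ∈ NN μ r A := by
        rw [← NN_congr ?_]
        · exact hy
        · filter_upwards [h, hW] with x a1 a2 a3
          have := a1 (a2 a3)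
          simp only [mem_union, mem_inter_iff, mem_diff]; tauto
      have hB : y ∈ NN μ r B := by
        rw [← NN_congr ?_]
        · exact hy
        · filter_upwards [h, hW] with x a1 a2 a3
          have := a1 (a2 a3)
          simp only [mem_union, mem_inter_iff, mem_diff]; tauto
      by_cases hs : y ∈ ball c s
      · exact Or.inl (Or.inl ⟨hA, hs⟩)
      · exact Or.inl (Or.inr ⟨hB, hs⟩)
  · have hB : y ∈ NN μ r B := by
      rw [← NN_congr ?_]
      · exact hy
      · refine Eventually.of_forall fun x hx => ?_
        have : x ∉ ball c s := by
          rw [mem_ball] at *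
          have := dist_triangle y x c
          rw [dist_comm y x] at this; intro h; linarith
        simp only [mem_union, mem_inter_iff, mem_diff]; tauto
    by_cases hs : y ∈ ball c s
    · exfalso
      rw [mem_ball] at hs h2
      have hr' : r < 0 := by linarith
      have := hB.1
      unfold PP at this
      rw [Set.mem_setOf_eq, ball_eq_empty.2 hr'.le] at this
      simp at this
    · exact Or.inl (Or.inr ⟨hB, hs⟩)

theorem glue_cmp {r : ℝ} (hr : 0 < r) (hr1 : r < 1) {g : V → ℝ} {b : ℝ} (hg : GB μ g b) {L U E A W : Set V}
    (h : OMin μ r g L U E) (hE : MeasurableSet E) (hA : MeasurableSet A)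
    (hLE : AL μ L E) (hEU : AL μ E U) (hLA : AL μ L A) (hAU : AL μ A U)
    (hW : ∀ᵐ x ∂μ, x ∉ W → (x ∈ A ↔ x ∈ E)) (c : V) (s : ℝ) :
    JJ μ r g (ball c s) E ≤ JJ μ r g (ball c s) A +
      μ.real (PP μ r W ∩ (ball c (s + r) \ ball c (s - r))) / (2 * r) := by
  set G := (A ∩ ball c s) ∪ (E \ ball c s) with hG
  have hGm : MeasurableSet G := (hA.inter measurableSet_ball).union (hE.diff measurableSet_ball)
  set D2 := ball c (s+1) \ ball c s with hD2
  have m2 : MeasurableSet D2 := measurableSet_ball.diff measurableSet_ball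
  have f1 : μ (ball c s) ≠ ∞ := fin_bdd isBounded_ball
  have f2 : μ D2 ≠ ∞ := fin_bdd (isBounded_ball.subset diff_subset)
  have hDu : ball c (s+1) = ball c s ∪ D2 := by
    rw [hD2, union_diff_self]
    exact (union_eq_self_of_subset_left (ball_subset_ball (by linarith))).symm
  have hdis : Disjoint (ball c s) D2 := disjoint_sdiff_right
  have fS : μ (PP μ r W ∩ (ball c (s + r) \ ball c (s - r))) ≠ ∞ :=
    fin_bdd (isBounded_ball.subset (inter_subset_right.trans diff_subset))
  have a1 : JJ μ r g (ball c (s+1)) E ≤ JJ μ r g (ball c (s+1)) G := by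
    apply h.amp hr hr1 hg hE hGm (K := ball c s) (Amp.ball (by linarith))
    · filter_upwards [hLE, hLA] with x; simp only [hG, mem_union, mem_inter_iff, mem_diff]; tauto
    · filter_upwards [hEU, hAU] with x; simp only [hG, mem_union, mem_inter_iff, mem_diff]; tauto
    · refine Eventually.of_forall fun x hx => ?_
      simp only [hG, mem_union, mem_inter_iff, mem_diff]; tauto
  have a2 : JJ μ r g (ball c (s+1)) E = JJ μ r g (ball c s) E + JJ μ r g D2 E := by
    rw [hDu, JJ_add hg measurableSet_ball m2 hE hdis f1 f2]
  have e1 : (∫ x in G ∩ ball c (s+1), g x ∂μ) = (∫ x in A ∩ ball c s, g x ∂μ) + ∫ x in E ∩ D2, g x ∂μ := by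
    rw [← setIntegral_union (hdis.mono inter_subset_right inter_subset_right) (hE.inter m2)
      (hg.intOn (fin_inter f1)) (hg.intOn (fin_inter f2))]
    congr 2
    ext x
    have : x ∈ ball c s → x ∈ ball c (s+1) := fun h => ball_subset_ball (by linarith) h
    simp only [hG, hD2, mem_union, mem_inter_iff, mem_diff]; tauto
  have e2 : μ.real (NN μ r G ∩ ball c (s+1)) ≤ μ.real (NN μ r A ∩ ball c s) + μ.real (NN μ r E ∩ D2) +
      μ.real (PP μ r W ∩ (ball c (s + r) \ ball c (s - r))) := by
    refine le_trans (mr_le (B := (NN μ r A ∩ ball c s) ∪ (NN μ r E ∩ D2) ∪ (PP μ r W ∩ (ball c (s + r) \ ball c (s - r)))) ?_ ?_)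
      ((measureReal_union_le _ _).trans (add_le_add_left (measureReal_union_le _ _) _))
    · rintro y ⟨h1, h2⟩
      rcases glue_NN hW h1 with (h3 | h3) | h3
      · exact Or.inl (Or.inl h3)
      · exact Or.inl (Or.inr ⟨h3.1, h2, h3.2⟩)
      · exact Or.inr h3
    · refine (measure_union_lt_top (measure_union_lt_top ?_ ?_) fS.lt_top).ne
      · exact (fin_inter f1).lt_top
      · exact (fin_inter f2).lt_top
  have e3 : μ.real (NN μ r G ∩ ball c (s+1)) / (2*r) ≤ (μ.real (NN μ r A ∩ ball c s) + μ.real (NN μ r E ∩ D2) +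
      μ.real (PP μ r W ∩ (ball c (s + r) \ ball c (s - r)))) / (2*r) := by gcongr
  rw [add_div, add_div] at e3
  rw [a2] at a1
  unfold JJ at a1 ⊢
  rw [e1] at a1
  linarith

theorem pigeon_shell {r : ℝ} (hr : 0 < r) (hr1 : r < 1) (S : Set V) (hS : MeasurableSet S) (c : V) (R : ℝ) :
    ∃ s, R ≤ s ∧ s ≤ R + 3 ∧ μ.real (S ∩ (ball c (s + r) \ ball c (s - r))) / (2 * r) ≤
      μ.real (S ∩ (ball c (R + 3) \ ball c R)) := by
  set m := ⌈1 / (2 * r)⌉₊ with hm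
  have hm1 : 1 / (2 * r) ≤ m := Nat.le_ceil _
  have hm2 : (m:ℝ) < 1 / (2*r) + 1 := Nat.ceil_lt_add_one (by positivity)
  have hm3 : 1 ≤ 2 * r * m := by
    rw [div_le_iff₀ (by positivity)] at hm1; linarith
  have hm4 : 2 * r * m ≤ 3 := by
    have : 2 * r * m < 2 * r * (1 / (2*r) + 1) := mul_lt_mul_of_pos_left hm2 (by positivity)
    have e : 2 * r * (1 / (2*r) + 1) = 1 + 2 * r := by field_simp
    linarith
  have hm0 : 0 < m := by
    by_contra h
    have : m = 0 := by omega
    rw [this] at hm3; norm_num at hm3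
  set s : ℕ → ℝ := fun i => R + (2 * i + 1) * r with hs
  set T : ℕ → Set V := fun i => S ∩ (ball c (s i + r) \ ball c (s i - r)) with hT
  have hTm : ∀ i, MeasurableSet (T i) := fun i => hS.inter (measurableSet_ball.diff measurableSet_ball)
  have fB : μ (S ∩ (ball c (R + 3) \ ball c R)) ≠ ∞ :=
    fin_bdd (isBounded_ball.subset (inter_subset_right.trans diff_subset))
  have hsum : ∑ i ∈ Finset.range m, μ.real (T i) ≤ μ.real (S ∩ (ball c (R + 3) \ ball c R)) := by
    rw [← measureReal_biUnion_finset (h := fun i _ => fin_bdd (isBounded_ball.subset (inter_subset_right.trans diff_subset)))]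
    · refine mr_le ?_ fB
      intro x hx
      simp only [mem_iUnion, Finset.mem_range, exists_prop] at hx
      obtain ⟨i, hi, hxS, hx1, hx2⟩ := hx
      have him : (i:ℝ) + 1 ≤ m := by exact_mod_cast hi
      rw [mem_ball] at hx1 hx2
      refine ⟨hxS, ?_, ?_⟩
      · rw [mem_ball]; simp only [hs] at hx1; nlinarith
      · rw [mem_ball]; simp only [hs] at hx2
        have : (0:ℝ) ≤ i := Nat.cast_nonneg i
        nlinarith
    · intro i _ j _ hij
      rw [Function.onFun, Set.disjoint_left]
      rintro x ⟨_, h1, h2⟩ ⟨_, h3, h4⟩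
      rw [mem_ball] at h1 h2 h3 h4
      simp only [hs] at h1 h2 h3 h4
      rcases lt_or_gt_of_ne hij with h | h
      · have : (i:ℝ) + 1 ≤ j := by exact_mod_cast h
        nlinarith
      · have : (j:ℝ) + 1 ≤ i := by exact_mod_cast h
        nlinarith
    · intro i _; exact hTm i
  set B := μ.real (S ∩ (ball c (R + 3) \ ball c R)) with hB
  have : ∃ i ∈ Finset.range m, μ.real (T i) ≤ B / m := by
    apply Finset.exists_le_of_sum_le (by simpa using hm0.ne')
    rw [Finset.sum_const, Finset.card_range, nsmul_eq_mul]
    have : (m:ℝ) * (B / m) = B := by field_simp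
    rw [this]; exact hsum
  obtain ⟨i, hi, hle⟩ := this
  have him : (i:ℝ) + 1 ≤ m := by exact_mod_cast Finset.mem_range.1 hi
  have hi0 : (0:ℝ) ≤ i := Nat.cast_nonneg i
  refine ⟨s i, ?_, ?_, ?_⟩
  · simp only [hs]; nlinarith
  · simp only [hs]; nlinarith
  · rw [div_le_iff₀ (by positivity)]
    refine hle.trans ?_
    rw [div_le_iff₀ (by exact_mod_cast hm0)]
    have : 0 ≤ B := measureReal_nonneg
    nlinarith

/-- comparison lemma (*) -/
theorem star {r : ℝ} (hr : 0 < r) (hr1 : r < 1) {g : V → ℝ} {b : ℝ} (hg : GB μ g b) {L U E A W Wp : Set V}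
    (h : OMin μ r g L U E) (hE : MeasurableSet E) (hA : MeasurableSet A)
    (hLE : AL μ L E) (hEU : AL μ E U) (hLA : AL μ L A) (hAU : AL μ A U)
    (hW : ∀ᵐ x ∂μ, x ∉ W → (x ∈ A ↔ x ∈ E)) (hWp : PP μ r W ⊆ Wp) (R : ℝ) :
    ∃ s, R ≤ s ∧ s ≤ R + 3 ∧ JJ μ r g (ball 0 s) E ≤ JJ μ r g (ball 0 s) A +
      μ.real (Wp ∩ (ball 0 (R + 3) \ ball 0 R)) := by
  obtain ⟨s, h1, h2, h3⟩ := pigeon_shell (μ := μ) hr hr1 (PP μ r W) (meas_PP μ r W) 0 R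
  refine ⟨s, h1, h2, ?_⟩
  have a := glue_cmp hr hr1 hg h hE hA hLE hEU hLA hAU hW 0 s
  have b : μ.real (PP μ r W ∩ (ball 0 (R + 3) \ ball 0 R)) ≤ μ.real (Wp ∩ (ball 0 (R + 3) \ ball 0 R)) :=
    mr_le (inter_subset_inter_left _ hWp) (fin_bdd (isBounded_ball.subset (inter_subset_right.trans diff_subset)))
  linarith


theorem chain {r : ℝ} {A : Set V} {u h : V} {m : ℕ} (hm : 0 < m) (hu : u ∈ PP μ r A) (hv : u + h ∉ PP μ r A)
    (hh : ‖h‖ < 2 * r * m) : ∃ j : ℕ, j ≤ m ∧ u + ((j:ℝ)/m) • h ∈ NN μ r A := by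
  classical
  have hm' : (0:ℝ) < m := by exact_mod_cast hm
  have hex : ∃ j : ℕ, u + ((j:ℝ)/m) • h ∉ PP μ r A := ⟨m, by rwa [div_self hm'.ne', one_smul]⟩
  set j := Nat.find hex with hj
  have hj1 : u + ((j:ℝ)/m) • h ∉ PP μ r A := Nat.find_spec hex
  have hjm : j ≤ m := Nat.find_min' hex (by rwa [div_self hm'.ne', one_smul])
  have hj0 : j ≠ 0 := by
    intro h0; rw [h0] at hj1; simp at hj1; exact hj1 hu
  obtain ⟨i, hi⟩ := Nat.exists_eq_succ_of_ne_zero hj0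
  have hip : u + ((i:ℝ)/m) • h ∈ PP μ r A := by
    by_contra hc
    have := Nat.find_min' hex hc
    omega
  refine ⟨i, by omega, hip, ?_⟩
  by_contra hc
  rw [notPP] at hj1 hc
  set p := u + ((i:ℝ)/m) • h with hp
  set q := u + ((j:ℝ)/m) • h with hq
  have hpq : q - p = (1/(m:ℝ)) • h := by
    rw [hp, hq, hi, add_sub_add_left_eq_sub, ← sub_smul]; congr 1; push_cast; field_simp; ring
  have hd : ‖q - p‖ < 2 * r := by
    rw [hpq, norm_smul, Real.norm_of_nonneg (by positivity), one_div, inv_mul_lt_iff₀ hm']; linarith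
  set z := p + (1/2:ℝ) • (q - p) with hz
  have z1 : z ∈ ball p r := by
    rw [mem_ball, dist_eq_norm, hz, add_sub_cancel_left, norm_smul, Real.norm_of_nonneg (by norm_num)]; linarith
  have z2 : z ∈ ball q r := by
    have : z - q = -((1/2:ℝ) • (q - p)) := by rw [hz]; module
    rw [mem_ball, dist_eq_norm, this, norm_neg, norm_smul, Real.norm_of_nonneg (by norm_num)]; linarith
  have hpos : 0 < μ (ball p r ∩ ball q r) := (isOpen_ball.inter isOpen_ball).measure_pos μ ⟨z, z1, z2⟩
  have : μ (ball p r ∩ ball q r) = 0 := by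
    rw [measure_eq_zero_iff_ae_notMem]
    filter_upwards [hj1, hc] with x h1 h2 h3
    exact h2 h3.1 (h1 h3.2)
  exact hpos.ne' this

theorem avg_meas {S T : Set V} (hS : MeasurableSet S) (hT : MeasurableSet T) :
    Measurable (fun h => μ (S ∩ tr h T)) ∧ ∫⁻ h, μ (S ∩ tr h T) ∂μ = μ S * μ T := by
  set Q : Set (V × V) := {p | p.2 ∈ S ∧ p.2 + p.1 ∈ T} with hQ
  have hQm : MeasurableSet Q := (measurable_snd hS).inter ((measurable_snd.add measurable_fst) hT)
  have e : ∀ h, S ∩ tr h T = Prod.mk h ⁻¹' Q := fun h => rfl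
  constructor
  · simp only [e]; exact measurable_measure_prodMk_left hQm
  · simp only [e]
    rw [← Measure.prod_apply hQm, Measure.prod_apply_symm hQm]
    have : ∀ x, μ ((fun y => (y, x)) ⁻¹' Q) = S.indicator (fun _ => μ T) x := by
      intro x
      by_cases hx : x ∈ S
      · rw [indicator_of_mem hx]
        have : ((fun y => (y, x)) ⁻¹' Q) = (fun y => x + y) ⁻¹' T := by
          ext y; simp [hQ, hx]
        rw [this, measure_preimage_add]
      · rw [indicator_of_notMem hx]
        have : ((fun y => (y, x)) ⁻¹' Q) = ∅ := by
          ext y; simp [hQ, hx]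
        rw [this, measure_empty]
    simp only [this]
    rw [lintegral_indicator hS, setLIntegral_const, mul_comm]

theorem le_PP {r : ℝ} (hr : 0 < r) (A : Set V) : AL μ A (PP μ r A) := by
  have : μ (A \ PP μ r A) = 0 := by
    apply measure_null_of_locally_null
    intro x hx
    refine ⟨A ∩ ball x r, ?_, ?_⟩
    · exact mem_of_superset (inter_mem_nhdsWithin _ (ball_mem_nhds x hr))
        (inter_subset_inter_left _ diff_subset)
    · have := hx.2
      unfold PP at this
      simpa using this
  rw [measure_eq_zero_iff_ae_notMem] at this
  filter_upwards [this] with x hx hA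
  by_contra hc; exact hx ⟨hA, hc⟩

theorem chain_sum {r : ℝ} {A N S : Set V} {h : V} {m : ℕ} (hm : 0 < m) (hN : μ N ≠ ∞)
    (hS : ∀ u ∈ S, ∃ j : ℕ, j ≤ m ∧ u + ((j:ℝ)/m) • h ∈ N) :
    μ.real S ≤ (m+1) * μ.real N := by
  have hsub : S ⊆ ⋃ j ∈ Finset.range (m+1), tr (((j:ℝ)/m) • h) N := by
    intro u hu
    obtain ⟨j, hj, hj'⟩ := hS u hu
    simp only [mem_iUnion, Finset.mem_range, exists_prop]
    exact ⟨j, by omega, hj'⟩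
  have hf : μ (⋃ j ∈ Finset.range (m+1), tr (((j:ℝ)/m) • h) N) ≠ ∞ := by
    refine (measure_biUnion_lt_top (Finset.finite_toSet _) ?_).ne
    intro i _; rw [measure_tr]; exact hN.lt_top
  refine (mr_le hsub hf).trans ((measureReal_biUnion_finset_le _ _).trans ?_)
  simp only [real_tr, Finset.sum_const, Finset.card_range, nsmul_eq_mul]
  push_cast; exact le_rfl

theorem isoper {r : ℝ} {A : Set V} (hf : μ (PP μ r A) ≠ ∞) {ρ : ℝ} {m : ℕ} (hρ0 : 0 < ρ)
    (hρ : 2 * μ.real (PP μ r A) ≤ μ.real (ball (0:V) ρ)) (hm : ρ ≤ 2 * r * m) (hm0 : 0 < m) :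
    μ.real (PP μ r A) ≤ 2 * (m + 1) * μ.real (NN μ r A) := by
  set P := PP μ r A with hP
  have hPm : MeasurableSet P := meas_PP μ r A
  obtain ⟨am, ai⟩ := avg_meas (μ := μ) hPm hPm
  set B := ball (0:V) ρ with hB
  have hB0 : μ B ≠ 0 := (measure_ball_pos μ _ hρ0).ne'
  have hBf : μ B ≠ ∞ := fin_bdd isBounded_ball
  obtain ⟨h, hhB, hh⟩ := exists_le_setLAverage hB0 hBf am.aemeasurable.restrict
  have h1 : μ (P ∩ tr h P) ≤ μ P * μ P / μ B := by
    refine hh.trans ?_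
    rw [setLAverage_eq]
    gcongr
    rw [← ai]
    exact setLIntegral_le_lintegral _ _
  have h2 : μ.real (P ∩ tr h P) ≤ μ.real P * μ.real P / μ.real B := by
    have := ENNReal.toReal_mono (ENNReal.div_ne_top (ENNReal.mul_ne_top hf hf) hB0) h1
    rwa [ENNReal.toReal_div, ENNReal.toReal_mul] at this
  have hBpos : 0 < μ.real B := ENNReal.toReal_pos hB0 hBf
  have h3 : μ.real (P ∩ tr h P) ≤ μ.real P / 2 := by
    refine h2.trans ?_
    rw [div_le_div_iff₀ hBpos (by norm_num)]
    have : 0 ≤ μ.real P := measureReal_nonneg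
    nlinarith
  have h4 : μ.real P = μ.real (P ∩ tr h P) + μ.real (P \ tr h P) :=
    (measureReal_inter_add_sdiff (meas_tr h hPm) hf).symm
  have hNf : μ (NN μ r A) ≠ ∞ := ne_top_of_le_ne_top hf (measure_mono inter_subset_left)
  have h5 : μ.real (P \ tr h P) ≤ (m+1) * μ.real (NN μ r A) := by
    apply chain_sum (r := r) (A := A) (h := h) hm0 hNf
    rintro u ⟨hu1, hu2⟩
    apply chain hm0 hu1 hu2
    rw [hB, mem_ball_zero_iff] at hhB; linarith
  linarith

theorem pow_aux (n : ℕ) {t : ℝ} (h0 : 0 ≤ t) (h1 : t ≤ 1) : (1 + t)^n ≤ 1 + (2^n - 1) * t := by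
  induction n with
  | zero => simp
  | succ n ih =>
    have h2 : (1:ℝ) ≤ 2^n := one_le_pow₀ (by norm_num)
    calc (1+t)^(n+1) = (1+t)^n * (1+t) := pow_succ _ _
      _ ≤ (1 + (2^n - 1) * t) * (1 + t) := by gcongr
      _ ≤ 1 + (2^(n+1) - 1) * t := by
        rw [pow_succ]
        nlinarith [mul_nonneg (mul_nonneg (sub_nonneg.2 h2) h0) (sub_nonneg.2 h1)]

theorem ball_real {x : V} {ρ : ℝ} (h : 0 < ρ) :
    μ.real (ball x ρ) = μ.real (ball (0:V) 1) * ρ ^ (Module.finrank ℝ V) := by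
  unfold Measure.real
  rw [Measure.addHaar_ball_of_pos μ x h, ENNReal.toReal_mul, ENNReal.toReal_ofReal (by positivity), mul_comm]

set_option maxHeartbeats 1600000 in
theorem density [Nontrivial V] {r : ℝ} (hr : 0 < r) (hr1 : r < 1) {E : Set V} {x : V}
    (hsupp : ∀ δ > 0, 0 < μ (E ∩ ball x δ))
    (hDH : ∀ s, 0 ≤ s → s ≤ 4 → μ.real (NN μ r E ∩ ball x s) ≤ 2 * r * μ.real (E ∩ ball x s) +
      μ.real (PP μ r E ∩ (ball x (s + r) \ ball x (s - r)))) :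
    μ.real (ball (0:V) 1) * (1 / (32 * 2 ^ (Module.finrank ℝ V))) ^ (Module.finrank ℝ V) ≤
      μ.real (PP μ r E ∩ ball x 5) := by
  set n := Module.finrank ℝ V with hn
  have hn1 : 1 ≤ n := Module.finrank_pos
  set κ := μ.real (ball (0:V) 1) with hκ
  have hκ0 : 0 < κ := ENNReal.toReal_pos (measure_ball_pos μ _ one_pos).ne' (fin_bdd isBounded_ball)
  set J : ℕ := 32 * 2^n with hJ
  have hJ64 : 64 ≤ J := by
    have : 2^1 ≤ 2^n := Nat.pow_le_pow_right (by norm_num) hn1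
    omega
  have hJR : (64:ℝ) ≤ J := by exact_mod_cast hJ64
  have hJe : (32 * 2^n : ℝ) = J := by rw [hJ]; push_cast; ring
  rw [hJe]
  set c : ℝ := 1 / J with hc
  have hc0 : 0 < c := by positivity
  set v : ℕ → ℝ := fun j => μ.real (PP μ r E ∩ ball x ((2*j+1)*r)) with hv
  have hvf : ∀ s, μ (PP μ r E ∩ ball x s) ≠ ∞ := fun s => fin_bdd (isBounded_ball.subset inter_subset_right)
  have hvm : Monotone v := by
    intro i j hij
    refine mr_le (inter_subset_inter_right _ (ball_subset_ball ?_)) (hvf _)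
    have : (i:ℝ) ≤ j := by exact_mod_cast hij
    nlinarith
  have hv0 : v 0 = κ * r^n := by
    simp only [hv]
    have : PP μ r E ∩ ball x ((2*((0:ℕ):ℝ)+1)*r) = ball x r := by
      simp only [Nat.cast_zero, mul_zero, zero_add, one_mul]
      apply inter_eq_self_of_subset_right
      intro y hy
      rw [mem_ball] at hy
      have h1 := hsupp (r - dist y x) (by linarith)
      refine lt_of_lt_of_le h1 (measure_mono (inter_subset_inter_right _ (ball_subset_ball' ?_)))
      rw [dist_comm x y]; linarith
    rw [this, ball_real hr]
  have main : ∀ j : ℕ, 2 * j * r ≤ 4 → κ * (c * (j+1) * r)^n ≤ v j := by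
    intro j
    induction j with
    | zero =>
      intro _
      rw [hv0]
      have : c * ((0:ℕ)+1) * r ≤ r := by
        have : c ≤ 1 := by rw [hc, div_le_one (by positivity)]; linarith
        push_cast; nlinarith
      gcongr
    | succ i ih =>
      intro hj
      have hjr : (i:ℝ) * r ≤ 4 := by push_cast at hj; nlinarith
      have ih' := ih (by push_cast at hj; nlinarith)
      rcases Nat.lt_or_ge (i+1) J with hlt | hge
      · refine le_trans ?_ (hvm (Nat.zero_le (i+1)))
        rw [hv0]
        have : c * (((i+1:ℕ):ℝ)+1) * r ≤ r := by
          have h1 : (((i+1:ℕ):ℝ)+1) ≤ J := by exact_mod_cast hlt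
          have h2 : c * (((i+1:ℕ):ℝ)+1) ≤ 1 := by
            rw [hc, one_div, inv_mul_le_iff₀ (by positivity)]; linarith
          nlinarith
        gcongr
      · by_contra hcon
        push Not at hcon
        set j := i + 1 with hji
        have hj0 : (0:ℝ) < j := by rw [hji]; push_cast; positivity
        have hjJ : (J:ℝ) ≤ j := by exact_mod_cast hge
        have hcj : c * j = j / J := by rw [hc]; ring
        have hcj1 : 1 ≤ c * j := by rw [hcj, le_div_iff₀ (by positivity)]; linarith
        have hcle : c ≤ 1 := by rw [hc, div_le_one (by positivity)]; linarith
        set s : ℝ := 2 * j * r with hs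
        set Eh := E ∩ ball x s with hEh
        have hV1 : PP μ r Eh ⊆ PP μ r E ∩ ball x ((2*j+1)*r) := by
          intro y hy
          refine ⟨PP_sub inter_subset_left hy, ?_⟩
          have hy' : 0 < μ (Eh ∩ ball y r) := hy
          obtain ⟨z, hz⟩ := nonempty_of_measure_ne_zero hy'.ne'
          have z1 := hz.1.2
          have z2 := hz.2
          rw [mem_ball] at z1 z2 ⊢
          have := dist_triangle y z x
          rw [dist_comm y z] at this
          rw [hs] at z1; linarith
        have hV2 : PP μ r E ∩ ball x ((2*i+1)*r) ⊆ PP μ r Eh := by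
          rintro y ⟨hy1, hy2⟩
          refine PP_imp (Eventually.of_forall fun z hz hzE => ⟨hzE, ?_⟩) hy1
          rw [mem_ball] at hz hy2 ⊢
          have := dist_triangle z y x
          have : (j:ℝ) = i + 1 := by rw [hji]; push_cast; ring
          rw [hs, this]; linarith
        have fV : μ (PP μ r Eh) ≠ ∞ := ne_top_of_le_ne_top (hvf _) (measure_mono hV1)
        have hVv : μ.real (PP μ r Eh) ≤ v j := mr_le hV1 (hvf _)
        have hvV : v i ≤ μ.real (PP μ r Eh) := mr_le hV2 fV
        set ρ := 2 * (c * (j+1) * r) with hρ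
        have hρ0 : 0 < ρ := by positivity
        set m := ⌊c * (j+1)⌋₊ + 1 with hm
        have hm1 : c * (j+1) < m := by rw [hm]; push_cast; exact Nat.lt_floor_add_one _
        have hm2 : (m:ℝ) ≤ c * (j+1) + 1 := by
          rw [hm]; push_cast; linarith [Nat.floor_le (show 0 ≤ c * ((j:ℝ)+1) by positivity)]
        have hm4 : (m:ℝ) + 1 ≤ 4 * (c * j) := by nlinarith
        have iso := isoper (μ := μ) (A := Eh) fV (ρ := ρ) (m := m) hρ0 (by
          rw [ball_real hρ0, hρ, mul_pow]
          have h2n : (2:ℝ) ≤ 2^n := by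
            calc (2:ℝ) = 2^1 := by norm_num
              _ ≤ 2^n := pow_le_pow_right₀ (by norm_num) hn1
          have hpos : 0 < κ * (c * (j+1) * r)^n := by positivity
          have : μ.real (PP μ r Eh) ≤ κ * (c * (j+1) * r)^n := hVv.trans hcon.le
          rw [← hn]
          change _ ≤ κ * _
          nlinarith) (by rw [hρ]; nlinarith) (by omega)
        have hN : μ.real (NN μ r Eh) ≤ μ.real (NN μ r E ∩ ball x s) +
            μ.real (PP μ r E ∩ (ball x (s + r) \ ball x (s - r))) := by
          have fB1 : μ (NN μ r E ∩ ball x s) ≠ ∞ := fin_bdd (isBounded_ball.subset inter_subset_right)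
          have fB2 : μ (PP μ r E ∩ (ball x (s + r) \ ball x (s - r))) ≠ ∞ :=
            fin_bdd (isBounded_ball.subset (inter_subset_right.trans diff_subset))
          refine le_trans (mr_le ?_ (measure_union_lt_top fB1.lt_top fB2.lt_top).ne) (measureReal_union_le _ _)
          have := glue_NN (μ := μ) (r := r) (s := s) (c := x) (A := E) (B := ∅) (W := E)
            (Eventually.of_forall fun z hz => by simp [hz])
          rw [empty_diff, union_empty] at this
          intro y hy
          rcases this hy with (h | h) | h
          · exact Or.inl h
          · exfalso
            have h' : 0 < μ (∅ ∩ ball y r) := h.1.1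
            simp at h'
          · exact Or.inr h
        have hD := hDH s (by rw [hs]; positivity) (by rw [hs]; exact hj)
        have hEV : μ.real (E ∩ ball x s) ≤ μ.real (PP μ r Eh) :=
          ENNReal.toReal_mono fV (measure_mono_ae (le_PP hr Eh))
        have hσ : μ.real (PP μ r E ∩ (ball x (s + r) \ ball x (s - r))) = v j - v i := by
          have e1 : (2 * (j:ℝ) + 1) * r = s + r := by rw [hs]; ring
          have e2 : (2 * (i:ℝ) + 1) * r = s - r := by rw [hs, hji]; push_cast; ring
          simp only [hv]
          rw [e1, e2, ← measureReal_sdiff (inter_subset_inter_right _ (ball_subset_ball (by linarith)))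
            ((meas_PP μ r E).inter measurableSet_ball) (hvf _)]
          congr 1; ext z; simp only [mem_inter_iff, mem_diff]; tauto
        rw [hσ] at hN hD
        set Vv := μ.real (PP μ r Eh) with hVv'
        have hVv0 : 0 ≤ Vv := measureReal_nonneg
        have hm8 : ((m:ℝ) + 1) * r ≤ 1/8 := by
          have : (c * j) * r ≤ 1/32 := by
            have h1 : (j:ℝ) * r ≤ 2 := by rw [hs] at *; linarith
            have h2 : c * (j * r) ≤ c * 2 := mul_le_mul_of_nonneg_left h1 hc0.le
            have h3 : c ≤ 1/64 := by rw [hc]; exact one_div_le_one_div_of_le (by norm_num) hJR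
            nlinarith
          nlinarith
        have hfin : Vv ≤ 8 * (m+1) * (v j - v i) := by
          have h1 : μ.real (NN μ r Eh) ≤ 2 * r * Vv + 2 * (v j - v i) := by
            have : 2 * r * μ.real (E ∩ ball x s) ≤ 2 * r * Vv := by gcongr
            linarith
          have hmp : (0:ℝ) ≤ m + 1 := by positivity
          have h2 : Vv ≤ 2 * (m+1) * (2 * r * Vv + 2 * (v j - v i)) := iso.trans (by gcongr)
          have h3 : (m+1) * r * Vv ≤ 1/8 * Vv := by gcongr
          linarith
        have hdiff : 0 ≤ v j - v i := by have := hvm (show i ≤ j by omega); linarith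
        have hfin2 : v i ≤ 32 * (c * j) * (v j - v i) := by
          have : 8 * ((m:ℝ)+1) * (v j - v i) ≤ 8 * (4 * (c * j)) * (v j - v i) := by gcongr
          linarith
        have hfin3 : v i * (1 + 2^n / j) ≤ v j := by
          have e : 32 * (c * j) = j / 2^n := by
            rw [hc, ← hJe]; field_simp
          rw [e, div_mul_eq_mul_div, le_div_iff₀ (by positivity)] at hfin2
          have e2 : v i * (1 + 2^n/j) = v i + v i * 2^n / j := by ring
          rw [e2]
          have : v i * 2^n / j ≤ v j - v i := by rw [div_le_iff₀ hj0]; linarith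
          linarith
        have hij : (i:ℝ) + 1 = j := by rw [hji]; push_cast; ring
        have hfin4 : κ * (c * (j+1) * r)^n ≤ v i * (1 + 2^n / j) := by
          rw [hij] at ih'
          have e : c * ((j:ℝ)+1) * r = (c * j * r) * (1 + 1/j) := by field_simp
          have hj1 : (1:ℝ) ≤ j := by linarith
          have p := pow_aux n (t := 1/(j:ℝ)) (by positivity) (by rw [div_le_one hj0]; exact hj1)
          have p2 : (1 + 1/(j:ℝ))^n ≤ 1 + 2^n / j := by
            refine p.trans ?_
            have : (0:ℝ) ≤ 1/j := by positivity
            have e3 : (2:ℝ)^n / j = 2^n * (1/j) := by ring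
            rw [e3]; nlinarith
          rw [e, mul_pow, ← mul_assoc]
          gcongr
        linarith
  set j := ⌈1/r⌉₊ with hj
  have j1 : 1/r ≤ j := Nat.le_ceil _
  have j2 : (j:ℝ) < 1/r + 1 := Nat.ceil_lt_add_one (by positivity)
  have j3 : 1 ≤ j * r := by rwa [div_le_iff₀ hr] at j1
  have j4 : j * r < 2 := by
    have : j * r < (1/r + 1) * r := mul_lt_mul_of_pos_right j2 hr
    have e : (1/r + 1) * r = 1 + r := by field_simp
    linarith
  have := main j (by linarith)
  calc κ * c^n ≤ κ * (c * (j+1) * r)^n := by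
        gcongr
        nlinarith
    _ ≤ v j := this
    _ ≤ _ := mr_le (inter_subset_inter_right _ (ball_subset_ball (by nlinarith))) (hvf _)

theorem DH_in {r : ℝ} (hr : 0 < r) (hr1 : r < 1) {g : V → ℝ} (hg : GB μ g 1) {L U E : Set V}
    (h : OMin μ r g L U E) (hE : MeasurableSet E) (hLE : AL μ L E) (hEU : AL μ E U) {x : V}
    (hL : ∀ z ∈ L, z ∉ ball x 5) (s : ℝ) (hs4 : s ≤ 4) :
    μ.real (NN μ r E ∩ ball x s) ≤ 2 * r * μ.real (E ∩ ball x s) +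
      μ.real (PP μ r E ∩ (ball x (s + r) \ ball x (s - r))) := by
  have hAm : MeasurableSet (E \ ball x (s+1)) := hE.diff measurableSet_ball
  have := glue_cmp (W := E) hr hr1 hg h hE hAm hLE hEU
    (by filter_upwards [hLE] with z h1 h2
        exact ⟨h1 h2, fun h3 => hL z h2 (ball_subset_ball (by linarith) h3)⟩)
    (by filter_upwards [hEU] with z h1 h2; exact h1 h2.1)
    (Eventually.of_forall fun z hz => ⟨fun h => absurd h.1 hz, fun h => absurd h hz⟩) x s
  have e1 : NN μ r (E \ ball x (s+1)) ∩ ball x s = ∅ := by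
    rw [eq_empty_iff_forall_notMem]
    rintro y ⟨⟨hy, -⟩, hy2⟩
    refine notPP.2 (Eventually.of_forall fun z hz hzz => hzz.2 ?_) hy
    rw [mem_ball] at *
    linarith [dist_triangle z y x]
  have e2 : (E \ ball x (s+1)) ∩ ball x s = ∅ := by
    rw [eq_empty_iff_forall_notMem]
    rintro y ⟨hy, hy2⟩
    exact hy.2 (ball_subset_ball (by linarith) hy2)
  have hb := hg.bound (D := E ∩ ball x s) (fin_inter measure_ball_lt_top.ne)
  unfold JJ at this
  rw [e1, e2] at this
  simp only [measureReal_empty, zero_div, setIntegral_empty, zero_add] at this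
  have h3 := neg_le_of_abs_le hb
  have h4 : μ.real (NN μ r E ∩ ball x s) / (2*r) ≤ μ.real (E ∩ ball x s) +
    μ.real (PP μ r E ∩ (ball x (s + r) \ ball x (s - r))) / (2*r) := by linarith
  have h5 : (0:ℝ) < 2 * r := by positivity
  rw [← sub_nonneg] at h4 ⊢
  have := mul_nonneg h4 h5.le
  field_simp at this
  linarith

theorem DH_out {r : ℝ} (hr : 0 < r) (hr1 : r < 1) {g : V → ℝ} (hg : GB μ g 1) {L U E : Set V}
    (h : OMin μ r g L U E) (hE : MeasurableSet E) (hLE : AL μ L E) (hEU : AL μ E U) {x : V}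
    (hU : ball x 5 ⊆ U) (s : ℝ) (hs4 : s ≤ 4) :
    μ.real (NN μ r Eᶜ ∩ ball x s) ≤ 2 * r * μ.real (Eᶜ ∩ ball x s) +
      μ.real (PP μ r Eᶜ ∩ (ball x (s + r) \ ball x (s - r))) := by
  have hAm : MeasurableSet (E ∪ ball x (s+1)) := hE.union measurableSet_ball
  have := glue_cmp (W := Eᶜ) hr hr1 hg h hE hAm hLE hEU
    (by filter_upwards [hLE] with z h1 h2
        exact Or.inl (h1 h2))
    (by filter_upwards [hEU] with z h1 h2
        rcases h2 with h2 | h2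
        · exact h1 h2
        · exact hU (ball_subset_ball (by linarith) h2))
    (Eventually.of_forall fun z hz => by
      have : z ∈ E := by simpa using hz
      exact ⟨fun _ => this, fun _ => Or.inl this⟩) x s
  have e1 : NN μ r (E ∪ ball x (s+1)) ∩ ball x s = ∅ := by
    rw [eq_empty_iff_forall_notMem]
    rintro y ⟨⟨-, hy⟩, hy2⟩
    refine notPP.2 (Eventually.of_forall fun z hz hzz => ?_) hy
    refine hzz (Or.inr ?_)
    rw [mem_ball] at *
    linarith [dist_triangle z y x]
  have e2 : (E ∪ ball x (s+1)) ∩ ball x s = (E ∩ ball x s) ∪ (Eᶜ ∩ ball x s) := by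
    ext y
    have : y ∈ ball x s → y ∈ ball x (s+1) := fun h => ball_subset_ball (by linarith) h
    simp only [mem_inter_iff, mem_union, mem_compl_iff]; tauto
  have hb := hg.bound (D := Eᶜ ∩ ball x s) (fin_inter measure_ball_lt_top.ne)
  unfold JJ at this
  rw [e1, e2, setIntegral_union (disjoint_compl_right.mono inter_subset_left inter_subset_left)
    (hE.compl.inter measurableSet_ball) (hg.intOn (fin_inter measure_ball_lt_top.ne))
    (hg.intOn (fin_inter measure_ball_lt_top.ne))] at this
  simp only [measureReal_empty, zero_div, zero_add] at this
  have h3 := le_of_abs_le hb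
  have h4 : μ.real (NN μ r E ∩ ball x s) / (2*r) ≤ μ.real (Eᶜ ∩ ball x s) +
    μ.real (PP μ r Eᶜ ∩ (ball x (s + r) \ ball x (s - r))) / (2*r) := by linarith
  have h5 : (0:ℝ) < 2 * r := by positivity
  rw [NN_compl]
  rw [← sub_nonneg] at h4 ⊢
  have := mul_nonneg h4 h5.le
  field_simp at this
  linarith

theorem supp_pt {E B : Set V} (hB : IsOpen B) (h : 0 < μ (E ∩ B)) :
    ∃ x ∈ B, ∀ δ > 0, 0 < μ (E ∩ ball x δ) := by
  obtain ⟨x, hx, hx2⟩ := exists_mem_forall_mem_nhdsWithin_pos_measure h.ne'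
  refine ⟨x, hx.2, fun δ hδ => hx2 _ ?_⟩
  rw [mem_nhdsWithin]
  exact ⟨ball x δ, isOpen_ball, mem_ball_self hδ, fun z hz => ⟨hz.2.1, hz.1⟩⟩

theorem exists_shift {P Q : Set V} (hP : MeasurableSet P) (hQ : MeasurableSet Q) {c : V} {ρ : ℝ}
    (hPb : P ⊆ ball c ρ) (hQb : Q ⊆ ball c ρ) (h0 : 0 < μ.real P) (h1 : 0 < μ.real Q) :
    ∃ h : V, ‖h‖ < 2 * ρ ∧ μ.real P * μ.real Q ≤ 2 * μ.real (ball (0:V) (2*ρ)) * μ.real (P ∩ tr h Q) := by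
  have fP : μ P ≠ ∞ := ne_top_of_le_ne_top measure_ball_lt_top.ne (measure_mono hPb)
  have fQ : μ Q ≠ ∞ := ne_top_of_le_ne_top measure_ball_lt_top.ne (measure_mono hQb)
  by_contra hcon
  push Not at hcon
  obtain ⟨hm, hi⟩ := avg_meas (μ := μ) hP hQ
  set M := μ.real (ball (0:V) (2*ρ)) with hM
  have hMpos : 0 < M := by
    obtain ⟨x, hx⟩ : P.Nonempty := by
      by_contra hne; rw [not_nonempty_iff_eq_empty] at hne; rw [hne] at h0; simp at h0
    have := hPb hx
    have hρ : 0 < ρ := lt_of_le_of_lt dist_nonneg (mem_ball.1 this)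
    exact ENNReal.toReal_pos (measure_ball_pos _ _ (by linarith)).ne' measure_ball_lt_top.ne
  have hz : ∀ h, h ∉ ball (0:V) (2*ρ) → μ (P ∩ tr h Q) = 0 := by
    intro h hh
    have : P ∩ tr h Q = ∅ := by
      rw [eq_empty_iff_forall_notMem]
      rintro u ⟨hu, hv⟩
      apply hh
      have a := hPb hu; have b := hQb (mem_tr.1 hv)
      rw [mem_ball] at a b
      rw [mem_ball_zero_iff]
      have : dist (u+h) u = ‖h‖ := by simp [dist_eq_norm]
      linarith [dist_triangle (u+h) c u, dist_comm c u]
    rw [this, measure_empty]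
  have hle : ∀ h, μ (P ∩ tr h Q) ≤ (ball (0:V) (2*ρ)).indicator (fun _ => ENNReal.ofReal (μ.real P * μ.real Q / (2*M))) h := by
    intro h
    by_cases hh : h ∈ ball (0:V) (2*ρ)
    · rw [indicator_of_mem hh]
      have := hcon h (by rwa [mem_ball_zero_iff] at hh)
      rw [← ofReal_measureReal (ne_top_of_le_ne_top fP (measure_mono inter_subset_left))]
      apply ENNReal.ofReal_le_ofReal
      rw [le_div_iff₀ (by positivity)]; linarith
    · rw [hz h hh]; exact zero_le
  have := lintegral_mono (μ := μ) hle
  rw [hi, lintegral_indicator_const measurableSet_ball, ← ofReal_measureReal fP, ← ofReal_measureReal fQ,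
    ← ofReal_measureReal (measure_ball_lt_top.ne), ← ENNReal.ofReal_mul measureReal_nonneg, ← ENNReal.ofReal_mul (by positivity)] at this
  rw [ENNReal.ofReal_le_ofReal_iff (by positivity)] at this
  rw [← hM] at this
  have h2 : μ.real P * μ.real Q / (2*M) * M = μ.real P * μ.real Q / 2 := by field_simp
  rw [h2] at this
  have := mul_pos h0 h1
  linarith

theorem mixed [Nontrivial V] (μ : Measure V) [μ.IsAddHaarMeasure] {ρ0 : ℝ} (hρ0 : 0 < ρ0) :
    ∃ c2 : ℝ, 0 < c2 ∧ ∀ r : ℝ, 0 < r → r < 1 → ∀ (E : Set V) (c : V), MeasurableSet E →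
      0 < μ (E ∩ ball c ρ0) → 0 < μ (Eᶜ ∩ ball c ρ0) →
      (∀ x ∈ ball c ρ0, ∀ s : ℝ, s ≤ 4 → μ.real (NN μ r E ∩ ball x s) ≤ 2 * r * μ.real (E ∩ ball x s) +
        μ.real (PP μ r E ∩ (ball x (s + r) \ ball x (s - r)))) →
      (∀ x ∈ ball c ρ0, ∀ s : ℝ, s ≤ 4 → μ.real (NN μ r Eᶜ ∩ ball x s) ≤ 2 * r * μ.real (Eᶜ ∩ ball x s) +
        μ.real (PP μ r Eᶜ ∩ (ball x (s + r) \ ball x (s - r)))) →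
      c2 * r ≤ μ.real (NN μ r E ∩ ball c (ρ0 + 5)) := by
  set c0 := μ.real (ball (0:V) 1) * (1 / (32 * 2 ^ (Module.finrank ℝ V))) ^ (Module.finrank ℝ V) with hc0
  have hk : 0 < μ.real (ball (0:V) 1) :=
    ENNReal.toReal_pos (measure_ball_pos _ _ one_pos).ne' measure_ball_lt_top.ne
  have hc0p : 0 < c0 := by positivity
  set M := μ.real (ball (0:V) (2*(ρ0+5))) with hM
  have hMp : 0 < M := ENNReal.toReal_pos (measure_ball_pos _ _ (by linarith)).ne' measure_ball_lt_top.ne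
  refine ⟨min (c0/2) ((c0/2*(c0/2))/(2*M)/(ρ0+7)), by positivity, ?_⟩
  intro r hr hr1 E c hE hE1 hE2 hD1 hD2
  set N := NN μ r E ∩ ball c (ρ0+5) with hN
  have fN : μ N ≠ ∞ := fin_inter measure_ball_lt_top.ne
  by_cases hbig : c0/2 ≤ μ.real N
  · refine le_trans ?_ hbig
    have : min (c0/2) ((c0/2*(c0/2))/(2*M)/(ρ0+7)) ≤ c0/2 := min_le_left _ _
    nlinarith
  push Not at hbig
  obtain ⟨x, hx, hx2⟩ := supp_pt isOpen_ball hE1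
  obtain ⟨y, hy, hy2⟩ := supp_pt isOpen_ball hE2
  have d1 := density hr hr1 hx2 (fun s _ h => hD1 x hx s h)
  have d2 := density hr hr1 hy2 (fun s _ h => hD2 y hy s h)
  rw [← hc0] at d1 d2
  have sub : ∀ z ∈ ball c ρ0, ball z 5 ⊆ ball c (ρ0+5) := by
    intro z hz; apply ball_subset_ball'; rw [mem_ball] at hz; linarith
  have key : ∀ (z : V) (S : Set V), z ∈ ball c ρ0 → c0 ≤ μ.real (S ∩ ball z 5) →
      c0/2 ≤ μ.real ((S ∩ ball z 5) \ NN μ r E) := by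
    intro z S hz hS
    have h1 : S ∩ ball z 5 ⊆ ((S ∩ ball z 5) \ NN μ r E) ∪ N := by
      intro w hw
      by_cases h : w ∈ NN μ r E
      · exact Or.inr ⟨h, sub z hz hw.2⟩
      · exact Or.inl ⟨hw, h⟩
    have h2 := mr_le (μ := μ) h1 (measure_union_lt_top
      (lt_of_le_of_lt (measure_mono (diff_subset.trans inter_subset_right)) measure_ball_lt_top) fN.lt_top).ne
    have h3 := measureReal_union_le (μ := μ) ((S ∩ ball z 5) \ NN μ r E) N
    linarith
  have k1 := key x _ hx d1
  have k2 := key y _ hy d2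
  obtain ⟨h, hh, hh2⟩ := exists_shift (μ := μ) (c := c) (ρ := ρ0+5)
    (((meas_PP μ r E).inter measurableSet_ball).diff (meas_NN μ r E))
    (((meas_PP μ r Eᶜ).inter measurableSet_ball).diff (meas_NN μ r E))
    (diff_subset.trans (inter_subset_right.trans (sub x hx)))
    (diff_subset.trans (inter_subset_right.trans (sub y hy))) (by linarith) (by linarith)
  set S := ((PP μ r E ∩ ball x 5) \ NN μ r E) ∩ tr h ((PP μ r Eᶜ ∩ ball y 5) \ NN μ r E) with hS
  set m := ⌈(ρ0+5)/r⌉₊ with hm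
  have hm1 : (ρ0+5)/r ≤ m := Nat.le_ceil _
  have hm2 : (m:ℝ) < (ρ0+5)/r + 1 := Nat.ceil_lt_add_one (by positivity)
  have hm0 : 0 < m := Nat.ceil_pos.2 (by positivity)
  have hcs := chain_sum (r := r) (A := E) (S := S) (h := h) hm0 fN (by
    rintro u ⟨⟨hu, hun⟩, ⟨hv, hvn⟩⟩
    have hv' : u + h ∉ PP μ r E := fun h' => hvn ⟨h', hv.1⟩
    have hlt : ‖h‖ < 2 * r * m := by
      refine hh.trans_le ?_
      rw [div_le_iff₀ hr] at hm1
      nlinarith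
    obtain ⟨j, hj, hj2⟩ := chain hm0 hu.1 hv' hlt
    refine ⟨j, hj, hj2, ?_⟩
    have hmr : (0:ℝ) < m := by exact_mod_cast hm0
    have hjm : (j:ℝ)/m ≤ 1 := by rw [div_le_one hmr]; exact_mod_cast hj
    have := (convex_ball c (ρ0+5)).add_smul_sub_mem (sub x hx hu.2) (sub y hy hv.2) ⟨by positivity, hjm⟩
    simpa using this)
  have h8 : ((m:ℝ)+1) ≤ (ρ0+7)/r := by
    have : (ρ0+7)/r = (ρ0+5)/r + 2/r := by ring
    have h2 : 2 ≤ 2/r := by rw [le_div_iff₀ hr]; linarith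
    linarith
  have h9 : (c0/2*(c0/2)) ≤ 2 * M * ((ρ0+7)/r * μ.real N) := by
    calc (c0/2*(c0/2)) ≤ _ := mul_le_mul k1 k2 (by positivity) (by linarith)
      _ ≤ 2 * M * μ.real S := hh2
      _ ≤ _ := by
        gcongr
        exact hcs.trans (mul_le_mul_of_nonneg_right h8 measureReal_nonneg)
  calc min (c0/2) ((c0/2*(c0/2))/(2*M)/(ρ0+7)) * r ≤ ((c0/2*(c0/2))/(2*M)/(ρ0+7)) * r := by
        gcongr; exact min_le_right _ _
    _ ≤ ((2 * M * ((ρ0+7)/r * μ.real N))/(2*M)/(ρ0+7)) * r := by gcongr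
    _ = μ.real N := by field_simp

theorem growth {φ : ℝ → ℝ} {κ : ℝ} {n : ℕ} (hκ : ∀ R, 0 < R → φ R ≤ κ * R ^ n) {R1 : ℝ} (hR1 : 0 ≤ R1)
    (hp : 0 < φ R1) {c C : ℝ} (hc : 0 < c) (hC : 0 < C)
    (h : ∀ R, R1 ≤ R → c * φ R ≤ φ (R + C) - φ R) : False := by
  have h1 : ∀ m : ℕ, (1+c)^m * φ R1 ≤ φ (R1 + m * C) := by
    intro m
    induction m with
    | zero => simp
    | succ m ih =>
      have := h (R1 + m * C) (by have : 0 ≤ (m:ℝ) * C := by positivity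
                                 linarith)
      have e : R1 + (m+1:ℕ) * C = R1 + m * C + C := by push_cast; ring
      rw [e, pow_succ]
      nlinarith
  have hκ0 : 0 ≤ κ := by
    have a := hκ (R1 + C) (by linarith)
    have b := h1 1
    simp only [Nat.cast_one, one_mul, pow_one] at b
    by_contra hneg
    push Not at hneg
    have : κ * (R1 + C)^n ≤ 0 := mul_nonpos_of_nonpos_of_nonneg hneg.le (by positivity)
    nlinarith
  have h2 : ∀ m : ℕ, 1 ≤ m → φ R1 ≤ κ * (R1 + C)^n * ((m:ℝ)^n / (1+c)^m) := by
    intro m hm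
    have hm' : (1:ℝ) ≤ m := by exact_mod_cast hm
    have a := hκ (R1 + m*C) (by nlinarith)
    have b := h1 m
    have d : (R1 + m * C)^n ≤ ((R1+C)*m)^n := by
      apply pow_le_pow_left₀ (by positivity); nlinarith
    have e : (1+c)^m * φ R1 ≤ κ * ((R1+C)*m)^n := b.trans (a.trans (by gcongr))
    rw [mul_div_assoc', le_div_iff₀ (by positivity)]
    rw [mul_pow] at e
    nlinarith
  have h3 := (tendsto_pow_const_div_const_pow_of_one_lt n (show 1 < 1 + c by linarith)).const_mul (κ * (R1 + C)^n)
  rw [mul_zero] at h3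
  have h4 := ge_of_tendsto h3 (eventually_atTop.2 ⟨1, h2⟩)
  linarith

def SL (ω : V) (α β : ℝ) : Set V := {x | α ≤ ⟪ω, x⟫ ∧ ⟪ω, x⟫ ≤ β}

theorem mem_SL {ω : V} {α β : ℝ} {x : V} : x ∈ SL ω α β ↔ α ≤ ⟪ω, x⟫ ∧ ⟪ω, x⟫ ≤ β := Iff.rfl

theorem meas_SL (ω : V) (α β : ℝ) : MeasurableSet (SL ω α β) := by
  have : Measurable (fun x : V => ⟪ω, x⟫) := by fun_prop
  exact (measurableSet_le measurable_const this).inter (measurableSet_le this measurable_const)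

theorem SL_mono (ω : V) {α β α' β' : ℝ} (h1 : α' ≤ α) (h2 : β ≤ β') : SL ω α β ⊆ SL ω α' β' :=
  fun x hx => ⟨h1.trans hx.1, hx.2.trans h2⟩

theorem in_le {ω : V} (hω : ‖ω‖ = 1) (x y : V) : |⟪ω, x⟫ - ⟪ω, y⟫| ≤ dist x y := by
  rw [← inner_sub_right, dist_eq_norm]
  have := abs_real_inner_le_norm ω (x - y)
  rwa [hω, one_mul] at this

theorem shell_split (W : Set V) (R1 R2 : ℝ) (h : R1 ≤ R2) :
    μ.real (W ∩ ball 0 R2) = μ.real (W ∩ ball (0:V) R1) + μ.real (W ∩ (ball 0 R2 \ ball 0 R1)) := by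
  have e := measureReal_inter_add_diff (μ := μ) (s := W ∩ ball (0:V) R2) (t := ball (0:V) R1) measurableSet_ball
    (fin_inter measure_ball_lt_top.ne)
  rw [← e]
  congr 2
  · ext x
    have : x ∈ ball (0:V) R1 → x ∈ ball (0:V) R2 := fun hx => ball_subset_ball h hx
    simp only [mem_inter_iff]; tauto
  · ext x; simp only [mem_inter_iff, mem_diff]; tauto

theorem fin_shell (W : Set V) (R1 R2 : ℝ) : μ (W ∩ (ball 0 R2 \ ball (0:V) R1)) ≠ ∞ :=
  ne_top_of_le_ne_top measure_ball_lt_top.ne (measure_mono (inter_subset_right.trans diff_subset))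

theorem shell_mono {W W' : Set V} (h : W ⊆ W') {R1 R2 R1' R2' : ℝ} (h1 : R1' ≤ R1) (h2 : R2 ≤ R2') :
    μ.real (W ∩ (ball 0 R2 \ ball (0:V) R1)) ≤ μ.real (W' ∩ (ball 0 R2' \ ball (0:V) R1')) := by
  apply mr_le _ (fin_shell _ _ _)
  exact inter_subset_inter h (diff_subset_diff (ball_subset_ball h2) (ball_subset_ball h1))

theorem ballW_mono {W W' : Set V} (h : W ⊆ W') {R R' : ℝ} (h1 : R ≤ R') :
    μ.real (W ∩ ball (0:V) R) ≤ μ.real (W' ∩ ball (0:V) R') :=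
  mr_le (inter_subset_inter h (ball_subset_ball h1)) (fin_inter measure_ball_lt_top.ne)

theorem growth_set {W : Set V} {R1 : ℝ} (hp : 0 < μ.real (W ∩ ball (0:V) R1)) {c C : ℝ} (hc : 0 < c) (hC : 0 < C)
    (h : ∀ R, R1 ≤ R → c * μ.real (W ∩ ball (0:V) R) ≤ μ.real (W ∩ (ball 0 (R + C) \ ball (0:V) R))) : False := by
  have hR1 : 0 ≤ R1 := by
    by_contra hn
    push Not at hn
    rw [ball_eq_empty.2 hn.le, inter_empty] at hp
    simp at hp
  refine growth (φ := fun R => μ.real (W ∩ ball (0:V) R)) (κ := μ.real (ball (0:V) 1)) (n := Module.finrank ℝ V)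
    (fun R hR => ?_) hR1 hp hc hC (fun R hR => ?_)
  · rw [← ball_real (μ := μ) (x := (0:V)) hR]
    exact mr_le inter_subset_right measure_ball_lt_top.ne
  · have := shell_split (μ := μ) W R (R+C) (by linarith)
    have := h R hR
    linarith

theorem SL_pos {ω : V} (hω : ‖ω‖ = 1) {α β : ℝ} (h : α < β) : ∃ R1 : ℝ, 0 < μ.real (SL ω α β ∩ ball (0:V) R1) := by
  set p : V := ((α+β)/2) • ω with hp
  have hωω : ⟪ω, ω⟫ = 1 := by rw [real_inner_self_eq_norm_sq, hω]; norm_num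
  have hip : ⟪ω, p⟫ = (α+β)/2 := by rw [hp, inner_smul_right, hωω, mul_one]
  refine ⟨‖p‖ + (β-α)/2, ?_⟩
  have hsub : ball p ((β-α)/2) ⊆ SL ω α β ∩ ball (0:V) (‖p‖ + (β-α)/2) := by
    intro x hx
    rw [mem_ball] at hx
    have := in_le hω x p
    rw [hip, abs_le] at this
    refine ⟨⟨by linarith, by linarith⟩, ?_⟩
    rw [mem_ball]
    have := dist_triangle x p 0
    rw [dist_zero_right p] at this
    linarith
  exact lt_of_lt_of_le (ENNReal.toReal_pos (measure_ball_pos _ _ (by linarith)).ne' measure_ball_lt_top.ne)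
    (mr_le hsub (fin_inter measure_ball_lt_top.ne))

/-- growth contradiction for slabs -/
theorem growth_slab {ω : V} (hω : ‖ω‖ = 1) {α β : ℝ} (hαβ : α < β) {c C R0 : ℝ} (hc : 0 < c) (hC : 0 < C)
    (h : ∀ R, R0 ≤ R → c * μ.real (SL ω α β ∩ ball (0:V) (R - C)) ≤
      μ.real (SL ω α β ∩ (ball 0 (R + C) \ ball (0:V) (R - C)))) : False := by
  obtain ⟨R1, h1⟩ := SL_pos (μ := μ) hω hαβ
  refine growth_set (W := SL ω α β) (R1 := max R1 R0) (C := 2*C)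
    (lt_of_lt_of_le h1 (ballW_mono subset_rfl (le_max_left _ _))) hc (by linarith) (fun R hR => ?_)
  have := h (R + C) (by linarith [le_max_right R1 R0])
  rw [show R + C - C = R by ring, show R + C + C = R + 2 * C by ring] at this
  exact this

theorem slab_cover {ω : V} (hω : ‖ω‖ = 1) {α β α' β' C : ℝ} (T : Finset ℝ) (hC : ∀ τ ∈ T, |τ| ≤ C)
    (hT : ∀ x, α ≤ x → x ≤ β → ∃ τ ∈ T, α' ≤ x - τ ∧ x - τ ≤ β') (R1 R2 : ℝ) :
    μ.real (SL ω α β ∩ (ball 0 R2 \ ball (0:V) R1)) ≤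
      T.card * μ.real (SL ω α' β' ∩ (ball 0 (R2 + C) \ ball (0:V) (R1 - C))) := by
  have hωω : ⟪ω, ω⟫ = 1 := by rw [real_inner_self_eq_norm_sq, hω]; norm_num
  set S := SL ω α' β' ∩ (ball 0 (R2 + C) \ ball (0:V) (R1 - C)) with hS
  have hsub : SL ω α β ∩ (ball 0 R2 \ ball (0:V) R1) ⊆ ⋃ τ ∈ T, tr (-(τ • ω)) S := by
    rintro x ⟨hx, hx2, hx1⟩
    obtain ⟨τ, hτ, h1, h2⟩ := hT _ hx.1 hx.2
    have hi : ⟪ω, x + -(τ • ω)⟫ = ⟪ω, x⟫ - τ := by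
      rw [inner_add_right, inner_neg_right, inner_smul_right, hωω]; ring
    have hn : ‖τ • ω‖ ≤ C := by rw [norm_smul, hω, mul_one]; exact hC τ hτ
    simp only [mem_iUnion]
    refine ⟨τ, hτ, ?_⟩
    rw [mem_tr]
    rw [mem_ball_zero_iff] at hx1 hx2
    refine ⟨by rw [mem_SL, hi]; exact ⟨h1, h2⟩, ?_, ?_⟩
    · rw [mem_ball_zero_iff]
      have := norm_add_le x (-(τ • ω)); rw [norm_neg] at this; linarith
    · rw [mem_ball_zero_iff]
      have := norm_add_le (x + -(τ • ω)) (τ • ω)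
      rw [neg_add_cancel_right] at this; linarith
  have fS : μ S ≠ ∞ := fin_shell _ _ _
  calc _ ≤ μ.real (⋃ τ ∈ T, tr (-(τ • ω)) S) := by
        apply mr_le hsub
        refine (lt_of_le_of_lt (measure_biUnion_finset_le _ _) ?_).ne
        rw [ENNReal.sum_lt_top]
        intro τ _; rw [measure_tr]; exact fS.lt_top
    _ ≤ ∑ τ ∈ T, μ.real (tr (-(τ • ω)) S) := measureReal_biUnion_finset_le _ _
    _ = _ := by simp [real_tr]

theorem slab_cover_ball {ω : V} (hω : ‖ω‖ = 1) {α β α' β' C : ℝ} (T : Finset ℝ) (hC0 : 0 ≤ C) (hC : ∀ τ ∈ T, |τ| ≤ C)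
    (hT : ∀ x, α ≤ x → x ≤ β → ∃ τ ∈ T, α' ≤ x - τ ∧ x - τ ≤ β') (R2 : ℝ) :
    μ.real (SL ω α β ∩ ball 0 R2) ≤
      T.card * μ.real (SL ω α' β' ∩ ball 0 (R2 + C)) := by
  have := slab_cover (μ := μ) hω T hC hT 0 R2
  rwa [ball_zero, diff_empty, ball_eq_empty.2 (show 0 - C ≤ 0 by linarith), diff_empty] at this

theorem slab_any {ω : V} (hω : ‖ω‖ = 1) (α β : ℝ) {α' β' : ℝ} (h : α' < β') :
    ∃ (N C : ℝ), 0 < N ∧ 0 < C ∧ (∀ R1 R2, μ.real (SL ω α β ∩ (ball 0 R2 \ ball (0:V) R1)) ≤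
      N * μ.real (SL ω α' β' ∩ (ball 0 (R2 + C) \ ball (0:V) (R1 - C)))) ∧
      ∀ R2, μ.real (SL ω α β ∩ ball 0 R2) ≤ N * μ.real (SL ω α' β' ∩ ball (0:V) (R2 + C)) := by
  set d := β' - α' with hd
  have hdp : 0 < d := by linarith
  set m : ℕ := ⌈(β - α)/d⌉₊ + 1 with hm
  set T : Finset ℝ := (Finset.range m).image (fun i : ℕ => α - α' + i * d) with hTdef
  have hcard : (T.card : ℝ) ≤ m := by
    exact_mod_cast (Finset.card_image_le).trans (by simp)
  have hC : ∀ τ ∈ T, |τ| ≤ |α - α'| + m * d := by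
    intro τ hτ
    rw [hTdef, Finset.mem_image] at hτ
    obtain ⟨i, hi, rfl⟩ := hτ
    refine (abs_add_le _ _).trans ?_
    rw [abs_of_nonneg (show (0:ℝ) ≤ i * d by positivity)]
    have : (i:ℝ) ≤ m := by exact_mod_cast (Finset.mem_range.1 hi).le
    gcongr
  have hT : ∀ x, α ≤ x → x ≤ β → ∃ τ ∈ T, α' ≤ x - τ ∧ x - τ ≤ β' := by
    intro x h1 h2
    set i := ⌊(x - α)/d⌋₊ with hi
    have a1 : (i:ℝ) ≤ (x-α)/d := Nat.floor_le (div_nonneg (by linarith) hdp.le)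
    have a2 : (x-α)/d < i + 1 := Nat.lt_floor_add_one _
    rw [le_div_iff₀ hdp] at a1
    rw [div_lt_iff₀ hdp] at a2
    refine ⟨α - α' + i * d, ?_, by linarith, by linarith⟩
    rw [hTdef, Finset.mem_image]
    refine ⟨i, ?_, rfl⟩
    rw [Finset.mem_range, hm, Nat.lt_succ_iff]
    refine le_trans ?_ (Nat.floor_le_ceil _)
    exact Nat.floor_le_floor (by gcongr)
  refine ⟨m, |α - α'| + m * d, by rw [hm]; positivity, ?_, fun R1 R2 => ?_, fun R2 => ?_⟩
  · have : (0:ℝ) < m := by rw [hm]; positivity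
    positivity
  · refine (slab_cover hω T hC hT R1 R2).trans ?_
    gcongr
  · refine (slab_cover_ball hω T (by positivity) hC hT R2).trans ?_
    gcongr

theorem fubini_low {S X : Set V} (hS : MeasurableSet S) (hX : MeasurableSet X) (fS : μ S ≠ ∞) (fX : μ X ≠ ∞)
    {ρ q : ℝ} (hq : 0 ≤ q) (h : ∀ c ∈ X, q ≤ μ.real (S ∩ ball c ρ)) :
    q * μ.real X ≤ μ.real S * μ.real (ball (0:V) ρ) := by
  obtain ⟨hm, hi⟩ := avg_meas (μ := μ) hS (measurableSet_ball (x := (0:V)) (ε := ρ))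
  have hle : ∀ v, (-X).indicator (fun _ => ENNReal.ofReal q) v ≤ μ (S ∩ tr v (ball (0:V) ρ)) := by
    intro v
    by_cases hv : v ∈ -X
    · rw [indicator_of_mem hv, tr_ball, zero_sub, ← ofReal_measureReal (ne_top_of_le_ne_top fS (measure_mono inter_subset_left))]
      exact ENNReal.ofReal_le_ofReal (h _ (Set.mem_neg.1 hv))
    · rw [indicator_of_notMem hv]; exact zero_le
  have := lintegral_mono (μ := μ) hle
  rw [hi, lintegral_indicator_const hX.neg, Measure.measure_neg, ← ofReal_measureReal fS, ← ofReal_measureReal fX,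
    ← ofReal_measureReal (measure_ball_lt_top.ne), ← ENNReal.ofReal_mul measureReal_nonneg, ← ENNReal.ofReal_mul hq] at this
  rwa [ENNReal.ofReal_le_ofReal_iff (by positivity)] at this

theorem int_off {g : V → ℝ} {b : ℝ} (hg : GB μ g b) {A E W D : Set V}
    (hWm : MeasurableSet W) (hW : ∀ᵐ x ∂μ, x ∉ W → (x ∈ A ↔ x ∈ E)) (fD : μ D ≠ ∞) (hb : 0 ≤ b) :
    |(∫ x in A ∩ D, g x ∂μ) - ∫ x in E ∩ D, g x ∂μ| ≤ 2 * b * μ.real (W ∩ D) := by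
  have h1 : ∀ S : Set V, (∫ x in S ∩ D, g x ∂μ) = (∫ x in (S ∩ D) ∩ W, g x ∂μ) + ∫ x in (S ∩ D) \ W, g x ∂μ :=
    fun S => (integral_inter_add_diff hWm (hg.intOn (fin_inter fD))).symm
  have h2 : (∫ x in (A ∩ D) \ W, g x ∂μ) = ∫ x in (E ∩ D) \ W, g x ∂μ := by
    apply setIntegral_congr_set
    filter_upwards [hW] with x hx
    apply propext
    change (x ∈ A ∩ D ∧ x ∉ W) ↔ (x ∈ E ∩ D ∧ x ∉ W)
    simp only [mem_inter_iff]; tauto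
  have h3 : ∀ S : Set V, |∫ x in (S ∩ D) ∩ W, g x ∂μ| ≤ b * μ.real (W ∩ D) := by
    intro S
    refine (hg.bound (ne_top_of_le_ne_top fD (measure_mono (inter_subset_left.trans inter_subset_right)))).trans ?_
    apply mul_le_mul_of_nonneg_left _ hb
    exact mr_le (fun x hx => ⟨hx.2, hx.1.2⟩) (fin_inter fD)
  rw [h1 A, h1 E, h2]
  have a := h3 A; have e := h3 E
  rw [abs_le] at *
  constructor <;> linarith

theorem NN_HH {ω : V} (hω : ‖ω‖ = 1) {r s : ℝ} : NN μ r (HH ω s) ⊆ {x | s - r < ⟪ω, x⟫ ∧ ⟪ω, x⟫ < s + r} := by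
  rintro y ⟨h1, h2⟩
  rw [mem_setOf_eq]
  constructor
  · by_contra hn
    push Not at hn
    refine notPP.2 (Eventually.of_forall fun z hz hzz => ?_) h2
    refine hzz ?_
    rw [mem_ball] at hz
    have := in_le hω z y
    rw [abs_le] at this
    rw [mem_HH]; linarith
  · by_contra hn
    push Not at hn
    refine notPP.2 (Eventually.of_forall fun z hz hzz => ?_) h1
    rw [mem_ball] at hz
    have := in_le hω z y
    rw [abs_le] at this
    rw [mem_HH] at hzz; linarith

/-- choose a good hyperplane -/
theorem good_plane {ω : V} (hω : ‖ω‖ = 1) {r : ℝ} (hr : 0 < r) (hr1 : r < 1) (a T1 : ℝ) (hT1 : 0 < T1) {W D : Set V}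
    (hW : SL ω a (a + T1 + 2) ⊆ W) (hD : MeasurableSet D) (fD : μ D ≠ ∞) :
    ∃ s, a ≤ s ∧ s ≤ a + T1 + 2 ∧ μ.real (NN μ r (HH ω s) ∩ D) / (2*r) ≤ μ.real (W ∩ D) / T1 := by
  set N : ℕ := ⌊(T1+2)/(2*r)⌋₊ with hN
  have hN1 : (N:ℝ) ≤ (T1+2)/(2*r) := Nat.floor_le (by positivity)
  have hN2 : (T1+2)/(2*r) < N + 1 := Nat.lt_floor_add_one _
  rw [le_div_iff₀ (by positivity)] at hN1
  rw [div_lt_iff₀ (by positivity)] at hN2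
  have hNT : T1 ≤ N * (2*r) := by nlinarith
  have hNp : 0 < N := by
    by_contra h0
    have : N = 0 := by omega
    rw [this] at hNT; simp at hNT; linarith
  by_contra hcon
  push Not at hcon
  set S : ℕ → Set V := fun i => NN μ r (HH ω (a + (2*i+1)*r)) ∩ D with hS
  have hi : ∀ i ∈ Finset.range N, a ≤ a + (2*(i:ℝ)+1)*r ∧ a + (2*(i:ℝ)+1)*r + r ≤ a + T1 + 2 := by
    intro i hi
    have : (i:ℝ) + 1 ≤ N := by exact_mod_cast (Finset.mem_range.1 hi)
    constructor
    · have : 0 ≤ (2*(i:ℝ)+1)*r := by positivity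
      linarith
    · nlinarith
  have hmS : ∀ i, MeasurableSet (S i) := fun i => (meas_NN μ r _).inter hD
  have hsum : ∑ i ∈ Finset.range N, μ.real (S i) ≤ μ.real (W ∩ D) := by
    rw [← measureReal_biUnion_finset (h := fun i _ => fin_inter fD) _ (fun i _ => hmS i)]
    · apply mr_le _ (fin_inter fD)
      simp only [iUnion_subset_iff]
      intro i hii x hx
      have h1 := NN_HH hω hx.1
      have h2 := hi i hii
      rw [mem_setOf_eq] at h1
      refine ⟨hW ⟨?_, ?_⟩, hx.2⟩
      · have : 0 ≤ 2*(i:ℝ)*r := by positivity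
        nlinarith
      · linarith
    · intro i _ j _ hij
      rw [Function.onFun, Set.disjoint_left]
      intro x hx hx'
      have h1 := NN_HH hω hx.1
      have h2 := NN_HH hω hx'.1
      rw [mem_setOf_eq] at h1 h2
      rcases lt_or_gt_of_ne hij with h | h
      · have : (i:ℝ) + 1 ≤ j := by exact_mod_cast h
        nlinarith
      · have : (j:ℝ) + 1 ≤ i := by exact_mod_cast h
        nlinarith
  have hlow : ∀ i ∈ Finset.range N, μ.real (W ∩ D) / T1 * (2*r) < μ.real (S i) := by
    intro i hii
    have := hcon (a + (2*i+1)*r) (hi i hii).1 (by linarith [(hi i hii).2])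
    rwa [lt_div_iff₀ (by positivity)] at this
  have := Finset.sum_lt_sum_of_nonempty (Finset.nonempty_range_iff.2 hNp.ne') hlow
  rw [Finset.sum_const, Finset.card_range, nsmul_eq_mul] at this
  have h5 : μ.real (W ∩ D) ≤ N * (μ.real (W ∩ D) / T1 * (2*r)) := by
    have : N * (μ.real (W ∩ D) / T1 * (2*r)) = (N * (2*r)) * μ.real (W ∩ D) / T1 := by ring
    rw [this, le_div_iff₀ hT1]
    nlinarith [measureReal_nonneg (μ := μ) (s := W ∩ D)]
  linarith

theorem not_AL_HH {ω : V} (hω : ‖ω‖ = 1) {α β : ℝ} (h : α < β) (hle : AL μ (HH ω β) (HH ω α)) : False := by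
  obtain ⟨R1, h1⟩ := SL_pos (μ := μ) hω (show (α+β)/2 < β by linarith)
  have : μ (SL ω ((α+β)/2) β ∩ ball (0:V) R1) = 0 := by
    rw [measure_eq_zero_iff_ae_notMem]
    filter_upwards [hle] with x hx hxx
    have := hx hxx.1.2
    rw [mem_HH] at this
    have := hxx.1.1
    linarith
  rw [measureReal_def, this] at h1
  simp at h1

theorem AL.trans {A B C : Set V} (h1 : AL μ A B) (h2 : AL μ B C) : AL μ A C := by
  filter_upwards [h1, h2] with x a b c; exact b (a c)

theorem AL.of_sub {A B : Set V} (h : A ⊆ B) : AL μ A B := Eventually.of_forall fun _ hx => h hx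

theorem layer_ab {ω : V} (hω : ‖ω‖ = 1) {E : Set V} {t t' : ℝ} (h1 : AL μ (HH ω t) E) (h2 : AL μ E (HH ω t')) :
    ∃ a b, t ≤ a ∧ b ≤ t' ∧ AL μ (HH ω a) E ∧ ¬ AL μ (HH ω (a+1)) E ∧ AL μ E (HH ω b) ∧ ¬ AL μ E (HH ω (b-1)) := by
  classical
  have e1 : ∃ i : ℕ, ¬ AL μ (HH ω (t + i)) E := by
    obtain ⟨i, hi⟩ := exists_nat_gt (t' - t)
    exact ⟨i, fun h => not_AL_HH (μ := μ) hω (show t' < t + i by linarith) (h.trans h2)⟩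
  have e2 : ∃ i : ℕ, ¬ AL μ E (HH ω (t' - i)) := by
    obtain ⟨i, hi⟩ := exists_nat_gt (t' - t)
    exact ⟨i, fun h => not_AL_HH (μ := μ) hω (show t' - i < t by linarith) (h1.trans h)⟩
  have p1 := Nat.find_spec e1
  have p2 := Nat.find_spec e2
  obtain ⟨i, hi⟩ : ∃ i, Nat.find e1 = i + 1 := Nat.exists_eq_succ_of_ne_zero (fun h0 => by
    rw [h0] at p1; simp only [Nat.cast_zero, add_zero] at p1; exact p1 h1)
  obtain ⟨j, hj⟩ : ∃ i, Nat.find e2 = i + 1 := Nat.exists_eq_succ_of_ne_zero (fun h0 => by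
    rw [h0] at p2; simp only [Nat.cast_zero, sub_zero] at p2; exact p2 h2)
  have q1 := Nat.find_min e1 (show i < Nat.find e1 by omega)
  have q2 := Nat.find_min e2 (show j < Nat.find e2 by omega)
  rw [not_not] at q1 q2
  rw [hi] at p1; rw [hj] at p2
  refine ⟨t + i, t' - j, by linarith [(Nat.cast_nonneg i : (0:ℝ) ≤ i)], by linarith [(Nat.cast_nonneg j : (0:ℝ) ≤ j)], q1, ?_, q2, ?_⟩
  · convert p1 using 3; push_cast; ring
  · convert p2 using 3; push_cast; ring

theorem PP_slab {ω : V} (hω : ‖ω‖ = 1) {r α β : ℝ} (hr1 : r < 1) : PP μ r (SL ω α β) ⊆ SL ω (α-1) (β+1) := by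
  intro y hy
  by_contra hn
  refine notPP.2 (Eventually.of_forall fun z hz hzz => ?_) hy
  apply hn
  rw [mem_ball] at hz
  have := in_le hω z y
  rw [abs_le] at this
  rw [mem_SL] at *
  constructor <;> linarith

theorem layer [Nontrivial V] (μ : Measure V) [μ.IsAddHaarMeasure] {ρ0 : ℝ} (hρ0 : 0 < ρ0) :
    ∃ η T : ℝ, 0 < η ∧ η < 1/2 ∧ 0 < T ∧ ∀ (r : ℝ) (g : V → ℝ) (ω : V) (t t' : ℝ) (E : Set V), 0 < r → r < 1 → ‖ω‖ = 1 →
      GB μ g (2*η) → MeasurableSet E → AL μ (HH ω t) E → AL μ E (HH ω t') →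
      OMin μ r g (HH ω t) (HH ω t') E →
      (∀ c : V, AL μ (ball c ρ0) E → AL μ (HH ω (⟪ω, c⟫ - ρ0)) E) →
      (∀ c : V, AL μ E (ball c ρ0)ᶜ → AL μ E (HH ω (⟪ω, c⟫ + ρ0))) →
      ∃ a, t ≤ a ∧ AL μ (HH ω a) E ∧ AL μ E (HH ω (a + T)) := by
  obtain ⟨c2, hc2, hmix⟩ := mixed μ hρ0
  set K := μ.real (ball (0:V) (ρ0+5)) with hK
  have hKp : 0 < K := ENNReal.toReal_pos (measure_ball_pos _ _ (by linarith)).ne' measure_ball_lt_top.ne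
  set c := c2 / (2*K) with hc
  have hcp : 0 < c := by positivity
  set T1 := 12 / c with hT1
  have hT1p : 0 < T1 := by positivity
  set η := min (1/4) (c/48) with hη
  have hηp : 0 < η := by positivity
  set C2 := ρ0 + 6 with hC2
  set C' := C2 + 1 with hC'
  refine ⟨η, T1 + 2 + 2 * C2 + C', hηp, lt_of_le_of_lt (min_le_left _ _) (by norm_num), by positivity, ?_⟩
  intro r g ω t t' E hr hr1 hω hg hE hLE hEU hmin hfull hempty
  have hg1 : GB μ g 1 := ⟨hg.1, hg.2.mono fun x hx => hx.trans (by linarith [min_le_left (1/4) (c/48)])⟩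
  obtain ⟨a, b, hta, hbt, ha, ha1, hb, hb1⟩ := layer_ab (μ := μ) hω hLE hEU
  refine ⟨a, hta, ha, ?_⟩
  by_cases hab : b ≤ a + (T1 + 2 + 2 * C2 + C')
  · exact hb.trans (AL.of_sub (HH_mono ω hab))
  exfalso
  push Not at hab
  set W0 := SL ω (a + C2) (b - C2) with hW0
  set Wp := SL ω (a - 1) (b + 1) with hWp
  have hW0m : MeasurableSet W0 := meas_SL _ _ _
  -- mixed balls
  have hpt : ∀ p ∈ W0, c2 * r ≤ μ.real (NN μ r E ∩ ball p (ρ0 + 5)) := by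
    intro p hp
    rw [hW0, mem_SL] at hp
    refine hmix r hr hr1 E p hE ?_ ?_ ?_ ?_
    · rw [pos_iff_ne_zero]
      intro h0
      rw [measure_eq_zero_iff_ae_notMem] at h0
      have := hempty p (by filter_upwards [h0] with x hx hxE hxb; exact hx ⟨hxE, hxb⟩)
      exact hb1 (this.trans (AL.of_sub (HH_mono ω (by linarith))))
    · rw [pos_iff_ne_zero]
      intro h0
      rw [measure_eq_zero_iff_ae_notMem] at h0
      have := hfull p (by filter_upwards [h0] with x hx hxb; by_contra hxE; exact hx ⟨hxE, hxb⟩)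
      exact ha1 ((AL.of_sub (HH_mono ω (by linarith))).trans this)
    · intro x hx s hs
      refine DH_in hr hr1 hg1 hmin hE hLE hEU (fun z hz hzx => ?_) s hs
      rw [mem_ball] at hx hzx
      have i1 := in_le hω z x; have i2 := in_le hω x p
      rw [abs_le] at i1 i2
      rw [mem_HH] at hz
      linarith
    · intro x hx s hs
      refine DH_out hr hr1 hg1 hmin hE hLE hEU (fun z hzx => ?_) s hs
      rw [mem_ball] at hx hzx
      have i1 := in_le hω z x; have i2 := in_le hω x p
      rw [abs_le] at i1 i2
      rw [mem_HH]
      linarith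
  have hcov : ∀ x, a - 1 ≤ x → x ≤ b + 1 → ∃ τ ∈ ({0, C', -C'} : Finset ℝ), a + C2 ≤ x - τ ∧ x - τ ≤ b - C2 := by
    intro x h1 h2
    by_cases hx1 : x < a + C2
    · exact ⟨-C', by simp, by linarith, by linarith⟩
    by_cases hx2 : b - C2 < x
    · exact ⟨C', by simp, by linarith, by linarith⟩
    · push Not at hx1 hx2
      exact ⟨0, by simp, by linarith, by linarith⟩
  have hC'p : 0 < C' := by positivity
  have hCT : ∀ τ ∈ ({0, C', -C'} : Finset ℝ), |τ| ≤ C' := by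
    intro τ hτ
    simp only [Finset.mem_insert, Finset.mem_singleton] at hτ
    rcases hτ with rfl | rfl | rfl
    · simpa using hC'p.le
    · rw [abs_of_pos hC'p]
    · rw [abs_neg, abs_of_pos hC'p]
  have hcard : ((({0, C', -C'} : Finset ℝ).card : ℕ) : ℝ) ≤ 3 := by
    exact_mod_cast Finset.card_le_three
  refine growth_slab (μ := μ) (R0 := 0) hω (show a + C2 < b - C2 by linarith) (c := (c/2)/(c/2+3)) (C := C' + 3) (by positivity) (by linarith) (fun R hR => ?_)
  rw [← hW0]
  obtain ⟨s', hs1, hs2, hs3⟩ := good_plane (μ := μ) (W := Wp) (D := ball (0:V) (R+3)) hω hr hr1 a T1 hT1p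
    (SL_mono ω (by linarith) (by linarith)) measurableSet_ball measure_ball_lt_top.ne
  have hWW : ∀ᵐ x ∂μ, x ∉ SL ω a b → (x ∈ HH ω s' ↔ x ∈ E) := by
    filter_upwards [ha, hb] with x h1 h2 h3
    rw [mem_SL, not_and_or] at h3
    push Not at h3
    rcases h3 with h3 | h3
    · exact ⟨fun _ => h1 h3.le, fun _ => (show ⟪ω, x⟫ ≤ s' by linarith)⟩
    · refine ⟨fun h => ?_, fun h => ?_⟩
      · rw [mem_HH] at h; exfalso; linarith
      · have := h2 h; rw [mem_HH] at this; exfalso; linarith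
  obtain ⟨s, hRs, hsR, hst⟩ := star (A := HH ω s') (W := SL ω a b) hr hr1 hg hmin hE (meas_HH ω s') hLE hEU
    (AL.of_sub (HH_mono ω (by linarith))) (AL.of_sub (HH_mono ω (by linarith))) hWW (PP_slab hω hr1) R
  rw [← hWp] at hst
  have hint := int_off hg (D := ball (0:V) s) (meas_SL ω a b) hWW measure_ball_lt_top.ne (by linarith)
  have hfub := fubini_low (μ := μ) (S := NN μ r E ∩ ball 0 s) (X := W0 ∩ ball 0 (s - (ρ0+5))) (ρ := ρ0+5) (q := c2 * r)
    ((meas_NN μ r E).inter measurableSet_ball) (hW0m.inter measurableSet_ball) (fin_inter measure_ball_lt_top.ne)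
    (fin_inter measure_ball_lt_top.ne) (by positivity) (by
      rintro p ⟨hp, hp2⟩
      refine (hpt p hp).trans (mr_le ?_ (fin_inter measure_ball_lt_top.ne))
      rintro z ⟨hz, hz2⟩
      refine ⟨⟨hz, ?_⟩, hz2⟩
      rw [mem_ball] at *
      linarith [dist_triangle z p 0])
  rw [← hK] at hfub
  have hfub' : c * μ.real (W0 ∩ ball (0:V) (s - (ρ0+5))) ≤ μ.real (NN μ r E ∩ ball 0 s) / (2*r) := by
    rw [le_div_iff₀ (by positivity), hc]
    have : c2/(2*K) * μ.real (W0 ∩ ball (0:V) (s - (ρ0+5))) * (2*r) = (c2 * r * μ.real (W0 ∩ ball (0:V) (s - (ρ0+5))))/K := by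
      field_simp
    rw [this, div_le_iff₀ hKp]; exact hfub
  unfold JJ at hst
  have hNs : μ.real (NN μ r (HH ω s') ∩ ball (0:V) s) / (2*r) ≤ μ.real (Wp ∩ ball (0:V) (R+3)) / T1 := by
    refine le_trans ?_ hs3
    exact div_le_div_of_nonneg_right (ballW_mono subset_rfl hsR) (by positivity)
  have hWs : μ.real (SL ω a b ∩ ball (0:V) s) ≤ μ.real (Wp ∩ ball (0:V) (R+3)) :=
    ballW_mono (SL_mono ω (by linarith) (by linarith)) hsR
  set φ := fun ρ => μ.real (W0 ∩ ball (0:V) ρ) with hφ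
  set X := μ.real (W0 ∩ ball (0:V) (R - (C'+3))) with hX
  set Y := μ.real (W0 ∩ (ball 0 (R + (C'+3)) \ ball (0:V) (R - (C'+3)))) with hY
  have hX0 : 0 ≤ X := measureReal_nonneg
  have hY0 : 0 ≤ Y := measureReal_nonneg
  have b1 : X ≤ μ.real (W0 ∩ ball (0:V) (s - (ρ0+5))) := ballW_mono subset_rfl (by linarith)
  have b2 : μ.real (Wp ∩ ball (0:V) (R+3)) ≤ 3 * (X + Y) := by
    rw [hX, hY, ← shell_split (μ := μ) W0 _ _ (by linarith)]
    refine (slab_cover_ball hω _ hC'p.le hCT hcov (R+3)).trans ?_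
    refine mul_le_mul hcard (ballW_mono subset_rfl (by linarith)) measureReal_nonneg (by norm_num)
  have b3 : μ.real (Wp ∩ (ball 0 (R+3) \ ball (0:V) R)) ≤ 3 * Y := by
    refine (slab_cover hω _ hCT hcov R (R+3)).trans ?_
    refine mul_le_mul hcard (shell_mono subset_rfl (by linarith) (by linarith)) measureReal_nonneg (by norm_num)
  have b4 : c * X ≤ μ.real (Wp ∩ ball (0:V) (R+3)) / T1 + 2 * (2*η) * μ.real (Wp ∩ ball (0:V) (R+3)) + 3 * Y := by
    have e1 : c * X ≤ c * μ.real (W0 ∩ ball (0:V) (s - (ρ0+5))) := by gcongr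
    have e2 := le_of_abs_le hint
    have e3 : 2 * (2 * η) * μ.real (SL ω a b ∩ ball (0:V) s) ≤ 2 * (2*η) * μ.real (Wp ∩ ball (0:V) (R+3)) := by gcongr
    linarith
  have b5 : μ.real (Wp ∩ ball (0:V) (R+3)) / T1 ≤ c/12 * (3 * (X+Y)) := by
    rw [hT1, div_div_eq_mul_div]
    nlinarith
  have b6 : 2 * (2*η) * μ.real (Wp ∩ ball (0:V) (R+3)) ≤ c/12 * (3 * (X+Y)) := by
    have : 2 * (2*η) ≤ c/12 := by linarith [min_le_right (1/4) (c/48)]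
    exact mul_le_mul this b2 measureReal_nonneg (by positivity)
  rw [div_mul_eq_mul_div, div_le_iff₀ (by positivity)]
  nlinarith

structure LatP (μ : Measure V) (Z : AddSubgroup V) (fl : V → V) (ρ0 : ℝ) (g : V → ℝ) : Prop where
  cnt : (Z : Set V).Countable
  flm : Measurable fl
  flZ : ∀ x, fl x ∈ Z
  fld : ∀ x, dist x (fl x) < ρ0
  fla : ∀ x, ∀ k ∈ Z, fl (x + k) = fl x + k
  per : ∀ x, ∀ k ∈ Z, g (x + k) = g x
  zero : ∀ k ∈ Z, ∫ x in fl ⁻¹' {k}, g x ∂μ = 0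

theorem LatP.zero' {Z : AddSubgroup V} {fl : V → V} {ρ0 : ℝ} {g : V → ℝ} (h : LatP μ Z fl ρ0 g) {b : ℝ} (hg : GB μ g b)
    {T : Set V} (hT : μ (fl ⁻¹' T) ≠ ∞) : ∫ x in fl ⁻¹' T, g x ∂μ = 0 := by
  have e : fl ⁻¹' T = ⋃ k : (T ∩ (Z : Set V) : Set V), fl ⁻¹' {(k:V)} := by
    ext x
    simp only [mem_preimage, mem_iUnion, mem_singleton_iff]
    constructor
    · intro hx; exact ⟨⟨fl x, hx, h.flZ x⟩, rfl⟩
    · rintro ⟨k, hk⟩; rw [hk]; exact k.2.1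
  have : Countable (T ∩ (Z : Set V) : Set V) := (h.cnt.mono inter_subset_right).to_subtype
  have hint := hg.intOn hT
  rw [e] at hint ⊢
  rw [integral_iUnion (fun k => h.flm (measurableSet_singleton _)) _ hint]
  · have : ∀ k : (T ∩ (Z : Set V) : Set V), ∫ x in fl ⁻¹' {(k:V)}, g x ∂μ = 0 := fun k => h.zero k k.2.2
    simp [this]
  · intro i j hij
    rw [Function.onFun, Set.disjoint_left]
    intro x hx hx'
    exact hij (Subtype.ext (hx.symm.trans hx'))

theorem int_off2 {g : V → ℝ} {b : ℝ} (hg : GB μ g b) {A E W D1 D2 : Set V} (hb : 0 ≤ b)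
    (hWm : MeasurableSet W) (hW : ∀ᵐ x ∂μ, x ∉ W → (x ∈ A ↔ x ∈ E)) (h1 : MeasurableSet D1) (h2 : MeasurableSet D2)
    (f1 : μ D1 ≠ ∞) (f2 : μ D2 ≠ ∞) :
    |((∫ x in A ∩ D1, g x ∂μ) - ∫ x in E ∩ D1, g x ∂μ) - ((∫ x in A ∩ D2, g x ∂μ) - ∫ x in E ∩ D2, g x ∂μ)| ≤
      2 * b * (μ.real (W ∩ (D1 \ D2)) + μ.real (W ∩ (D2 \ D1))) := by
  have key : ∀ (S D D' : Set V), MeasurableSet D' → μ D ≠ ∞ →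
      (∫ x in S ∩ D, g x ∂μ) = (∫ x in S ∩ (D ∩ D'), g x ∂μ) + ∫ x in S ∩ (D \ D'), g x ∂μ := by
    intro S D D' hD' fD
    rw [← integral_inter_add_diff hD' (hg.intOn (fin_inter fD)), inter_assoc, inter_diff_assoc]
  have a := int_off hg (D := D1 \ D2) hWm hW (ne_top_of_le_ne_top f1 (measure_mono diff_subset)) hb
  have c := int_off hg (D := D2 \ D1) hWm hW (ne_top_of_le_ne_top f2 (measure_mono diff_subset)) hb
  rw [key A D1 D2 h2 f1, key E D1 D2 h2 f1, key A D2 D1 h1 f2, key E D2 D1 h1 f2, inter_comm D2 D1]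
  rw [abs_le] at *
  constructor <;> linarith

theorem NN_slab {ω : V} (hω : ‖ω‖ = 1) {r α β : ℝ} (hr1 : r < 1) {A : Set V} (h1 : AL μ (HH ω α) A) (h2 : AL μ A (HH ω β)) :
    NN μ r A ⊆ SL ω (α-1) (β+1) := by
  rintro y ⟨ha, hb⟩
  constructor
  · by_contra hn
    push Not at hn
    refine notPP.2 ?_ hb
    filter_upwards [h1] with z hz hzy hzz
    refine hzz (hz ?_)
    rw [mem_ball] at hzy
    have := in_le hω z y
    rw [abs_le] at this
    rw [mem_HH]; linarith
  · by_contra hn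
    push Not at hn
    refine notPP.2 ?_ ha
    filter_upwards [h2] with z hz hzy hzz
    have h3 := hz hzz
    rw [mem_ball] at hzy
    have := in_le hω z y
    rw [abs_le] at this
    rw [mem_HH] at h3; linarith

theorem shiftJ {Z : AddSubgroup V} {fl : V → V} {ρ0 : ℝ} {g : V → ℝ} (hl : LatP μ Z fl ρ0 g) {b : ℝ} (hb : 0 ≤ b) (hg : GB μ g b)
    {r : ℝ} (hr : 0 < r) (hr1 : r < 1) {ω : V} (hω : ‖ω‖ = 1) {k : V} (hk : k ∈ Z) :
    ∃ N C : ℝ, 0 < N ∧ 0 < C ∧ ∀ (A : Set V) (α β : ℝ), MeasurableSet A → α ≤ β → AL μ (HH ω α) A → AL μ A (HH ω β) →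
      ∀ s, JJ μ r g (ball 0 s) (tr k A) ≤ JJ μ r g (ball 0 s) A +
      N * μ.real (SL ω (α - C) (β + C) ∩ (ball 0 (s + C) \ ball (0:V) (s - C))) := by
  have hρ0 : 0 < ρ0 := lt_of_le_of_lt dist_nonneg (hl.fld 0)
  set C := ρ0 + ‖k‖ + 1 with hC
  have hkn : 0 ≤ ‖k‖ := norm_nonneg k
  refine ⟨1/(2*r) + 8 * b, C, by positivity, by positivity, fun A α β hA hαβ h1 h2 s => ?_⟩
  set W := SL ω (α - C) (β + C) with hW
  have hWm : MeasurableSet W := meas_SL _ _ _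
  set Sh := ball 0 (s + C) \ ball (0:V) (s - C) with hSh
  have fS : μ (W ∩ Sh) ≠ ∞ := fin_shell _ _ _
  have hωk : |⟪ω, k⟫| ≤ ‖k‖ := by have := abs_real_inner_le_norm ω k; rwa [hω, one_mul] at this
  rw [abs_le] at hωk
  -- perimeter part
  have per : μ.real (NN μ r (tr k A) ∩ ball 0 s) ≤ μ.real (NN μ r A ∩ ball 0 s) + μ.real (W ∩ Sh) := by
    have e : NN μ r (tr k A) ∩ ball 0 s = tr k (NN μ r A ∩ ball k s) := by
      rw [NN_tr]
      have : ball (0:V) s = tr k (ball k s) := by rw [tr_ball, sub_self]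
      rw [this]; rfl
    rw [e, real_tr]
    refine le_trans (mr_le (B := (NN μ r A ∩ ball 0 s) ∪ (W ∩ Sh)) ?_ ?_) (measureReal_union_le _ _)
    · rintro x ⟨hx, hxk⟩
      by_cases hs : x ∈ ball (0:V) s
      · exact Or.inl ⟨hx, hs⟩
      · refine Or.inr ⟨SL_mono ω (by linarith) (by linarith) (NN_slab hω hr1 h1 h2 hx), ?_, fun h => hs (ball_subset_ball (by linarith) h)⟩
        rw [mem_ball] at *
        have := dist_triangle x k 0
        rw [dist_zero_right k] at this
        linarith
    · exact (measure_union_lt_top (fin_inter measure_ball_lt_top.ne).lt_top fS.lt_top).ne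
  -- cells
  set D0 := fl ⁻¹' (ball 0 s) with hD0
  set Dk := fl ⁻¹' (ball k s) with hDk
  set P := fl ⁻¹' (HH ω α) with hP
  have mD0 : MeasurableSet D0 := hl.flm measurableSet_ball
  have mDk : MeasurableSet Dk := hl.flm measurableSet_ball
  have hfl : ∀ x, ‖x‖ - ρ0 < ‖fl x‖ ∧ ‖fl x‖ < ‖x‖ + ρ0 := by
    intro x
    have := hl.fld x
    rw [dist_eq_norm] at this
    have a := norm_le_norm_add_norm_sub (fl x) x
    have a2 := norm_le_norm_add_norm_sub x (fl x)
    rw [norm_sub_rev] at a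
    constructor <;> first | linarith | (rw [norm_sub_rev] at a2; linarith)
  have big : ∀ x, x ∈ D0 ∨ x ∈ Dk ∨ x ∈ ball (0:V) s → x ∈ ball (0:V) (s + C) := by
    intro x hx
    rw [mem_ball_zero_iff]
    have := hfl x
    rcases hx with hx | hx | hx
    · rw [hD0, mem_preimage, mem_ball_zero_iff] at hx; linarith
    · rw [hDk, mem_preimage, mem_ball, dist_eq_norm] at hx
      have a2 := norm_sub_norm_le (fl x) k
      linarith
    · rw [mem_ball_zero_iff] at hx; linarith
  have small : ∀ x ∈ ball (0:V) (s - C), x ∈ D0 ∧ x ∈ Dk ∧ x ∈ ball (0:V) s := by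
    intro x hx
    rw [mem_ball_zero_iff] at hx
    have := hfl x
    refine ⟨?_, ?_, ?_⟩
    · rw [hD0, mem_preimage, mem_ball_zero_iff]; linarith
    · rw [hDk, mem_preimage, mem_ball, dist_eq_norm]
      have a2 := norm_sub_le (fl x) k
      linarith
    · rw [mem_ball_zero_iff]; linarith
  have f0 : μ D0 ≠ ∞ := ne_top_of_le_ne_top (measure_ball_lt_top (x := (0:V)) (r := s + C)).ne (measure_mono fun x hx => big x (Or.inl hx))
  have fk : μ Dk ≠ ∞ := ne_top_of_le_ne_top (measure_ball_lt_top (x := (0:V)) (r := s + C)).ne (measure_mono fun x hx => big x (Or.inr (Or.inl hx)))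
  have hWk : ∀ᵐ x ∂μ, x ∉ W → (x ∈ tr k A ↔ x ∈ A) := by
    filter_upwards [h1, h2, ae_tr k h1, ae_tr k h2] with x a1 a2 a3 a4 hx
    rw [mem_tr]
    rw [hW, mem_SL, not_and_or] at hx
    push Not at hx
    simp only [mem_HH, inner_add_right] at a1 a2 a3 a4
    rcases hx with hx | hx
    · exact ⟨fun _ => a1 (by linarith), fun _ => a3 (by linarith)⟩
    · exact ⟨fun h => by exfalso; have := a4 h; linarith, fun h => by exfalso; have := a2 h; linarith⟩
  have hWP : ∀ᵐ x ∂μ, x ∉ W → (x ∈ A ↔ x ∈ P) := by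
    filter_upwards [h1, h2] with x a1 a2 hx
    rw [hW, mem_SL, not_and_or] at hx
    push Not at hx
    rw [hP, mem_preimage]
    simp only [mem_HH] at a1 a2 ⊢
    have i := in_le hω x (fl x)
    have := hl.fld x
    rw [abs_le] at i
    rcases hx with hx | hx
    · exact ⟨fun _ => by linarith, fun _ => a1 (by linarith)⟩
    · exact ⟨fun h => by exfalso; have := a2 h; linarith, fun h => by exfalso; linarith⟩
  have q1 := int_off2 hg hb hWm hWk (measurableSet_ball (x := (0:V)) (ε := s)) mD0 measure_ball_lt_top.ne f0
  have q2 := int_off2 hg hb hWm hWP mDk mD0 fk f0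
  have z1 : (∫ x in P ∩ Dk, g x ∂μ) = 0 := hl.zero' hg (T := HH ω α ∩ ball k s) (fin_inter fk)
  have z2 : (∫ x in P ∩ D0, g x ∂μ) = 0 := hl.zero' hg (T := HH ω α ∩ ball 0 s) (fin_inter f0)
  have z3 : (∫ x in tr k A ∩ D0, g x ∂μ) = ∫ x in A ∩ Dk, g x ∂μ := by
    rw [← int_tr (A := A ∩ Dk) k (fun x => hl.per x k hk)]
    congr 2
    ext x
    simp only [mem_inter_iff, mem_tr, hD0, hDk, mem_preimage, hl.fla x k hk, mem_ball, dist_eq_norm]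
    simp
  have sh : ∀ D D' : Set V, (∀ x ∈ D, x ∈ ball (0:V) (s+C)) → (∀ x ∈ ball (0:V) (s-C), x ∈ D') →
      μ.real (W ∩ (D \ D')) ≤ μ.real (W ∩ Sh) := fun D D' hD hD' =>
    mr_le (fun x hx => ⟨hx.1, hD x hx.2.1, fun h => hx.2.2 (hD' x h)⟩) fS
  have s1 := sh (ball 0 s) D0 (fun x hx => big x (by tauto)) (fun x hx => (small x hx).1)
  have s2 := sh D0 (ball 0 s) (fun x hx => big x (by tauto)) (fun x hx => (small x hx).2.2)
  have s3 := sh Dk D0 (fun x hx => big x (by tauto)) (fun x hx => (small x hx).1)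
  have s4 := sh D0 Dk (fun x hx => big x (by tauto)) (fun x hx => (small x hx).2.1)
  rw [z3] at q1
  rw [z1, z2] at q2
  have q1' := le_of_abs_le q1
  have q2' := le_of_abs_le q2
  have m1 : 2 * b * (μ.real (W ∩ (ball 0 s \ D0)) + μ.real (W ∩ (D0 \ ball 0 s))) ≤ 2 * b * (μ.real (W ∩ Sh) + μ.real (W ∩ Sh)) := by gcongr
  have m2 : 2 * b * (μ.real (W ∩ (Dk \ D0)) + μ.real (W ∩ (D0 \ Dk))) ≤ 2 * b * (μ.real (W ∩ Sh) + μ.real (W ∩ Sh)) := by gcongr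
  have m3 : μ.real (NN μ r (tr k A) ∩ ball 0 s) / (2*r) ≤ μ.real (NN μ r A ∩ ball 0 s) / (2*r) + μ.real (W ∩ Sh) / (2*r) := by
    rw [← add_div]; gcongr
  unfold JJ
  have m4 : (1/(2*r) + 8*b) * μ.real (W ∩ Sh) = μ.real (W ∩ Sh) / (2*r) + 8 * b * μ.real (W ∩ Sh) := by ring
  rw [m4]
  linarith

theorem EE_low {r : ℝ} (hr : 0 < r) {g : V → ℝ} {b : ℝ} (hb : 0 ≤ b) (hg : GB μ g b) (ω : V) (τ ε A : ℕ → ℝ) (j : ℕ) :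
    AL μ (HH ω (τ j)) (EE μ r g ω τ ε A) :=
  (Em_spec hr hb hg ω τ ε A j).low.trans (AL.of_sub (subset_iUnion _ j))

theorem EE_up {r : ℝ} (hr : 0 < r) {g : V → ℝ} {b : ℝ} (hb : 0 ≤ b) (hg : GB μ g b) (ω : V) {τ ε A : ℕ → ℝ} {t : ℝ}
    (h1 : ∀ j, τ j ≤ t) (h2 : ∀ j, A j ≤ t) : AL μ (EE μ r g ω τ ε A) (HH ω t) := by
  have : ∀ᵐ x ∂μ, ∀ j, x ∈ Em μ r g ω τ ε A j → x ∈ HH ω t := by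
    rw [ae_all_iff]
    intro j
    filter_upwards [(Em_spec hr hb hg ω τ ε A j).up] with x hx hx2
    rcases hx hx2 with h | h
    · exact HH_mono ω (h1 j) h
    · exact HH_mono ω (h2 j) h.2
  filter_upwards [this] with x hx hx2
  obtain ⟨j, hj⟩ := mem_iUnion.1 hx2
  exact hx j hj

theorem birk {Z : AddSubgroup V} {fl : V → V} {ρ0 : ℝ} {g : V → ℝ} (hl : LatP μ Z fl ρ0 g) {ω : V} (hω : ‖ω‖ = 1) {E : Set V}
    (hB : ∀ k ∈ Z, ⟪ω, k⟫ ≤ 0 → AL μ (tr (-k) E) E) :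
    (∀ c : V, AL μ (ball c ρ0) E → AL μ (HH ω (⟪ω, c⟫ - ρ0)) E) ∧
    (∀ c : V, AL μ E (ball c ρ0)ᶜ → AL μ E (HH ω (⟪ω, c⟫ + ρ0))) := by
  have hB' : ∀ᵐ x ∂μ, ∀ k ∈ (Z : Set V), ⟪ω, k⟫ ≤ 0 → x + -k ∈ E → x ∈ E := by
    rw [ae_ball_iff hl.cnt]
    intro k hk
    by_cases h : ⟪ω, k⟫ ≤ 0
    · filter_upwards [hB k hk h] with x hx _; exact hx
    · exact Eventually.of_forall fun x h' => absurd h' h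
  constructor
  · intro c hc
    have hc' : ∀ᵐ x ∂μ, ∀ k ∈ (Z : Set V), x + -k ∈ ball c ρ0 → x + -k ∈ E := by
      rw [ae_ball_iff hl.cnt]
      intro k hk
      exact ae_tr (-k) hc
    filter_upwards [hB', hc'] with x h1 h2 hx
    have hd := hl.fld (x - c)
    have hi := in_le hω (x - c) (fl (x - c))
    rw [abs_le, inner_sub_right] at hi
    rw [mem_HH] at hx
    refine h1 _ (hl.flZ (x - c)) (by linarith) (h2 _ (hl.flZ (x - c)) ?_)
    rw [mem_ball, dist_eq_norm]
    rw [dist_eq_norm] at hd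
    convert hd using 2; abel
  · intro c hc
    have hc' : ∀ᵐ x ∂μ, ∀ k ∈ (Z : Set V), x + k ∈ E → x + k ∉ ball c ρ0 := by
      rw [ae_ball_iff hl.cnt]
      intro k hk
      exact ae_tr k hc
    have hB2 : ∀ᵐ x ∂μ, ∀ k ∈ (Z : Set V), ⟪ω, k⟫ ≤ 0 → x ∈ E → x + k ∈ E := by
      rw [ae_ball_iff hl.cnt]
      intro k hk
      filter_upwards [ae_tr k hB'] with x hx h h2
      refine hx k hk h ?_
      rwa [add_neg_cancel_right]
    filter_upwards [hc', hB2] with x h1 h2 hx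
    by_contra hn
    rw [mem_HH, not_le] at hn
    have hd := hl.fld (c - x)
    have hi := in_le hω (c - x) (fl (c - x))
    rw [abs_le, inner_sub_right] at hi
    refine h1 _ (hl.flZ (c - x)) (h2 _ (hl.flZ (c - x)) (by linarith) hx) ?_
    rw [mem_ball, dist_comm, dist_eq_norm]
    rw [dist_eq_norm] at hd
    convert hd using 2; abel

theorem gap_meas {ω : V} {E A : Set V} {a : ℝ} (h1 : AL μ (HH ω a) E) (h2 : AL μ A (HH ω (a - 1))) (h3 : AL μ A E) (s : ℝ) :
    μ.real (A ∩ ball (0:V) s) + μ.real (SL ω (a - 1/2) a ∩ ball (0:V) s) ≤ μ.real (E ∩ ball (0:V) s) := by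
  have hd : AEDisjoint μ (A ∩ ball (0:V) s) (SL ω (a - 1/2) a ∩ ball (0:V) s) := by
    rw [AEDisjoint, measure_eq_zero_iff_ae_notMem]
    filter_upwards [h2] with x hx hxx
    have := hx hxx.1.1
    rw [mem_HH] at this
    have := hxx.2.1.1
    linarith
  rw [← measureReal_union₀ ((meas_SL ω _ _).inter measurableSet_ball).nullMeasurableSet hd (fin_inter measure_ball_lt_top.ne) (fin_inter measure_ball_lt_top.ne)]
  refine ENNReal.toReal_mono (fin_inter measure_ball_lt_top.ne) (measure_mono_ae ?_)
  filter_upwards [h1, h3] with x a1 a3 hx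
  rcases hx with hx | hx
  · exact ⟨a3 hx.1, hx.2⟩
  · exact ⟨a1 hx.1.2, hx.2⟩

theorem position [Nontrivial V] (μ : Measure V) [μ.IsAddHaarMeasure] {ρ0 : ℝ} (hρ0 : 0 < ρ0) :
    ∃ η C1 : ℝ, 0 < η ∧ η < 1/2 ∧ 0 < C1 ∧ ∀ (r : ℝ) (g : V → ℝ) (ω : V) (Z : AddSubgroup V) (fl : V → V),
      0 < r → r < 1 → ‖ω‖ = 1 → LatP μ Z fl ρ0 g → GB μ g η → ∀ ε, 0 < ε → ε ≤ η → ∀ t t', t ≤ t' →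
      AL μ (EE μ r (fun x => g x + ε) ω (fun _ => t) (fun _ => 0) (fun _ => t')) (HH ω (t + C1)) := by
  obtain ⟨η, T, hη, hη2, hT, hlay⟩ := layer μ hρ0
  set C0 := T + 1 + 2 * ρ0 with hC0
  refine ⟨η, C0 + T, hη, hη2, by positivity, ?_⟩
  intro r g ω Z fl hr hr1 hω hl hg ε hε hεη t t' htt
  have hg' : GB μ (fun x => g x + ε) (2*η) := by
    refine ⟨hg.1.add_const ε, ?_⟩
    filter_upwards [hg.2] with x hx
    refine (abs_add_le _ _).trans ?_
    rw [abs_of_pos hε]; linarith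
  have h2η : 0 ≤ 2 * η := by linarith
  set E := EE μ r (fun x => g x + ε) ω (fun _ => t) (fun _ => 0) (fun _ => t') with hE
  have Em : MeasurableSet E := EE_meas hr h2η hg' ω _ _ _
  have hlow : AL μ (HH ω t) E := EE_low hr h2η hg' ω (fun _ => t) (fun _ => 0) (fun _ => t') 0
  have hup : AL μ E (HH ω t') := EE_up hr h2η hg' ω (fun _ => htt) (fun _ => le_rfl)
  have hmin : OMin μ r (fun x => g x + ε) (HH ω t) (HH ω t') E := by
    refine EE_OMin hr hr1 h2η hg' ω ⟨monotone_const, antitone_const, fun _ => le_rfl, fun _ => zero_le_one, monotone_const⟩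
      tendsto_const_nhds (fun _ => subset_rfl) (fun R => Eventually.of_forall fun _ => inter_subset_left)
  have hBk : ∀ k ∈ Z, ⟪ω, k⟫ ≤ 0 → AL μ (tr (-k) E) E := by
    intro k hk hk0
    refine EE_comp hr h2η hg' ω h2η hg' k (fun x => by rw [hl.per x (-k) (neg_mem hk)]) (fun j => ?_)
    obtain ⟨j', hj'⟩ := exists_nat_ge (j + ‖k‖)
    exact ⟨j', by linarith, by linarith, Eventually.of_forall fun x => le_rfl, hj'⟩
  obtain ⟨hf, he⟩ := birk hl hω hBk
  obtain ⟨a, hta, ha, hb⟩ := hlay r _ ω t t' E hr hr1 hω hg' Em hlow hup hmin hf he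
  by_cases hac : a ≤ t + C0
  · exact hb.trans (AL.of_sub (HH_mono ω (by linarith)))
  exfalso
  push Not at hac
  have hat : a ≤ t' := by
    by_contra hn
    push Not at hn
    exact not_AL_HH (μ := μ) hω hn (ha.trans hup)
  have hωω : ⟪ω, ω⟫ = 1 := by rw [real_inner_self_eq_norm_sq, hω]; norm_num
  set k := fl ((T + 1 + ρ0) • ω) with hk
  have hkZ : k ∈ Z := hl.flZ _
  have hki : T + 1 ≤ ⟪ω, k⟫ ∧ ⟪ω, k⟫ ≤ C0 := by
    have h1 := hl.fld ((T + 1 + ρ0) • ω)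
    have h2 := in_le hω ((T + 1 + ρ0) • ω) k
    rw [inner_smul_right, hωω, abs_le] at h2
    constructor <;> linarith
  have trm : ∀ u v : ℝ, AL μ (HH ω u) E → AL μ E (HH ω v) → AL μ (HH ω (u - ⟪ω, k⟫)) (tr k E) ∧ AL μ (tr k E) (HH ω (v - ⟪ω, k⟫)) := by
    intro u v h1 h2
    rw [← tr_HH, ← tr_HH]
    exact ⟨ae_tr k h1, ae_tr k h2⟩
  obtain ⟨t1, t2⟩ := trm _ _ ha hb
  have t2' : AL μ (tr k E) (HH ω (a - 1)) := t2.trans (AL.of_sub (HH_mono ω (by linarith)))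
  have hAE : AL μ (tr k E) E := t2'.trans ((AL.of_sub (HH_mono ω (by linarith))).trans ha)
  obtain ⟨N, C, hN, hC, hsh⟩ := shiftJ hl hη.le hg hr hr1 hω hkZ
  set α := min (a - C0 - 1) (a - C) with hα
  set β := max (a + T + 1) (a + T + C) with hβ
  obtain ⟨N2, C2, hN2, hC2, hany, -⟩ := slab_any (μ := μ) hω α β (show a - 1/2 < a by linarith)
  refine growth_slab (μ := μ) (R0 := 0) hω (show a - 1/2 < a by linarith) (c := ε / ((N+1)*N2)) (C := 3 + C + C2) (by positivity) (by linarith) (fun R hR => ?_)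
  have hW : ∀ᵐ x ∂μ, x ∉ SL ω (a - C0) (a + T) → (x ∈ tr k E ↔ x ∈ E) := by
    filter_upwards [ha, hb, t1, t2] with x a1 a2 a3 a4 hx
    rw [mem_SL, not_and_or] at hx
    push Not at hx
    simp only [mem_HH] at a1 a2 a3 a4
    rcases hx with hx | hx
    · exact ⟨fun _ => a1 (by linarith), fun _ => a3 (by linarith)⟩
    · exact ⟨fun h => by exfalso; have := a4 h; linarith, fun h => by exfalso; have := a2 h; linarith⟩
  obtain ⟨s, hRs, hsR, hst⟩ := star (A := tr k E) hr hr1 hg' hmin Em (meas_tr k Em) hlow hup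
    ((AL.of_sub (HH_mono ω (by linarith))).trans t1) (t2'.trans (AL.of_sub (HH_mono ω (by linarith)))) hW (PP_slab hω hr1) R
  rw [JJ_const hg ε measure_ball_lt_top.ne, JJ_const hg ε measure_ball_lt_top.ne] at hst
  have g1 := hsh E a (a+T) Em (by linarith) ha hb s
  have g2 := gap_meas (μ := μ) ha t2' hAE s
  have g3 : μ.real (SL ω (a - 1/2) a ∩ ball (0:V) (R - (3 + C + C2))) ≤ μ.real (SL ω (a - 1/2) a ∩ ball (0:V) s) :=
    ballW_mono subset_rfl (by linarith)
  set Y := μ.real (SL ω α β ∩ (ball 0 (R + 3 + C) \ ball (0:V) (R - C))) with hY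
  have g4 : μ.real (SL ω (a - C0 - 1) (a + T + 1) ∩ (ball 0 (R + 3) \ ball (0:V) R)) ≤ Y :=
    shell_mono (SL_mono ω (min_le_left _ _) (le_max_left _ _)) (by linarith) (by linarith)
  have g5 : μ.real (SL ω (a - C) (a + T + C) ∩ (ball 0 (s + C) \ ball (0:V) (s - C))) ≤ Y :=
    shell_mono (SL_mono ω (min_le_right _ _) (le_max_right _ _)) (by linarith) (by linarith)
  have g6 : Y ≤ N2 * μ.real (SL ω (a - 1/2) a ∩ (ball 0 (R + (3 + C + C2)) \ ball (0:V) (R - (3 + C + C2)))) := by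
    refine (hany _ _).trans ?_
    gcongr 1
    exact shell_mono subset_rfl (by linarith) (by linarith)
  rw [div_mul_eq_mul_div, div_le_iff₀ (by positivity)]
  have g7 : N * μ.real (SL ω (a - C) (a + T + C) ∩ (ball 0 (s + C) \ ball (0:V) (s - C))) ≤ N * Y := by gcongr
  have g8 := mul_le_mul_of_nonneg_left g6 (show 0 ≤ N + 1 by linarith)
  have g9 := mul_le_mul_of_nonneg_left g3 hε.le
  have g10 := mul_le_mul_of_nonneg_left g2 hε.le
  linarith

theorem plane_null {ω : V} (hω : ‖ω‖ = 1) (t : ℝ) : ∀ᵐ x ∂μ, ⟪ω, x⟫ ≠ t := by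
  have hωω : ⟪ω, ω⟫ = 1 := by rw [real_inner_self_eq_norm_sq, hω]; norm_num
  have h0 : μ (LinearMap.ker (innerₛₗ ℝ ω) : Set V) = 0 := by
    apply Measure.addHaar_submodule
    intro h
    have : ω ∈ LinearMap.ker (innerₛₗ ℝ ω) := by rw [h]; trivial
    rw [LinearMap.mem_ker, innerₛₗ_apply_apply, hωω] at this
    norm_num at this
  have h1 := measure_eq_zero_iff_ae_notMem.1 h0
  filter_upwards [ae_tr (-(t • ω)) h1] with x hx h
  apply hx
  rw [SetLike.mem_coe, LinearMap.mem_ker, innerₛₗ_apply_apply, inner_add_right, inner_neg_right, inner_smul_right, hωω, h]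
  ring

structure Fam (μ : Measure V) (r : ℝ) (g : V → ℝ) (ω : V) (Z : AddSubgroup V) (C1 : ℝ) (X : ℝ → Set V) : Prop where
  meas : ∀ t, MeasurableSet (X t)
  low : ∀ t, AL μ (HH ω t) (X t)
  up : ∀ t, AL μ (X t) (HH ω (t + C1))
  shift : ∀ k ∈ Z, ∀ t t', t + ⟪ω, k⟫ ≤ t' → AL μ (tr (-k) (X t)) (X t')
  lc : AL μ (X 0) (⋃ i : ℕ, X (-(1/((i:ℝ)+1))))
  min : ∀ t, OMin μ r g (HH ω t) univ (X t)

theorem exists_fam [Nontrivial V] (μ : Measure V) [μ.IsAddHaarMeasure] {ρ0 : ℝ} (hρ0 : 0 < ρ0) :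
    ∃ η C1 : ℝ, 0 < η ∧ η < 1/2 ∧ 0 < C1 ∧ ∀ (r : ℝ) (g : V → ℝ) (ω : V) (Z : AddSubgroup V) (fl : V → V),
      0 < r → r < 1 → ‖ω‖ = 1 → LatP μ Z fl ρ0 g → GB μ g η → ∃ X, Fam μ r g ω Z C1 X := by
  obtain ⟨η, C1, hη, hη2, hC1, hpos⟩ := position μ hρ0
  refine ⟨η, C1, hη, hη2, hC1, ?_⟩
  intro r g ω Z fl hr hr1 hω hl hg
  set τ : ℝ → ℕ → ℝ := fun t j => t - 1/((j:ℝ)+1) with hτ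
  set ε : ℕ → ℝ := fun j => η/((j:ℝ)+1) with hε
  set A : ℝ → ℕ → ℝ := fun t j => t + j + 1 with hA
  have hinv : ∀ {i j : ℕ}, i ≤ j → 1/((j:ℝ)+1) ≤ 1/((i:ℝ)+1) := fun h => Nat.one_div_le_one_div h
  have hinv0 : ∀ j : ℕ, 0 < 1/((j:ℝ)+1) := fun j => Nat.one_div_pos_of_nat
  have hεe : ∀ j, ε j = η * (1/((j:ℝ)+1)) := fun j => by rw [hε]; ring
  have hεa : Antitone ε := fun i j h => by rw [hεe, hεe]; exact mul_le_mul_of_nonneg_left (hinv h) hη.le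
  have hεp : ∀ j, 0 < ε j := fun j => by rw [hεe]; exact mul_pos hη (hinv0 j)
  have hεη : ∀ j, ε j ≤ η := fun j => by
    have := hεa (Nat.zero_le j); rw [hεe 0] at this; simpa using this
  have hd : ∀ t, Dat (τ t) ε (A t) := fun t =>
    ⟨fun i j h => by have := hinv h; simp only [hτ]; linarith, hεa, fun j => (hεp j).le, fun j => by linarith [hεη j],
      fun i j h => by have : (i:ℝ) ≤ j := by exact_mod_cast h
                      simp only [hA]; linarith⟩
  have hεt : Tendsto ε atTop (𝓝 0) := by
    have := (tendsto_one_div_add_atTop_nhds_zero_nat (𝕜 := ℝ)).const_mul η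
    rw [mul_zero] at this
    exact this.congr fun j => (hεe j).symm
  refine ⟨fun t => EE μ r g ω (τ t) ε (A t), ?_, ?_, ?_, ?_, ?_, ?_⟩
  · exact fun t => EE_meas hr hη.le hg ω _ _ _
  · intro t
    have : ∀ᵐ x ∂μ, ∀ j, x ∈ HH ω (τ t j) → x ∈ EE μ r g ω (τ t) ε (A t) := by
      rw [ae_all_iff]; exact fun j => EE_low hr hη.le hg ω _ _ _ j
    filter_upwards [this, plane_null hω t] with x hx hne hxt
    rw [mem_HH] at hxt
    have hlt : 0 < t - ⟪ω, x⟫ := by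
      have := lt_of_le_of_ne hxt hne; linarith
    obtain ⟨j, hj⟩ := exists_nat_one_div_lt hlt
    refine hx j ?_
    rw [mem_HH, hτ]; simp only; linarith
  · intro t
    have : ∀ᵐ x ∂μ, ∀ j, x ∈ Em μ r g ω (τ t) ε (A t) j → x ∈ HH ω (t + C1) := by
      rw [ae_all_iff]
      intro j
      have hg' : GB μ (fun x => g x + ε j) (η + |ε j|) := hg.addc (ε j)
      have c1 := Em_comp hr hη.le hg ω (by positivity) hg' 0 (fun x => by simp) (τ := τ t) (ε := ε) (A := A t)
        (τ' := fun _ => t) (ε' := fun _ => 0) (A' := fun _ => A t j) (j := j) (j' := j)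
        (by simp only [hτ, inner_zero_right]; linarith [hinv0 j]) (by simp)
        (Eventually.of_forall fun x => by simp) (by simp)
      rw [show tr (-0:V) (Em μ r g ω (τ t) ε (A t) j) = Em μ r g ω (τ t) ε (A t) j by ext x; simp [mem_tr]] at c1
      refine c1.trans ((AL.of_sub (subset_iUnion _ j)).trans
        (hpos r g ω Z fl hr hr1 hω hl hg (ε j) (hεp j) (hεη j) t (A t j) ?_))
      simp only [hA]; have : (0:ℝ) ≤ j := Nat.cast_nonneg j
      linarith
    filter_upwards [this] with x hx hxx
    obtain ⟨j, hj⟩ := mem_iUnion.1 hxx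
    exact hx j hj
  · intro k hk t t' htt
    refine EE_comp hr hη.le hg ω hη.le hg k (fun x => hl.per x (-k) (neg_mem hk)) (fun j => ?_)
    obtain ⟨j', hj'⟩ := exists_nat_ge (j + ‖k‖)
    have hjj : j ≤ j' := by
      have : (j:ℝ) ≤ j' := by linarith [norm_nonneg k]
      exact_mod_cast this
    have h1 := hinv hjj
    refine ⟨j', ?_, ?_, Eventually.of_forall fun x => by have := hεa hjj; linarith, hj'⟩
    · simp only [hτ]; linarith
    · simp only [hA]; linarith [norm_nonneg k]
  · have : ∀ᵐ x ∂μ, ∀ j, x ∈ Em μ r g ω (τ 0) ε (A 0) j → x ∈ ⋃ i : ℕ, EE μ r g ω (τ (-(1/((i:ℝ)+1)))) ε (A (-(1/((i:ℝ)+1)))) := by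
      rw [ae_all_iff]
      intro j
      have hj0 : (0:ℝ) ≤ j := Nat.cast_nonneg j
      have e : 1/(((2*j+1 : ℕ):ℝ)+1) = 1/((j:ℝ)+1)/2 := by push_cast; field_simp; ring
      have c1 := Em_comp hr hη.le hg ω hη.le hg 0 (fun x => by simp) (τ := τ 0) (ε := ε) (A := A 0)
        (τ' := τ (-(1/(((2*j+1:ℕ):ℝ)+1)))) (ε' := ε) (A' := A (-(1/(((2*j+1:ℕ):ℝ)+1)))) (j := j) (j' := 2*j+1)
        (by simp only [hτ, inner_zero_right]; rw [e]; linarith)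
        (by simp only [hA, inner_zero_right]; rw [e]; push_cast
            have := hinv (Nat.zero_le j); simp only [Nat.cast_zero, zero_add] at this; linarith)
        (Eventually.of_forall fun x => by have := hεa (show j ≤ 2*j+1 by omega); linarith) (by push_cast; simp; linarith)
      rw [show tr (-0:V) (Em μ r g ω (τ 0) ε (A 0) j) = Em μ r g ω (τ 0) ε (A 0) j by ext x; simp [mem_tr]] at c1
      refine c1.trans (AL.of_sub ((subset_iUnion _ (2*j+1)).trans ?_))
      exact subset_iUnion (fun i : ℕ => EE μ r g ω (τ (-(1/((i:ℝ)+1)))) ε (A (-(1/((i:ℝ)+1))))) (2*j+1)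
    filter_upwards [this] with x hx hxx
    obtain ⟨j, hj⟩ := mem_iUnion.1 hxx
    exact hx j hj
  · intro t
    refine EE_OMin hr hr1 hη.le hg ω (hd t) hεt (fun j => HH_mono ω ?_) (fun R => ?_)
    · simp only [hτ]; linarith [hinv0 j]
    · obtain ⟨j0, hj0⟩ := exists_nat_ge (R - t)
      filter_upwards [eventually_ge_atTop j0] with j hj x hx
      have := hx.2
      rw [mem_ball_zero_iff] at this
      have h2 := abs_real_inner_le_norm ω x
      rw [hω, one_mul] at h2
      have h3 := le_of_abs_le h2
      have : (j0:ℝ) ≤ j := by exact_mod_cast hj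
      rw [mem_HH]; simp only [hA]; linarith

theorem rel_dense {Z : AddSubgroup V} {fl : V → V} {ρ0 : ℝ} {g : V → ℝ} (hl : LatP μ Z fl ρ0 g) {ω : V} (hω : ‖ω‖ = 1)
    {e : ℝ} (he : 0 < e) : ∃ C4 : ℝ, 0 < C4 ∧ ∀ x ∈ SL ω 0 1, ∃ k ∈ Z, 0 ≤ ⟪ω, k⟫ ∧ ⟪ω, k⟫ < e ∧ dist x k ≤ C4 := by
  have hρ0 : 0 < ρ0 := lt_of_le_of_lt dist_nonneg (hl.fld 0)
  have hωω : ⟪ω, ω⟫ = 1 := by rw [real_inner_self_eq_norm_sq, hω]; norm_num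
  obtain ⟨k0, hk0, hp, hsm⟩ : ∃ k0 ∈ Z, 0 < ⟪ω, k0⟫ ∧ ∀ k ∈ Z, 0 ≤ ⟪ω, k⟫ → ⟪ω, k⟫ < ⟪ω, k0⟫ → ⟪ω, k⟫ < e := by
    rcases AddSubgroup.dense_or_cyclic (Z.map (innerₛₗ ℝ ω).toAddMonoidHom) with h | ⟨a, ha⟩
    · obtain ⟨y, hy, hy2⟩ := h.exists_mem_open isOpen_Ioo (show (Ioo 0 e).Nonempty from ⟨e/2, by constructor <;> linarith⟩)
      obtain ⟨k0, hk0, rfl⟩ := hy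
      exact ⟨k0, hk0, hy2.1, fun k _ _ h => h.trans hy2.2⟩
    · have hmem : ∀ k ∈ Z, ∃ m : ℤ, m • a = ⟪ω, k⟫ := by
        intro k hk
        have : ⟪ω, k⟫ ∈ Z.map (innerₛₗ ℝ ω).toAddMonoidHom := ⟨k, hk, rfl⟩
        rw [ha, AddSubgroup.mem_closure_singleton] at this
        exact this
      have ha0 : a ≠ 0 := by
        intro h0
        obtain ⟨m, hm⟩ := hmem _ (hl.flZ ((1 + ρ0) • ω))
        rw [h0, smul_zero] at hm
        have h1 := hl.fld ((1 + ρ0) • ω)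
        have h2 := in_le hω ((1 + ρ0) • ω) (fl ((1 + ρ0) • ω))
        rw [inner_smul_right, hωω, abs_le] at h2
        linarith
      have hain : ∃ k0 ∈ Z, ⟪ω, k0⟫ = a := by
        have : a ∈ Z.map (innerₛₗ ℝ ω).toAddMonoidHom := by
          rw [ha]; exact AddSubgroup.subset_closure rfl
        obtain ⟨k0, hk0, h⟩ := this
        exact ⟨k0, hk0, h⟩
      obtain ⟨k1, hk1, hk1a⟩ := hain
      obtain ⟨k0, hk0, hk0a⟩ : ∃ k0 ∈ Z, ⟪ω, k0⟫ = |a| := by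
        rcases abs_choice a with h | h
        · exact ⟨k1, hk1, by rw [h, hk1a]⟩
        · exact ⟨-k1, neg_mem hk1, by rw [inner_neg_right, hk1a, h]⟩
      refine ⟨k0, hk0, by rw [hk0a]; positivity, fun k hk h0 h1 => ?_⟩
      obtain ⟨m, hm⟩ := hmem k hk
      rw [← hm, hk0a] at h1
      rw [← hm] at h0 ⊢
      have : |(m:ℝ)| * |a| < |a| := by
        rw [← abs_mul, ← zsmul_eq_mul, abs_of_nonneg h0]; exact h1
      have h2 : |(m:ℝ)| < 1 := by
        by_contra hn; push Not at hn
        nlinarith [abs_nonneg a]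
      have h3 : m = 0 := by
        have : |m| < 1 := by exact_mod_cast h2
        rwa [Int.abs_lt_one_iff] at this
      rw [h3, zero_smul]; exact he
  refine ⟨ρ0 + ((1+ρ0)/⟪ω, k0⟫ + 1) * ‖k0‖, by positivity, fun x hx => ?_⟩
  have hd := hl.fld x
  have hi := in_le hω x (fl x)
  rw [abs_le] at hi
  set m := ⌊⟪ω, fl x⟫ / ⟪ω, k0⟫⌋ with hm
  have m1 : (m:ℝ) ≤ ⟪ω, fl x⟫ / ⟪ω, k0⟫ := Int.floor_le _
  have m2 : ⟪ω, fl x⟫ / ⟪ω, k0⟫ < m + 1 := Int.lt_floor_add_one _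
  have mabs : |(m:ℝ)| ≤ (1+ρ0)/⟪ω, k0⟫ + 1 := by
    have a1 : ⟪ω, fl x⟫ / ⟪ω, k0⟫ ≤ (1+ρ0)/⟪ω, k0⟫ := by gcongr; linarith [hx.2]
    have a2 : -((1+ρ0)/⟪ω, k0⟫) ≤ ⟪ω, fl x⟫ / ⟪ω, k0⟫ := by
      rw [← neg_div]; gcongr; linarith [hx.1]
    rw [abs_le]; constructor <;> linarith
  rw [le_div_iff₀ hp] at m1
  rw [div_lt_iff₀ hp] at m2
  have hin : ⟪ω, fl x - m • k0⟫ = ⟪ω, fl x⟫ - m * ⟪ω, k0⟫ := by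
    rw [inner_sub_right, ← Int.cast_smul_eq_zsmul ℝ, inner_smul_right]
  have hkZ : fl x - m • k0 ∈ Z := sub_mem (hl.flZ x) (zsmul_mem hk0 m)
  have hpos : 0 ≤ ⟪ω, fl x - m • k0⟫ := by rw [hin]; linarith
  refine ⟨fl x - m • k0, hkZ, hpos, hsm _ hkZ hpos (by rw [hin]; linarith), ?_⟩
  have : dist x (fl x - m • k0) ≤ dist x (fl x) + |(m:ℝ)| * ‖k0‖ := by
    refine (dist_triangle x (fl x) _).trans ?_
    gcongr
    rw [dist_eq_norm, sub_sub_cancel, ← Int.cast_smul_eq_zsmul ℝ, norm_smul, Real.norm_eq_abs]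
  have h5 : |(m:ℝ)| * ‖k0‖ ≤ ((1+ρ0)/⟪ω, k0⟫ + 1) * ‖k0‖ := by gcongr
  linarith

theorem no_pack {ω : V} (hω : ‖ω‖ = 1) {T : Set V} {d R1 N C C4 α β : ℝ} (hd : 0 < d) (hR1 : 0 < R1) (hN : 0 < N) (hC : 0 < C)
    (hC4 : 0 < C4)
    (h1 : ∀ (ρ : ℝ) (S : Finset V), (∀ k ∈ S, k ∈ T ∧ ‖k‖ + R1 + 1 ≤ ρ) → (∀ k ∈ S, ∀ k' ∈ S, k ≠ k' → 2 * R1 ≤ dist k k') →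
      S.card * d ≤ N * μ.real (SL ω α β ∩ (ball 0 (ρ + C) \ ball (0:V) (ρ - C))))
    (h2 : ∀ x ∈ SL ω 0 1, ∃ k ∈ T, dist x k ≤ C4) : False := by
  obtain ⟨N1, C1, hN1, hC1, hs, -⟩ := slab_any (μ := μ) hω α β (show (0:ℝ) < 1 by norm_num)
  set C5 := C4 + 2 * R1 with hC5
  set v := μ.real (ball (0:V) C5) with hv
  have hv0 : 0 < v := ENNReal.toReal_pos (measure_ball_pos _ _ (by positivity)).ne' measure_ball_lt_top.ne
  set CC := C + C1 + R1 + 1 + C4 with hCC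
  refine growth_slab (μ := μ) hω (show (0:ℝ) < 1 by norm_num) (c := d / (v * N * N1)) (C := CC) (R0 := 0) (by positivity) (by positivity)
    (fun ρ _ => ?_)
  set Q : Finset V → Prop := fun S => (∀ k ∈ S, k ∈ T ∧ ‖k‖ + R1 + 1 ≤ ρ) ∧ (∀ k ∈ S, ∀ k' ∈ S, k ≠ k' → 2 * R1 ≤ dist k k') with hQ
  set A : Set ℕ := {m | ∃ S, Q S ∧ S.card = m} with hA
  have hAne : A.Nonempty := ⟨0, ∅, ⟨by simp, by simp⟩, rfl⟩
  set Y := N * μ.real (SL ω α β ∩ (ball 0 (ρ + C) \ ball (0:V) (ρ - C))) with hY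
  have hAb : BddAbove A := by
    refine ⟨⌈Y / d⌉₊, ?_⟩
    rintro m ⟨S, hS, rfl⟩
    have := h1 ρ S hS.1 hS.2
    rw [← le_div_iff₀ hd] at this
    exact_mod_cast this.trans (Nat.le_ceil _)
  obtain ⟨S, hS, hSc⟩ := Nat.sSup_mem hAne hAb
  have hmax : ∀ S', Q S' → S'.card ≤ S.card := fun S' h => by
    rw [hSc]; exact le_csSup hAb ⟨S', h, rfl⟩
  have hcov : SL ω 0 1 ∩ ball (0:V) (ρ - CC) ⊆ ⋃ k ∈ S, ball k C5 := by
    rintro x ⟨hx, hxb⟩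
    by_contra hn
    simp only [mem_iUnion, not_exists, mem_ball, not_lt] at hn
    obtain ⟨k, hkT, hk⟩ := h2 x hx
    rw [mem_ball_zero_iff] at hxb
    have hkn : ‖k‖ ≤ ‖x‖ + dist x k := by
      have := norm_le_norm_add_norm_sub' k x
      rw [dist_eq_norm, norm_sub_rev]; linarith [norm_sub_rev x k]
    have far : ∀ k' ∈ S, 2 * R1 ≤ dist k k' := by
      intro k' hk'
      have := hn k' hk'
      have := dist_triangle x k k'
      linarith
    have hkS : k ∉ S := fun h => by
      have := far k h; rw [dist_self] at this; linarith
    classical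
    have : Q (insert k S) := by
      refine ⟨?_, ?_⟩
      · intro j hj
        rcases Finset.mem_insert.1 hj with rfl | hj
        · exact ⟨hkT, by linarith⟩
        · exact hS.1 j hj
      · intro j hj j' hj' hne
        rcases Finset.mem_insert.1 hj with hj1 | hj1
        · rcases Finset.mem_insert.1 hj' with hj2 | hj2
          · exact absurd (hj1.trans hj2.symm) hne
          · rw [hj1]; exact far j' hj2
        · rcases Finset.mem_insert.1 hj' with hj2 | hj2
          · rw [hj2, dist_comm]; exact far j hj1
          · exact hS.2 j hj1 j' hj2 hne
    have := hmax _ this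
    rw [Finset.card_insert_of_notMem hkS] at this
    omega
  have hvol : μ.real (SL ω 0 1 ∩ ball (0:V) (ρ - CC)) ≤ S.card * v := by
    calc _ ≤ μ.real (⋃ k ∈ S, ball k C5) := mr_le hcov (fin_bdd ((Bornology.isBounded_biUnion_finset S).2 fun k _ => isBounded_ball))
      _ ≤ ∑ k ∈ S, μ.real (ball k C5) := measureReal_biUnion_finset_le _ _
      _ = S.card * v := by
        rw [Finset.sum_congr rfl (fun k _ => show μ.real (ball k C5) = v by
          rw [hv, measureReal_def, measureReal_def, Measure.addHaar_ball_center]), Finset.sum_const, nsmul_eq_mul]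
  have a1 := h1 ρ S hS.1 hS.2
  have a2 := hs (ρ - C) (ρ + C)
  have a3 : μ.real (SL ω 0 1 ∩ (ball 0 (ρ + C + C1) \ ball (0:V) (ρ - C - C1))) ≤
      μ.real (SL ω 0 1 ∩ (ball 0 (ρ + CC) \ ball (0:V) (ρ - CC))) :=
    shell_mono subset_rfl (by linarith) (by linarith)
  set q := μ.real (SL ω 0 1 ∩ (ball 0 (ρ + CC) \ ball (0:V) (ρ - CC)))
  rw [div_mul_eq_mul_div, div_le_iff₀ (by positivity)]
  calc _ ≤ d * (S.card * v) := by gcongr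
    _ = v * (S.card * d) := by ring
    _ ≤ v * (N * (N1 * q)) := by
        refine mul_le_mul_of_nonneg_left (a1.trans (mul_le_mul_of_nonneg_left (a2.trans ?_) hN.le)) hv0.le
        exact mul_le_mul_of_nonneg_left a3 hN1.le
    _ = _ := by ring

theorem pack_sum {r : ℝ} (hr : 0 < r) {g : V → ℝ} {b : ℝ} (hg : GB μ g b) {E B : Set V} (hE : MeasurableSet E)
    (hB : MeasurableSet B) (hBf : μ B ≠ ∞) {Y : V → Set V} {R1 d : ℝ} (S : Finset V)
    (hm : ∀ k ∈ S, MeasurableSet (Y k)) (hYE : ∀ k ∈ S, Y k ⊆ E)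
    (hoff : ∀ k ∈ S, ∀ᵐ x ∂μ, x ∉ ball k R1 → x ∈ E → x ∈ Y k)
    (hJ : ∀ k ∈ S, JJ μ r g B (Y k) ≤ JJ μ r g B E - d)
    (hsep : ∀ k ∈ S, ∀ k' ∈ S, k ≠ k' → 2 * R1 ≤ dist k k') :
    JJ μ r g B (E ∩ ⋂ k ∈ S, Y k) ≤ JJ μ r g B E - S.card * d := by
  classical
  induction S using Finset.induction_on with
  | empty => simp
  | insert k S hk ih =>
    have ih' := ih (fun j hj => hm j (Finset.mem_insert_of_mem hj)) (fun j hj => hYE j (Finset.mem_insert_of_mem hj))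
      (fun j hj => hoff j (Finset.mem_insert_of_mem hj)) (fun j hj => hJ j (Finset.mem_insert_of_mem hj))
      (fun j hj j' hj' => hsep j (Finset.mem_insert_of_mem hj) j' (Finset.mem_insert_of_mem hj'))
    have e1 : E ∩ ⋂ j ∈ insert k S, Y j = (E ∩ ⋂ j ∈ S, Y j) ∩ Y k := by
      rw [Finset.set_biInter_insert]; ext x; simp only [mem_inter_iff]; tauto
    have hall : ∀ᵐ x ∂μ, ∀ j ∈ insert k S, x ∉ ball j R1 → x ∈ E → x ∈ Y j := by
      exact (ae_ball_iff (Finset.countable_toSet _)).2 hoff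
    have e2 : JJ μ r g B ((E ∩ ⋂ j ∈ S, Y j) ∪ Y k) = JJ μ r g B E := by
      apply JJ_congr
      filter_upwards [hall] with x hx
      constructor
      · rintro (h | h)
        · exact h.1
        · exact hYE k (Finset.mem_insert_self _ _) h
      · intro hxE
        by_cases hxk : x ∈ ball k R1
        · left
          refine ⟨hxE, ?_⟩
          simp only [mem_iInter]
          intro j hj
          refine hx j (Finset.mem_insert_of_mem hj) (fun hxj => ?_) hxE
          have hne : k ≠ j := fun h => hk (h ▸ hj)
          have := hsep k (Finset.mem_insert_self _ _) j (Finset.mem_insert_of_mem hj) hne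
          rw [mem_ball] at hxk hxj
          have := dist_triangle_left k j x
          linarith
        · right; exact hx k (Finset.mem_insert_self _ _) hxk hxE
    have sm := JJ_submod hr hg hB hBf
      (hE.inter (Finset.measurableSet_biInter S fun j hj => hm j (Finset.mem_insert_of_mem hj))) (hm k (Finset.mem_insert_self _ _))
    rw [e2, ← e1] at sm
    have := hJ k (Finset.mem_insert_self _ _)
    rw [Finset.card_insert_of_notMem hk]
    push_cast
    linarith

theorem Fam.mono {r : ℝ} {g : V → ℝ} {ω : V} {Z : AddSubgroup V} {C1 : ℝ} {X : ℝ → Set V} (h : Fam μ r g ω Z C1 X) {t t' : ℝ}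
    (htt : t ≤ t') : AL μ (X t) (X t') := by
  have := h.shift 0 (zero_mem _) t t' (by rw [inner_zero_right]; linarith)
  rwa [show tr (-0:V) (X t) = X t by ext x; simp [mem_tr]] at this

theorem Fam.left {r : ℝ} (hr : 0 < r) {g : V → ℝ} {b : ℝ} (hg : GB μ g b) {ω : V} {Z : AddSubgroup V} {C1 : ℝ} {X : ℝ → Set V} (h : Fam μ r g ω Z C1 X)
    {D G : Set V} (hDm : MeasurableSet D) (hDf : μ D ≠ ∞) (hG : MeasurableSet G) (hGE : AL μ G (X 0)) {δ : ℝ} (hδ : 0 < δ) :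
    ∃ e : ℝ, 0 < e ∧ ∀ t, -e ≤ t → t ≤ 0 → JJ μ r g D (X 0) - δ < JJ μ r g D (X t ∪ G) := by
  by_contra hn
  push Not at hn
  have hn' : ∀ i : ℕ, ∃ t, -(1/((i:ℝ)+1)) ≤ t ∧ t ≤ 0 ∧ JJ μ r g D (X t ∪ G) ≤ JJ μ r g D (X 0) - δ :=
    fun i => hn _ Nat.one_div_pos_of_nat
  choose t ht1 ht2 ht3 using hn'
  set A : ℕ → Set V := fun i => ⋃ l ∈ Finset.range (i+1), (X (t l) ∪ G) with hA
  have hAm : ∀ i, MeasurableSet (A i) := fun i => Finset.measurableSet_biUnion _ fun l _ => (h.meas _).union hG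
  have hmono : Monotone A := by
    intro i j hij
    refine biUnion_subset_biUnion_left ?_
    intro l hl
    simp only [Finset.coe_range, mem_Iio] at hl ⊢
    omega
  obtain ⟨q, hq, hqA⟩ := lsc_mono hr hg hDm hDf hAm hmono
  have hall : ∀ᵐ x ∂μ, ∀ i j : ℕ, t i ≤ t j → x ∈ X (t i) → x ∈ X (t j) := by
    rw [ae_all_iff]; intro i
    rw [ae_all_iff]; intro j
    by_cases hij : t i ≤ t j
    · filter_upwards [h.mono hij] with x hx _; exact hx
    · exact Eventually.of_forall fun x hx => absurd hx hij
  have hAJ : ∀ i, JJ μ r g D (A i) ≤ JJ μ r g D (X 0) - δ := by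
    intro i
    obtain ⟨l, hl, hmax⟩ := Finset.exists_max_image (Finset.range (i+1)) t ⟨0, by simp⟩
    refine le_trans (le_of_eq (JJ_congr ?_)) (ht3 l)
    filter_upwards [hall] with x hx
    constructor
    · intro hxA
      simp only [hA, mem_iUnion] at hxA
      obtain ⟨j, hj, h' | h'⟩ := hxA
      · left; exact hx j l (hmax j hj) h'
      · right; exact h'
    · intro h'
      simp only [hA, mem_iUnion]
      exact ⟨l, hl, h'⟩
  have hU : JJ μ r g D (⋃ i, A i) = JJ μ r g D (X 0) := by
    apply JJ_congr
    have u1 : ∀ᵐ x ∂μ, ∀ i, x ∈ X (t i) → x ∈ X 0 := by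
      rw [ae_all_iff]; exact fun i => h.mono (ht2 i)
    have u2 : ∀ᵐ x ∂μ, ∀ i : ℕ, x ∈ X (-(1/((i:ℝ)+1))) → x ∈ X (t i) := by
      rw [ae_all_iff]; exact fun i => h.mono (ht1 i)
    filter_upwards [u1, u2, h.lc, hGE] with x a1 a2 a3 a4
    constructor
    · intro hx
      simp only [hA, mem_iUnion] at hx
      obtain ⟨i, j, -, h' | h'⟩ := hx
      · exact a1 j h'
      · exact a4 h'
    · intro hx
      obtain ⟨i, hi⟩ := mem_iUnion.1 (a3 hx)
      simp only [hA, mem_iUnion]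
      exact ⟨i, i, by simp, Or.inl (a2 i hi)⟩
  rw [hU] at hq
  have := le_of_tendsto' hq fun i => (hqA i).trans (hAJ i)
  linarith

theorem Fam.dip {r : ℝ} (hr : 0 < r) {g : V → ℝ} {b : ℝ} (hg : GB μ g b) {ω : V} {Z : AddSubgroup V} {C1 : ℝ} {X : ℝ → Set V} (h : Fam μ r g ω Z C1 X)
    {D G K : Set V} (hDm : MeasurableSet D) (hDf : μ D ≠ ∞) (hG : MeasurableSet G) (hGE : AL μ G (X 0))
    (hoff : ∀ᵐ x ∂μ, x ∉ K → x ∈ X 0 → x ∈ G) {δ : ℝ} (hδ : JJ μ r g D G = JJ μ r g D (X 0) - δ)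
    {k : V} (hk : k ∈ Z) (hper : ∀ x, g (x + -k) = g x) (hk0 : 0 ≤ ⟪ω, k⟫)
    (hl : JJ μ r g D (X 0) - δ/2 < JJ μ r g D (X (-⟪ω, k⟫) ∪ G)) :
    JJ μ r g (tr (-k) D) (X 0 ∩ tr (-k) G) ≤ JJ μ r g (tr (-k) D) (X 0) - δ/2 ∧
    ∀ᵐ x ∂μ, x ∉ tr (-k) K → x ∈ X 0 → x ∈ X 0 ∩ tr (-k) G := by
  have s1 : AL μ (tr k (X 0)) (X (-⟪ω, k⟫)) := by
    have := h.shift (-k) (neg_mem hk) 0 (-⟪ω, k⟫) (by rw [inner_neg_right]; linarith)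
    rwa [neg_neg] at this
  have s2 : AL μ (X (-⟪ω, k⟫)) (tr k (X 0)) := by
    have := h.shift k hk (-⟪ω, k⟫) 0 (by linarith)
    filter_upwards [ae_tr k this] with x hx hxx
    rw [mem_tr]
    refine hx ?_
    rw [mem_tr, add_neg_cancel_right]; exact hxx
  constructor
  · have e1 : X 0 ∩ tr (-k) G = tr (-k) (tr k (X 0) ∩ G) := by
      ext x; simp only [mem_inter_iff, mem_tr, neg_add_cancel_right]
    have e2 : X 0 = tr (-k) (tr k (X 0)) := by
      ext x; simp only [mem_tr, neg_add_cancel_right]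
    have e3 : JJ μ r g (tr (-k) D) (X 0) = JJ μ r g D (X (-⟪ω, k⟫)) := by
      conv_lhs => rw [e2]
      rw [JJ_tr (-k) hper]
      apply JJ_congr
      filter_upwards [s1, s2] with x a b
      exact ⟨a, b⟩
    rw [e3, e1, JJ_tr (-k) hper]
    have e4 : JJ μ r g D (tr k (X 0) ∩ G) = JJ μ r g D (X (-⟪ω, k⟫) ∩ G) := by
      apply JJ_congr
      filter_upwards [s1, s2] with x a b
      exact ⟨fun hx => ⟨a hx.1, hx.2⟩, fun hx => ⟨b hx.1, hx.2⟩⟩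
    rw [e4]
    have := JJ_submod hr hg hDm hDf (h.meas (-⟪ω, k⟫)) hG
    linarith
  · have s3 := s1.trans (h.mono (show -⟪ω, k⟫ ≤ 0 by linarith))
    filter_upwards [ae_tr (-k) s3, ae_tr (-k) hoff] with x a1 a2 hxK hxE
    refine ⟨hxE, a2 hxK (a1 ?_)⟩
    rw [mem_tr, neg_add_cancel_right]; exact hxE

theorem noobs {r : ℝ} (hr : 0 < r) (hr1 : r < 1) {g : V → ℝ} {b : ℝ} (hb : 0 ≤ b) (hg : GB μ g b) {ω : V} (hω : ‖ω‖ = 1)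
    {Z : AddSubgroup V} {fl : V → V} {ρ0 : ℝ} (hl : LatP μ Z fl ρ0 g) {C1 : ℝ} (hC1 : 0 < C1) {X : ℝ → Set V} (h : Fam μ r g ω Z C1 X) :
    OMin μ r g ∅ univ (X 0) := by
  intro F R hF _ _ hoff
  have hρ0 : 0 < ρ0 := lt_of_le_of_lt dist_nonneg (hl.fld 0)
  have hωω : ⟪ω, ω⟫ = 1 := by rw [real_inner_self_eq_norm_sq, hω]; norm_num
  set R1 := max R 1 with hR1
  have hR11 : 1 ≤ R1 := le_max_right _ _
  have hRR : R ≤ R1 := le_max_left _ _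
  have hE := h.meas 0
  have hoff1 : ∀ᵐ x ∂μ, x ∉ ball (0:V) R1 → (x ∈ X 0 ↔ x ∈ F) := by
    filter_upwards [hoff] with x hx hx1
    exact hx fun h => hx1 (ball_subset_ball hRR h)
  have ampK : Amp r (ball (0:V) R1) (ball (0:V) (R1+1)) := Amp.ball (by linarith)
  have red := JJ_diff hr hg (Amp.ball (x := (0:V)) (by linarith : R + r ≤ R + 1)) (ampK.anti (ball_subset_ball hRR)) hE hF hoff
  by_contra hcon
  push Not at hcon
  set D := ball (0:V) (R1+1) with hD
  have hDm : MeasurableSet D := measurableSet_ball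
  have hDf : μ D ≠ ∞ := ampK.fin
  set G := X 0 ∩ F with hGdef
  have hG : MeasurableSet G := hE.inter hF
  have hEF : JJ μ r g D (X 0) ≤ JJ μ r g D (X 0 ∪ F) := by
    refine (h.min 0).amp hr hr1 hg hE (hE.union hF) ampK ?_ (Eventually.of_forall fun x _ => trivial) ?_
    · filter_upwards [h.low 0] with x hx hxx; exact Or.inl (hx hxx)
    · filter_upwards [hoff1] with x hx hxx
      have := hx hxx
      simp only [mem_union]; tauto
  have sm := JJ_submod hr hg hDm hDf hE hF
  set δ := JJ μ r g D (X 0) - JJ μ r g D G with hδ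
  have hδ0 : 0 < δ := by linarith
  have hGE : AL μ G (X 0) := AL.of_sub inter_subset_left
  have hoffG : ∀ᵐ x ∂μ, x ∉ ball (0:V) R1 → x ∈ X 0 → x ∈ G := by
    filter_upwards [hoff1] with x hx hxx hxE
    exact ⟨hxE, (hx hxx).1 hxE⟩
  obtain ⟨e, he, hleft⟩ := h.left hr hg hDm hDf hG hGE (half_pos hδ0)
  obtain ⟨C4, hC4, hdense⟩ := rel_dense (μ := μ) hl hω he
  set T : Set V := {k | k ∈ Z ∧ 0 ≤ ⟪ω, k⟫ ∧ ⟪ω, k⟫ < e} with hT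
  set Y : V → Set V := fun k => X 0 ∩ tr (-k) G with hY
  have hYm : ∀ k, MeasurableSet (Y k) := fun k => hE.inter (meas_tr _ hG)
  have trb : ∀ (k : V) (s : ℝ), tr (-k) (ball (0:V) s) = ball k s := fun k s => by
    rw [tr_ball, zero_sub, neg_neg]
  have hdip : ∀ k ∈ T, JJ μ r g (ball k (R1+1)) (Y k) ≤ JJ μ r g (ball k (R1+1)) (X 0) - δ/2 ∧
      ∀ᵐ x ∂μ, x ∉ ball k R1 → x ∈ X 0 → x ∈ Y k := by
    rintro k ⟨hkZ, hk0, hke⟩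
    have := h.dip hr hg hDm hDf hG hGE hoffG (δ := δ) (by linarith) hkZ (fun x => hl.per x (-k) (neg_mem hkZ)) hk0
      (hleft _ (by linarith) (by linarith))
    rwa [hD, trb, trb] at this
  set p := fl ((R1 + ρ0) • ω) with hp
  have hpZ : p ∈ Z := hl.flZ _
  have hpω : R1 ≤ ⟪ω, p⟫ := by
    have h1 := hl.fld ((R1 + ρ0) • ω)
    have h2 := in_le hω ((R1 + ρ0) • ω) (fl ((R1 + ρ0) • ω))
    rw [inner_smul_right, hωω, abs_le] at h2
    linarith
  obtain ⟨N, C, hN, hC, hsh⟩ := shiftJ (μ := μ) hl hb hg hr hr1 hω (neg_mem hpZ)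
  set α := -R1 - C - 1 with hα
  set β := C1 + C + ⟪ω, p⟫ + 1 with hβ
  refine no_pack (μ := μ) hω (T := T) (d := δ/2) (R1 := R1) (N := N + 1) (C := C + 3) (C4 := C4) (α := α) (β := β)
    (by linarith) (by linarith) (by linarith) (by linarith) hC4 ?_ ?_
  swap
  · intro x hx
    obtain ⟨k, hk, h0, h1, h2⟩ := hdense x hx
    exact ⟨k, ⟨hk, h0, h1⟩, h2⟩
  intro ρ S hS hsep
  set FS := X 0 ∩ ⋂ k ∈ S, Y k with hFS
  have hFSm : MeasurableSet FS := hE.inter (Finset.measurableSet_biInter S fun j _ => hYm j)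
  have hallS : ∀ᵐ x ∂μ, ∀ j ∈ S, x ∉ ball j R1 → x ∈ X 0 → x ∈ Y j :=
    (ae_ball_iff (Finset.countable_toSet _)).2 fun k hk => (hdip k (hS k hk).1).2
  have lowFS : AL μ (HH ω (-R1)) FS := by
    filter_upwards [hallS, (AL.of_sub (HH_mono ω (show -R1 ≤ 0 by linarith))).trans (h.low 0)] with x a1 a2 hx
    refine ⟨a2 hx, ?_⟩
    simp only [mem_iInter]
    intro j hj
    refine a1 j hj (fun hxj => ?_) (a2 hx)
    rw [mem_ball] at hxj
    have := in_le hω x j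
    rw [abs_le] at this
    have := (hS j hj).1.2.1
    rw [mem_HH] at hx
    linarith
  have upFS : AL μ FS (HH ω C1) := by
    have := (AL.of_sub (inter_subset_left : FS ⊆ X 0)).trans (h.up 0)
    rwa [zero_add] at this
  have hJS : ∀ s, ρ ≤ s → JJ μ r g (ball 0 s) FS ≤ JJ μ r g (ball 0 s) (X 0) - S.card * (δ/2) := by
    intro s hs
    refine pack_sum hr hg hE measurableSet_ball measure_ball_lt_top.ne S (fun k _ => hYm k) (fun k _ => inter_subset_left)
      (fun k hk => (hdip k (hS k hk).1).2) (fun k hk => ?_) hsep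
    have a1 : Amp r (ball k R1) (ball k (R1+1)) := Amp.ball (by linarith)
    have a2 : Amp r (ball k R1) (ball 0 s) := by
      refine (Amp.ball (x := (0:V)) (show (s-1) + r ≤ s by linarith)).anti (fun x hx => ?_)
      rw [mem_ball, dist_zero_right]
      rw [mem_ball] at hx
      have := (hS k hk).2
      have := norm_le_norm_add_norm_sub' x k
      rw [dist_eq_norm] at hx
      linarith
    have := JJ_diff hr hg a1 a2 hE (hYm k) (by
      filter_upwards [(hdip k (hS k hk).1).2] with x hx hxx
      exact ⟨fun h => hx hxx h, fun h => h.1⟩)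
    have := (hdip k (hS k hk).1).1
    linarith
  set A := tr (-p) FS with hA
  have hAm : MeasurableSet A := meas_tr _ hFSm
  have lowA : AL μ (HH ω 0) A := by
    have := ae_tr (-p) lowFS
    filter_upwards [this] with x hx hxx
    rw [hA, mem_tr]
    refine hx ?_
    rw [mem_HH] at hxx ⊢
    rw [inner_add_right, inner_neg_right]; linarith
  have upA : AL μ A (HH ω (C1 + ⟪ω, p⟫)) := by
    have := ae_tr (-p) upFS
    filter_upwards [this] with x hx hxx
    have := hx hxx
    rw [mem_HH] at this ⊢
    rw [inner_add_right, inner_neg_right] at this; linarith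
  obtain ⟨s, hs1, hs2, hst⟩ := star hr hr1 hg (h.min 0) hE hAm (h.low 0) (Eventually.of_forall fun x _ => trivial) lowA
    (Eventually.of_forall fun x _ => trivial) (W := SL ω 0 (C1 + ⟪ω, p⟫)) (Wp := SL ω α β) (by
      filter_upwards [h.low 0, h.up 0, lowA, upA] with x a1 a2 a3 a4 hx
      by_cases hx0 : ⟪ω, x⟫ ≤ 0
      · exact ⟨fun _ => a1 hx0, fun _ => a3 hx0⟩
      · push Not at hx0
        have hn : ¬ ⟪ω, x⟫ ≤ C1 + ⟪ω, p⟫ := fun hle => hx ⟨hx0.le, hle⟩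
        refine ⟨fun hh => absurd (a4 hh) hn, fun hh => absurd (a2 hh) ?_⟩
        intro hle
        rw [mem_HH] at hle
        exact hn (by linarith))
    ((PP_slab hω hr1).trans (SL_mono ω (by linarith) (by linarith))) ρ
  have b1 := hsh FS (-R1) C1 hFSm (by linarith) lowFS upFS s
  have b2 := hJS s hs1
  have b3 : μ.real (SL ω α β ∩ (ball 0 (ρ + 3) \ ball (0:V) ρ)) ≤
      μ.real (SL ω α β ∩ (ball 0 (ρ + (C+3)) \ ball (0:V) (ρ - (C+3)))) := shell_mono subset_rfl (by linarith) (by linarith)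
  have b4 : μ.real (SL ω (-R1 - C) (C1 + C) ∩ (ball 0 (s + C) \ ball (0:V) (s - C))) ≤
      μ.real (SL ω α β ∩ (ball 0 (ρ + (C+3)) \ ball (0:V) (ρ - (C+3)))) :=
    shell_mono (SL_mono ω (by linarith) (by linarith)) (by linarith) (by linarith)
  have b5 := mul_le_mul_of_nonneg_left b4 hN.le
  linarith

theorem frontier_mid {W : Type*} [TopologicalSpace W] {B S : Set W} (hB : IsPreconnected B) (h1 : (B ∩ S).Nonempty)
    (h2 : (B ∩ Sᶜ).Nonempty) : (B ∩ frontier S).Nonempty := by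
  by_contra hn
  have hd : ∀ x ∈ B, x ∈ interior S ∨ x ∈ interior Sᶜ := by
    intro x hx
    by_contra hc
    push Not at hc
    refine hn ⟨x, hx, ?_⟩
    rw [frontier_eq_closure_inter_closure]
    refine ⟨?_, ?_⟩
    · by_contra h; rw [interior_compl] at hc; exact hc.2 h
    · rw [closure_compl]; exact hc.1
  obtain ⟨y, -, hy1, hy2⟩ := hB _ _ isOpen_interior isOpen_interior (fun x hx => hd x hx)
    (by obtain ⟨x, hx, hxS⟩ := h1
        refine ⟨x, hx, (hd x hx).resolve_right fun h => interior_subset h hxS⟩)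
    (by obtain ⟨x, hx, hxS⟩ := h2
        refine ⟨x, hx, (hd x hx).resolve_left fun h => hxS (interior_subset h)⟩)
  exact interior_subset hy2 (interior_subset hy1)

theorem dens_ae {n : ℕ} {E : Set (EuclideanSpace ℝ (Fin n))} (hE : MeasurableSet E) :
    ∀ᵐ x : EuclideanSpace ℝ (Fin n) ∂volume, x ∈ densityOnePoints n E ↔ x ∈ E := by
  filter_upwards [Besicovitch.ae_tendsto_measure_inter_div_of_measurableSet volume hE] with x hx
  have hev : (fun ρ : ℝ => volume (E ∩ closedBall x ρ) / volume (closedBall x ρ)) =ᶠ[𝓝[>] 0]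
      fun ρ : ℝ => volume (E ∩ ball x ρ) / volume (ball x ρ) := by
    filter_upwards [self_mem_nhdsWithin] with ρ hρ
    have hs := measure_eq_zero_iff_ae_notMem.1 (Measure.addHaar_sphere_of_ne_zero (volume : Measure (EuclideanSpace ℝ (Fin n))) x (ne_of_gt hρ))
    have hb : ∀ᵐ y : EuclideanSpace ℝ (Fin n) ∂volume, y ∈ closedBall x ρ ↔ y ∈ ball x ρ := by
      filter_upwards [hs] with y hy
      rw [mem_sphere] at hy
      rw [mem_ball, mem_closedBall]
      exact ⟨fun h => lt_of_le_of_ne h hy, le_of_lt⟩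
    have e1 : volume (closedBall x ρ) = volume (ball x ρ) := measure_congr (eventuallyEq_set.2 hb)
    have e2 : volume (E ∩ closedBall x ρ) = volume (E ∩ ball x ρ) := by
      apply measure_congr
      rw [eventuallyEq_set]
      filter_upwards [hb] with y hy
      simp only [mem_inter_iff, hy]
    rw [e1, e2]
  have hx' := hx.congr' hev
  by_cases hxE : x ∈ E
  · rw [indicator_of_mem hxE] at hx'
    exact ⟨fun _ => hxE, fun _ => hx'⟩
  · rw [indicator_of_notMem hxE] at hx'
    refine ⟨fun h => ?_, fun h => absurd h hxE⟩
    have := tendsto_nhds_unique hx' h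
    simp at this

theorem thick_NN {n : ℕ} {r : ℝ} {E : Set (EuclideanSpace ℝ (Fin n))} (hE : MeasurableSet E) :
    thickening r (frontier (densityOnePoints n E)) = NN volume r E := by
  have hd := dens_ae hE
  ext y
  rw [mem_thickening_iff]
  constructor
  · rintro ⟨z, hz, hyz⟩
    rw [frontier_eq_closure_inter_closure] at hz
    have hzb : z ∈ ball y r := by rwa [mem_ball, dist_comm]
    obtain ⟨w, hwb, hw⟩ := mem_closure_iff.1 hz.1 _ isOpen_ball hzb
    obtain ⟨w', hwb', hw'⟩ := mem_closure_iff.1 hz.2 _ isOpen_ball hzb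
    have sub : ∀ {w}, w ∈ ball y r → ∀ᶠ ρ in 𝓝[>] (0:ℝ), ball w ρ ⊆ ball y r := by
      intro w hw
      have : 0 < r - dist w y := by rw [mem_ball] at hw; linarith
      filter_upwards [Ioo_mem_nhdsGT this] with ρ hρ
      exact ball_subset_ball' (by linarith [hρ.2])
    constructor
    · by_contra hn
      rw [notPP] at hn
      have : Tendsto (fun ρ : ℝ => volume (E ∩ ball w ρ) / volume (ball w ρ)) (𝓝[>] 0) (𝓝 0) := by
        refine tendsto_const_nhds.congr' ?_
        filter_upwards [sub hwb] with ρ hρ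
        have : volume (E ∩ ball w ρ) = 0 := by
          rw [measure_eq_zero_iff_ae_notMem]
          filter_upwards [hn] with x hx hxx
          exact hx (hρ hxx.2) hxx.1
        rw [this, ENNReal.zero_div]
      have := tendsto_nhds_unique this hw
      simp at this
    · by_contra hn
      rw [notPP] at hn
      apply hw'
      refine tendsto_const_nhds.congr' ?_
      filter_upwards [sub hwb', self_mem_nhdsWithin] with ρ hρ hρ0
      have : volume (E ∩ ball w' ρ) = volume (ball w' ρ) := by
        apply measure_congr
        rw [eventuallyEq_set]
        filter_upwards [hn] with x hx
        refine ⟨fun h => h.2, fun h => ⟨?_, h⟩⟩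
        by_contra hxE
        exact hx (hρ h) hxE
      rw [this, ENNReal.div_self (measure_ball_pos _ _ hρ0).ne' measure_ball_lt_top.ne]
  · rintro ⟨h1, h2⟩
    have pos : ∀ {A B : Set (EuclideanSpace ℝ (Fin n))}, y ∈ PP volume r A →
        (∀ᵐ x : EuclideanSpace ℝ (Fin n) ∂volume, x ∈ B ↔ x ∈ A) → (ball y r ∩ B).Nonempty := by
      intro A B hA hAB
      by_contra hn
      refine notPP.2 ?_ hA
      filter_upwards [hAB] with x hx hxb hxA
      exact hn ⟨x, hxb, hx.2 hxA⟩
    obtain ⟨z, hzb, hz⟩ := frontier_mid (convex_ball y r).isPreconnected (pos h1 hd)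
      (pos h2 (by filter_upwards [hd] with x hx; simp only [mem_compl_iff, hx]))
    exact ⟨z, hz, by rw [dist_comm]; exact hzb⟩

theorem FRG_JJ {n : ℕ} {r : ℝ} (hr : 0 < r) {g : EuclideanSpace ℝ (Fin n) → ℝ} {E : Set (EuclideanSpace ℝ (Fin n))}
    (hE : MeasurableSet E) (x : EuclideanSpace ℝ (Fin n)) (ρ : ℝ) :
    FRG n r g E (ball x ρ) = ((JJ volume r g (ball x ρ) E : ℝ) : EReal) := by
  unfold FRG perR JJ
  rw [thick_NN hE, EReal.coe_add]
  congr 1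
  have hne : volume (NN volume r E ∩ ball x ρ) / ENNReal.ofReal (2 * r) ≠ ⊤ :=
    ENNReal.div_ne_top (fin_inter measure_ball_lt_top.ne) (by rw [Ne, ENNReal.ofReal_eq_zero]; linarith)
  rw [← EReal.coe_ennreal_toReal hne, ENNReal.toReal_div, ENNReal.toReal_ofReal (by linarith), measureReal_def]

theorem inner_sub {n : ℕ} {r ρ : ℝ} (hρ : 0 < ρ) {ω : EuclideanSpace ℝ (Fin n)} (hω : ‖ω‖ = 1) (x : EuclideanSpace ℝ (Fin n)) :
    innerDomain n r (ball x ρ) ⊆ closedBall x (ρ - r) := by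
  rintro z ⟨hz, hzr⟩
  rw [frontier_ball x hρ.ne'] at hzr
  obtain ⟨u, hu, huz⟩ : ∃ u : EuclideanSpace ℝ (Fin n), ‖u‖ = 1 ∧ z - x = ‖z - x‖ • u := by
    by_cases h0 : z - x = 0
    · exact ⟨ω, hω, by rw [h0]; simp⟩
    · have hn : ‖z - x‖ ≠ 0 := norm_ne_zero_iff.2 h0
      exact ⟨‖z - x‖⁻¹ • (z - x), by rw [norm_smul, norm_inv, norm_norm, inv_mul_cancel₀ hn],
        by rw [smul_smul, mul_inv_cancel₀ hn, one_smul]⟩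
  have hw : x + ρ • u ∈ sphere x ρ := by
    rw [mem_sphere, dist_eq_norm, add_sub_cancel_left, norm_smul, hu, mul_one, Real.norm_of_nonneg hρ.le]
  have h1 := hzr.trans (infDist_le_dist_of_mem hw)
  have h2 : dist z (x + ρ • u) = ρ - ‖z - x‖ := by
    rw [dist_eq_norm, show z - (x + ρ • u) = (z - x) - ρ • u by abel]
    rw [mem_ball, dist_eq_norm] at hz
    conv_lhs => rw [huz]
    rw [← sub_smul, norm_smul, hu, mul_one, Real.norm_eq_abs, abs_of_nonpos (by linarith)]
    ring
  rw [mem_closedBall, dist_eq_norm]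
  linarith

/-- the integer lattice -/
def ZZ (n : ℕ) : AddSubgroup (EuclideanSpace ℝ (Fin n)) where
  carrier := range (intVec n)
  zero_mem' := ⟨0, by ext i; simp [intVec]⟩
  add_mem' := by
    rintro _ _ ⟨a, rfl⟩ ⟨b, rfl⟩
    exact ⟨a + b, by ext i; simp [intVec]⟩
  neg_mem' := by
    rintro _ ⟨a, rfl⟩
    exact ⟨-a, by ext i; simp [intVec]⟩

def flr (n : ℕ) (x : EuclideanSpace ℝ (Fin n)) : EuclideanSpace ℝ (Fin n) := intVec n (fun i => ⌊x i⌋)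

theorem intVec_apply (n : ℕ) (k : Fin n → ℤ) (i : Fin n) : intVec n k i = k i := by simp [intVec]

theorem latP {n : ℕ} {g : EuclideanSpace ℝ (Fin n) → ℝ}
    (hper : ∀ (k : Fin n → ℤ) (x : EuclideanSpace ℝ (Fin n)), g (x + intVec n k) = g x)
    (hz : (∫ x in {x : EuclideanSpace ℝ (Fin n) | ∀ i, x i ∈ Set.Icc (0 : ℝ) 1}, g x) = 0) :
    LatP volume (ZZ n) (flr n) (n + 1) g where
  cnt := countable_range _
  flm := by
    have : Measurable fun x : EuclideanSpace ℝ (Fin n) => (WithLp.toLp 2 (fun i => ((⌊x i⌋ : ℤ) : ℝ)) : EuclideanSpace ℝ (Fin n)) := by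
      apply (WithLp.measurable_toLp 2 (Fin n → ℝ)).comp
      refine measurable_pi_lambda _ fun i => ?_
      have h1 : Measurable fun x : EuclideanSpace ℝ (Fin n) => x i := by fun_prop
      have h2 : Measurable fun m : ℤ => (m : ℝ) := measurable_from_top
      exact h2.comp (Int.measurable_floor.comp h1)
    exact this
  flZ := fun x => ⟨_, rfl⟩
  fld := by
    intro x
    rw [EuclideanSpace.dist_eq]
    have h1 : ∑ i, dist (x i) (flr n x i) ^ 2 ≤ (n : ℝ) := by
      calc _ ≤ ∑ i : Fin n, (1:ℝ) := by
            refine Finset.sum_le_sum fun i _ => ?_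
            rw [flr, intVec_apply, Real.dist_eq, sq_abs]
            have a := Int.floor_le (x i)
            have b := Int.lt_floor_add_one (x i)
            nlinarith
        _ = n := by simp
    have h2 : Real.sqrt (∑ i, dist (x i) (flr n x i) ^ 2) ≤ Real.sqrt n := Real.sqrt_le_sqrt h1
    have h3 : Real.sqrt n < n + 1 := by
      rw [Real.sqrt_lt' (by positivity)]
      have : (0:ℝ) ≤ n := Nat.cast_nonneg n
      nlinarith
    linarith
  fla := by
    rintro x _ ⟨k, rfl⟩
    ext i
    simp [flr, intVec_apply]
  per := by rintro x _ ⟨k, rfl⟩; exact hper k x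
  zero := by
    rintro _ ⟨k, rfl⟩
    have e1 : flr n ⁻¹' {intVec n k} = tr (-intVec n k) {x | ∀ i, x i ∈ Ico (0:ℝ) 1} := by
      ext x
      rw [mem_preimage, mem_singleton_iff, mem_tr]
      have : flr n x = intVec n k ↔ ∀ i, ⌊x i⌋ = k i := by
        constructor
        · intro h i
          have := congrArg (fun y : EuclideanSpace ℝ (Fin n) => y i) h
          simp only [flr, intVec_apply] at this
          exact_mod_cast this
        · intro h; unfold flr; congr 1; ext i; exact h i
      rw [this]
      refine forall_congr' fun i => ?_
      rw [Int.floor_eq_iff]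
      simp only [PiLp.add_apply, PiLp.neg_apply, intVec_apply, mem_Ico]
      constructor <;> rintro ⟨a, b⟩ <;> constructor <;> linarith
    have hneg : ∀ x, g (x + -intVec n k) = g x := fun x => by
      have := hper k (x + -intVec n k)
      rw [neg_add_cancel_right] at this; exact this.symm
    rw [e1, int_tr _ hneg]
    refine Eq.trans ?_ hz
    apply setIntegral_congr_set
    rw [eventuallyEq_set]
    have : ∀ᵐ x : EuclideanSpace ℝ (Fin n) ∂volume, ∀ i, x i ≠ 1 := by
      rw [ae_all_iff]
      intro i
      filter_upwards [plane_null (μ := volume) (ω := EuclideanSpace.single i (1:ℝ)) (by simp) 1] with x hx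
      rw [EuclideanSpace.inner_single_left] at hx
      simpa using hx
    filter_upwards [this] with x hx
    simp only [mem_setOf_eq, mem_Ico, mem_Icc]
    refine forall_congr' fun i => ?_
    exact ⟨fun h => ⟨h.1, h.2.le⟩, fun h => ⟨h.1, lt_of_le_of_ne h.2 (hx i)⟩⟩

end Body

/-- Existence of planelike minimizers in periodic media: there are `η ∈ (0,1)` and `M > 1`,
depending only on `n`, such that for every `r ∈ (0,1)`, every measurable `ℤⁿ`-periodic `g` with
zero average on the unit cube and `‖g‖_∞ ≤ η`, and every unit direction `ω`, there is a
Class A minimizer `E*` of `F_{r,g}` with `{ω·x ≤ -M} ⊆ E* ⊆ {ω·x ≤ M}`; if `ω` is rational,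
`E*` is moreover `ω`-periodic. -/
theorem planelike_minimizers (n : ℕ) (hn : 1 ≤ n) :
    ∃ η : ℝ, η ∈ Set.Ioo (0 : ℝ) 1 ∧ ∃ M : ℝ, 1 < M ∧
      ∀ r : ℝ, r ∈ Set.Ioo (0 : ℝ) 1 →
      ∀ g : EuclideanSpace ℝ (Fin n) → ℝ, Measurable g →
        (∀ (k : Fin n → ℤ) (x : EuclideanSpace ℝ (Fin n)), g (x + intVec n k) = g x) →
        (∫ x in {x : EuclideanSpace ℝ (Fin n) | ∀ i, x i ∈ Set.Icc (0 : ℝ) 1}, g x) = 0 →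
        (∀ᵐ x : EuclideanSpace ℝ (Fin n) ∂volume, |g x| ≤ η) →
      ∀ ω : EuclideanSpace ℝ (Fin n), ‖ω‖ = 1 →
        ∃ E : Set (EuclideanSpace ℝ (Fin n)), MeasurableSet E ∧
          (∀ (x : EuclideanSpace ℝ (Fin n)) (ρ : ℝ), 0 < ρ →
            IsMinimizerFRG n r g E (ball x ρ)) ∧
          {x : EuclideanSpace ℝ (Fin n) | ⟪ω, x⟫ ≤ -M} ⊆ E ∧
          E ⊆ {x : EuclideanSpace ℝ (Fin n) | ⟪ω, x⟫ ≤ M} ∧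
          ((∃ K : Fin (n - 1) → (Fin n → ℤ), LinearIndependent ℤ K ∧
              ∀ j, ⟪ω, intVec n (K j)⟫ = 0) →
            ∀ k : Fin n → ℤ, ⟪ω, intVec n k⟫ = 0 →
              (fun x => x + intVec n k) '' E = E) := by
  have : Nonempty (Fin n) := ⟨⟨0, hn⟩⟩
  have : Nontrivial (EuclideanSpace ℝ (Fin n)) := inferInstance
  obtain ⟨η, C1, hη, hη2, hC1, hfam⟩ := exists_fam (volume : Measure (EuclideanSpace ℝ (Fin n))) (show (0:ℝ) < n + 1 by positivity)
  refine ⟨η, ⟨hη, by linarith⟩, C1 + 1, by linarith, ?_⟩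
  rintro r ⟨hr, hr1⟩ g hgm hper hz hgb ω hω
  have hl := latP hper hz
  have hg : GB volume g η := ⟨hgm, hgb⟩
  obtain ⟨X, hX⟩ := hfam r g ω (ZZ n) (flr n) hr hr1 hω hl hg
  have hmin := noobs hr hr1 hη.le hg hω hl hC1 hX
  set I : Set (Fin n → ℤ) := {k | ⟪ω, intVec n k⟫ = 0} with hI
  set E : Set (EuclideanSpace ℝ (Fin n)) := ((⋂ k ∈ I, tr (intVec n k) (X 0)) ∪ HH ω (-(C1+1))) ∩ HH ω (C1 + 1) with hE
  have hEm : MeasurableSet E :=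
    ((MeasurableSet.biInter (to_countable I) fun k _ => meas_tr _ (hX.meas 0)).union (meas_HH _ _)).inter (meas_HH _ _)
  have hae : ∀ᵐ x : EuclideanSpace ℝ (Fin n) ∂volume, x ∈ X 0 ↔ x ∈ E := by
    have h1 : ∀ᵐ x : EuclideanSpace ℝ (Fin n) ∂volume, ∀ k ∈ I, x ∈ X 0 → x ∈ tr (intVec n k) (X 0) := by
      refine (ae_ball_iff (to_countable I)).2 fun k hk => ?_
      have := ae_tr (intVec n k) (hX.shift (intVec n k) ⟨k, rfl⟩ 0 0 (by rw [show ⟪ω, intVec n k⟫ = 0 from hk]; simp))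
      filter_upwards [this] with x hx hxx
      rw [mem_tr]
      refine hx ?_
      rw [mem_tr, add_neg_cancel_right]; exact hxx
    filter_upwards [h1, hX.low 0, hX.up 0] with x a1 a2 a3
    constructor
    · intro hx
      refine ⟨Or.inl ?_, HH_mono ω (by linarith) (a3 hx)⟩
      simp only [mem_iInter]
      exact fun k hk => a1 k hk hx
    · rintro ⟨h | h, -⟩
      · simp only [mem_iInter] at h
        have := h 0 (by
          show ⟪ω, intVec n 0⟫ = 0
          rw [show intVec n 0 = 0 by ext i; simp [intVec_apply]]; simp)
        rw [mem_tr, show intVec n 0 = 0 by ext i; simp [intVec_apply], add_zero] at this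
        exact this
      · exact a2 (HH_mono ω (by linarith) h)
  refine ⟨E, hEm, ?_, ?_, ?_, ?_⟩
  · intro x ρ hρ F hF hFE
    rw [FRG_JJ hr hEm, FRG_JJ hr hF, EReal.coe_le_coe_iff, ← JJ_congr hae]
    refine hmin.amp hr hr1 hg (hX.meas 0) hF (K := closedBall x (ρ - r)) (Amp.closedBall (by linarith))
      (Eventually.of_forall fun x hx => absurd hx (notMem_empty x)) (Eventually.of_forall fun x _ => trivial) ?_
    filter_upwards [hae] with y hy hyK
    rw [hy]
    have hyi : y ∉ innerDomain n r (ball x ρ) := fun h => hyK (inner_sub hρ hω x h)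
    have := Set.ext_iff.1 hFE y
    simp only [mem_diff, hyi, not_false_eq_true, and_true] at this
    exact this.symm
  · intro x hx
    refine ⟨Or.inr hx, ?_⟩
    rw [mem_HH]
    have : ⟪ω, x⟫ ≤ -(C1 + 1) := hx
    linarith
  · intro x hx; exact hx.2
  · intro _ k hk
    have inv : ∀ j, ⟪ω, intVec n j⟫ = 0 → ∀ x, x ∈ E → x + intVec n j ∈ E := by
      intro j hj x hx
      have hin : ⟪ω, x + intVec n j⟫ = ⟪ω, x⟫ := by rw [inner_add_right, hj, add_zero]
      refine ⟨?_, by rw [mem_HH, hin]; exact hx.2⟩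
      rcases hx.1 with h | h
      · left
        simp only [mem_iInter] at h ⊢
        intro i hi
        have := h (j + i) (by
          show ⟪ω, intVec n (j + i)⟫ = 0
          rw [show intVec n (j + i) = intVec n j + intVec n i by ext l; simp [intVec_apply], inner_add_right, hj, zero_add]
          exact hi)
        rw [mem_tr] at this ⊢
        rw [show intVec n (j + i) = intVec n j + intVec n i by ext l; simp [intVec_apply], ← add_assoc] at this
        exact this
      · right; rw [mem_HH, hin]; exact h
    have hnk : intVec n (-k) = - intVec n k := by ext l; simp [intVec_apply]
    ext x
    constructor
    · rintro ⟨y, hy, rfl⟩; exact inv k hk y hy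
    · intro hx
      refine ⟨x + intVec n (-k), inv (-k) (by rw [hnk, inner_neg_right, hk, neg_zero]) x hx, ?_⟩
      simp only [hnk, neg_add_cancel_right]
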